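/- arXiv:2406.13334 — 2 statements merged into one kernel-verified Lean document; each statement's English description precedes it below -/
import Mathlib

section
/- Let g, a, q be integers with g ≥ 31699, q ≥ 1, gcd(a, q, g²−1) = 1, and g ∤ gcd(a, q). Then there are infinitely many primes p such that the base-g digital reverse ←p satisfies ←p ≡ a (mod q). -/
/-- The base-`g` digital reverse of a natural number. -/
def digitRev (g n : ℕ) : ℕ := Nat.ofDigits g ((Nat.digits g n).reverse)

open Finset Real
open scoped ArithmeticFunction.vonMangoldt

/-- The additive character `x ↦ exp (2πix)`. -/
noncomputable def ex (x : ℝ) : ℂ := Complex.exp ((2 * π * x : ℝ) * Complex.I)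

lemma ex_add (x y : ℝ) : ex (x + y) = ex x * ex y := by
  simp only [ex, ← Complex.exp_add]; congr 1; push_cast; ring

lemma ex_zero : ex 0 = 1 := by simp [ex]

lemma norm_ex (x : ℝ) : ‖ex x‖ = 1 := by simp only [ex, Complex.norm_exp_ofReal_mul_I]

lemma ex_int (n : ℤ) : ex n = 1 := by
  simp only [ex]
  rw [Complex.exp_eq_one_iff]
  exact ⟨n, by push_cast; ring⟩

lemma ex_add_int (x : ℝ) (n : ℤ) : ex (x + n) = ex x := by rw [ex_add, ex_int, mul_one]

lemma ex_neg (x : ℝ) : ex (-x) = (starRingEnd ℂ) (ex x) := by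
  simp only [ex, ← Complex.exp_conj]; congr 1; simp [Complex.conj_ofNat]

lemma ex_nat_mul (n : ℕ) (x : ℝ) : ex (n * x) = ex x ^ n := by
  simp only [ex, ← Complex.exp_nat_mul]; congr 1; push_cast; ring

lemma norm_ex_sub_one (x : ℝ) : ‖ex x - 1‖ = 2 * |sin (π * x)| := by
  have h := Complex.norm_exp_I_mul_ofReal_sub_one (2 * π * x)
  rw [ex, mul_comm, h, norm_mul]
  simp only [Real.norm_eq_abs, abs_two]
  congr 3; ring

lemma norm_sum_ex_mul_sin (n : ℕ) (x : ℝ) :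
    ‖∑ j ∈ range n, ex (j * x)‖ * |sin (π * x)| = |sin (π * (n * x))| := by
  have h : (∑ j ∈ range n, ex (j * x)) * (ex x - 1) = ex (n * x) - 1 := by
    simp_rw [ex_nat_mul]
    exact geom_sum_mul _ _
  have h2 := congrArg norm h
  rw [norm_mul, norm_ex_sub_one, norm_ex_sub_one] at h2
  linarith

lemma norm_sum_ex_le (n : ℕ) (x : ℝ) : ‖∑ j ∈ range n, ex (j * x)‖ ≤ n := by
  refine (norm_sum_le _ _).trans ?_
  simp [norm_ex]

lemma abs_sin_pi_add_int (x : ℝ) (n : ℤ) : |sin (π * (x + n))| = |sin (π * x)| := by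
  have h := norm_ex_sub_one (x + n)
  rw [ex_add_int, norm_ex_sub_one] at h
  linarith

lemma sin_pi_lower {z : ℝ} (h0 : 0 < z) (h1 : z < 1) : π * (z * (1 - z)) ≤ sin (π * z) := by
  have key : ∀ z : ℝ, 0 < z → z ≤ 1 / 2 → π * (z * (1 - z)) ≤ sin (π * z) := by
    intro z h0 h1
    have h := Real.sin_gt_sub_cube (x := π * z) (by positivity)
    have hp : π < 3.15 := pi_lt_d2
    have hp0 := pi_pos
    have : π ^ 2 * z ≤ 6 := by nlinarith
    have : (π * z) * z * (π ^ 2 * z) ≤ (π * z) * z * 6 := by gcongr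
    nlinarith
  rcases le_total z (1 / 2) with h | h
  · exact key z h0 h
  · have := key (1 - z) (by linarith) (by linarith)
    rw [show π * (1 - z) = π - π * z by ring, sin_pi_sub] at this
    linarith

lemma sin_pi_upper {t : ℝ} (h0 : 0 ≤ t) (h1 : t ≤ 1) : sin (π * t) ≤ 4 * t * (1 - t) := by
  have key : ∀ s : ℝ, 0 ≤ s → s ≤ 1 / 2 → cos (π * s) ≤ 1 - 4 * s ^ 2 := by
    intro s hs0 hs1
    have hconc := strictConcaveOn_sin_Icc.concaveOn
    have h := hconc.2 (show (0 : ℝ) ∈ Set.Icc 0 π from ⟨le_rfl, pi_pos.le⟩)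
      (show π / 4 ∈ Set.Icc 0 π from ⟨by positivity, by linarith [pi_pos]⟩)
      (show 0 ≤ 1 - 2 * s by linarith) (show 0 ≤ 2 * s by linarith) (by ring)
    simp only [sin_zero, smul_eq_mul, mul_zero, zero_add, sin_pi_div_four] at h
    rw [show 2 * s * (π / 4) = π * s / 2 by ring] at h
    have h2 : cos (π * s) = 1 - 2 * sin (π * s / 2) ^ 2 := by
      rw [show π * s = 2 * (π * s / 2) by ring, cos_two_mul, cos_sq']
      ring_nf
    have h3 : (2 * s * (√2 / 2)) ^ 2 ≤ sin (π * s / 2) ^ 2 := by gcongr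
    have h4 : (√2) ^ 2 = 2 := Real.sq_sqrt (by norm_num)
    have h5 : (2 * s * (√2 / 2)) ^ 2 = 2 * s ^ 2 := by
      rw [show (2 * s * (√2 / 2)) ^ 2 = s ^ 2 * (√2) ^ 2 by ring, h4]; ring
    rw [h2]; linarith
  rcases le_total t (1 / 2) with h | h
  · have := key (1 / 2 - t) (by linarith) (by linarith)
    rw [show π * (1 / 2 - t) = π / 2 - π * t by ring, cos_pi_div_two_sub] at this
    linarith
  · have := key (t - 1 / 2) (by linarith) (by linarith)
    rw [show π * (t - 1 / 2) = -(π / 2 - π * t) by ring, cos_neg, cos_pi_div_two_sub] at this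
    linarith

lemma inv_le_log_half {y : ℝ} (hy : 1 ≤ y) : 1 / y ≤ log (y + 1 / 2) - log (y - 1 / 2) := by
  have hu : |1 / (2 * y)| < 1 := by
    rw [abs_of_pos (by positivity), div_lt_one (by positivity)]; linarith
  have h := Real.hasSum_log_sub_log_of_abs_lt_one hu
  have h0 : log (1 + 1 / (2 * y)) - log (1 - 1 / (2 * y)) = log (y + 1 / 2) - log (y - 1 / 2) := by
    rw [show 1 + 1 / (2 * y) = (y + 1 / 2) / y by field_simp,
      show 1 - 1 / (2 * y) = (y - 1 / 2) / y by field_simp,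
      log_div (by positivity) (by positivity), log_div (by linarith) (by positivity)]
    ring
  rw [h0] at h
  have h1 := h.summable.sum_le_tsum (range 1) (fun i _ => by positivity)
  rw [h.tsum_eq] at h1
  refine le_trans (le_of_eq ?_) h1
  simp
  field_simp

lemma sum_inv_add_le {t : ℝ} (ht : 0 ≤ t) (n : ℕ) :
    ∑ j ∈ range n, 1 / (t + (j + 1)) ≤ log (n + t + 1 / 2) - log (t + 1 / 2) := by
  induction n with
  | zero => simp
  | succ n ih =>
    rw [sum_range_succ]
    have h := inv_le_log_half (y := t + (n + 1)) (by
      have : (0 : ℝ) ≤ n := by positivity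
      linarith)
    rw [show t + ((n : ℝ) + 1) - 1 / 2 = n + t + 1 / 2 by ring,
      show t + ((n : ℝ) + 1) + 1 / 2 = (n + 1 : ℝ) + t + 1 / 2 by ring] at h
    push_cast
    linarith

lemma sum_range_shift_periodic (g : ℕ) (f : ℤ → ℝ) (hf : ∀ n, f (n + g) = f n) (w : ℤ) :
    ∑ j ∈ range g, f (w + j) = ∑ j ∈ range g, f j := by
  have step : ∀ w : ℤ, ∑ j ∈ range g, f (w + 1 + j) = ∑ j ∈ range g, f (w + j) := by
    intro w
    have h1 := sum_range_succ (fun j : ℕ => f (w + j)) g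
    have h2 := sum_range_succ' (fun j : ℕ => f (w + j)) g
    rw [h1] at h2
    simp only [hf, Nat.cast_zero, add_zero, Nat.cast_add, Nat.cast_one] at h2
    have h3 := add_right_cancel h2
    rw [h3]
    exact sum_congr rfl fun j _ => by congr 1; ring
  induction w using Int.induction_on with
  | zero => simp
  | succ n ih => rw [step, ih]
  | pred n ih => rw [← ih, ← step (-(n : ℤ) - 1)]; simp

/-- Normalised modulus of the exponential sum over one base-`g` digit. -/
noncomputable def dig (g : ℕ) (x : ℝ) : ℝ := ‖∑ b ∈ range g, ex (b * x)‖ / g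

lemma dig_nonneg (g : ℕ) (x : ℝ) : 0 ≤ dig g x := by unfold dig; positivity

lemma dig_le_one (g : ℕ) (x : ℝ) : dig g x ≤ 1 := by
  unfold dig
  exact div_le_one_of_le₀ (norm_sum_ex_le g x) (by positivity)

lemma dig_add_int (g : ℕ) (x : ℝ) (n : ℤ) : dig g (x + n) = dig g x := by
  unfold dig
  congr 2
  refine sum_congr rfl fun b _ => ?_
  rw [mul_add]
  have := ex_add_int (b * x) (b * n)
  push_cast at this
  exact this

lemma dig_mul_sin {g : ℕ} (hg : 0 < g) (x : ℝ) :
    dig g x * (g * |sin (π * x)|) = |sin (π * (g * x))| := by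
  have hg' : (g : ℝ) ≠ 0 := by positivity
  rw [← norm_sum_ex_mul_sin, dig, ← mul_assoc, div_mul_cancel₀ _ hg']

lemma dig_le_of_sin {g : ℕ} (hg : 0 < g) {z s : ℝ} (hz : 0 < z) (hz' : z < g)
    (hs : |sin (π * z)| ≤ s) : dig g (z / g) ≤ s / π * (1 / z + 1 / (g - z)) := by
  have hg' : (0 : ℝ) < g := by exact_mod_cast hg
  have h := dig_mul_sin hg (z / g)
  rw [mul_div_cancel₀ _ hg'.ne'] at h
  have h1 := sin_pi_lower (z := z / g) (by positivity) (by rwa [div_lt_one hg'])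
  have hsub : 0 < g - z := by linarith
  have h2 : π * (z / g * (1 - z / g)) * g = π * (z * (g - z)) / g := by field_simp
  have h3 : dig g (z / g) * (π * (z * (g - z)) / g) ≤ s := by
    rw [← h2]
    calc _ = dig g (z / g) * (g * (π * (z / g * (1 - z / g)))) := by ring
      _ ≤ dig g (z / g) * (g * |sin (π * (z / g))|) := by
        gcongr
        · exact dig_nonneg _ _
        · exact h1.trans (le_abs_self _)
      _ ≤ s := by rw [h]; exact hs
  rw [← le_div_iff₀ (by have := pi_pos; positivity)] at h3
  refine h3.trans (le_of_eq ?_)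
  have := pi_pos
  field_simp
  ring

lemma sum_dig_aux {g : ℕ} (hg : 3 ≤ g) {t : ℝ} (ht0 : 0 ≤ t) (ht1 : t < 1) :
    ∑ j ∈ range g, dig g ((t + j) / g) ≤ (4 + 2 * log g) / π := by
  have hg' : (3 : ℝ) ≤ g := by exact_mod_cast hg
  have hlog : 1 ≤ log g := by
    rw [Real.le_log_iff_exp_le (by linarith)]
    linarith [Real.exp_one_lt_d9]
  have hpi := pi_pos
  rcases ht0.eq_or_lt with rfl | ht
  · have h0 : ∀ j ∈ range g, j ≠ 0 → dig g ((0 + j) / g) = 0 := by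
      intro j hj hj0
      have hjg := mem_range.1 hj
      have hjg' : (j : ℝ) < g := by exact_mod_cast hjg
      have hj1 : (0 : ℝ) < j := by exact_mod_cast Nat.pos_of_ne_zero hj0
      have h := dig_le_of_sin (g := g) (by omega) (z := j) (s := 0) hj1 hjg' (by
        rw [mul_comm, sin_nat_mul_pi]; simp)
      rw [zero_add]
      refine le_antisymm (h.trans (by simp)) (dig_nonneg _ _)
    rw [sum_eq_single 0 h0 (by intro h; simp at h; omega)]
    refine (dig_le_one _ _).trans ?_
    rw [le_div_iff₀ hpi]
    linarith [pi_lt_four]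
  · have hs0 : 0 < sin (π * t) := sin_pos_of_pos_of_lt_pi (by positivity) (by nlinarith)
    have hpt : ∀ j ∈ range g, dig g ((t + j) / g)
        ≤ sin (π * t) / π * (1 / (t + j) + 1 / (g - (t + j))) := by
      intro j hj
      have hjg : (j : ℝ) + 1 ≤ g := by exact_mod_cast mem_range.1 hj
      refine dig_le_of_sin (by omega) (by positivity) (by linarith) ?_
      have := abs_sin_pi_add_int t j
      push_cast at this
      rw [this, abs_of_pos hs0]
    refine (sum_le_sum hpt).trans ?_
    rw [← mul_sum, sum_add_distrib]
    obtain ⟨n, rfl⟩ : ∃ n, g = n + 1 := ⟨g - 1, by omega⟩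
    have hS1 : ∑ j ∈ range (n + 1), 1 / (t + (j : ℝ))
        ≤ 1 / t + (log (n + t + 1 / 2) - log (t + 1 / 2)) := by
      rw [sum_range_succ']
      have := sum_inv_add_le ht0 n
      push_cast
      simp only [add_zero] at *
      linarith
    have hS2 : ∑ j ∈ range (n + 1), 1 / (((n + 1 : ℕ) : ℝ) - (t + j))
        ≤ 1 / (1 - t) + (log (n + (1 - t) + 1 / 2) - log ((1 - t) + 1 / 2)) := by
      rw [← sum_range_reflect, sum_range_succ']
      have := sum_inv_add_le (t := 1 - t) (by linarith) n
      have e : ∀ j ∈ range n, 1 / (((n + 1 : ℕ) : ℝ) - (t + ((n + 1 - 1 - (j + 1) : ℕ) : ℝ)))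
          = 1 / ((1 - t) + ((j : ℝ) + 1)) := by
        intro j hj
        have := mem_range.1 hj
        rw [show n + 1 - 1 - (j + 1) = n - (j + 1) by omega, Nat.cast_sub (by omega)]
        push_cast
        congr 1; ring
      rw [sum_congr rfl e]
      have e2 : 1 / (((n + 1 : ℕ) : ℝ) - (t + ((n + 1 - 1 - 0 : ℕ) : ℝ))) = 1 / (1 - t) := by
        simp only [Nat.add_sub_cancel, Nat.sub_zero]
        push_cast
        congr 1; ring
      rw [e2]
      linarith
    set G : ℝ := ((n + 1 : ℕ) : ℝ) with hG
    have hn : (n : ℝ) = G - 1 := by rw [hG]; push_cast; ring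
    rw [hn] at hS1 hS2
    have hl1 : log (G - 1 + t + 1 / 2) + log (G - 1 + (1 - t) + 1 / 2) ≤ 2 * log G := by
      rw [← log_mul (by linarith) (by linarith), show 2 * log G = log (G ^ 2) by simp]
      apply log_le_log
      · apply mul_pos <;> linarith
      · nlinarith [sq_nonneg (t - 1 / 2)]
    set s := t - 1 / 2 with hs
    have hs1 : s ^ 2 < 1 / 4 := by nlinarith
    have hl2 : -(log (t + 1 / 2) + log (1 - t + 1 / 2)) ≤ 4 / 3 * s ^ 2 := by
      rw [← log_mul (by linarith) (by linarith), show (t + 1 / 2) * (1 - t + 1 / 2) = 1 - s ^ 2 by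
        rw [hs]; ring]
      have := Real.one_sub_inv_le_log_of_pos (x := 1 - s ^ 2) (by linarith)
      have h3 : (1 - s ^ 2)⁻¹ ≤ 1 + 4 / 3 * s ^ 2 := by
        rw [inv_le_iff_one_le_mul₀ (by linarith)]
        nlinarith [sq_nonneg s]
      linarith
    have hup := sin_pi_upper ht0 ht1.le
    have h4 : sin (π * t) * (1 / t + 1 / (1 - t)) ≤ 4 := by
      have : 1 / t + 1 / (1 - t) = 1 / (t * (1 - t)) := by
        have : 1 - t ≠ 0 := by linarith
        field_simp; ring
      rw [this, mul_one_div, div_le_iff₀ (by nlinarith)]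
      linarith
    have h5 : sin (π * t) * (2 * log G + 4 / 3 * s ^ 2) ≤ 2 * log G := by
      have : sin (π * t) ≤ 1 - 4 * s ^ 2 := by rw [hs]; linarith
      calc _ ≤ (1 - 4 * s ^ 2) * (2 * log G + 4 / 3 * s ^ 2) := by gcongr
        _ ≤ 2 * log G := by nlinarith [sq_nonneg s, sq_nonneg (s ^ 2)]
    rw [div_mul_eq_mul_div]
    gcongr
    refine (mul_le_mul_of_nonneg_left (add_le_add hS1 hS2) hs0.le).trans ?_
    have h6 : 1 / t + (log (G - 1 + t + 1 / 2) - log (t + 1 / 2)) +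
        (1 / (1 - t) + (log (G - 1 + (1 - t) + 1 / 2) - log (1 - t + 1 / 2)))
        ≤ (1 / t + 1 / (1 - t)) + (2 * log G + 4 / 3 * s ^ 2) := by linarith
    refine (mul_le_mul_of_nonneg_left h6 hs0.le).trans ?_
    rw [mul_add]; linarith

lemma sum_dig_le {g : ℕ} (hg : 3 ≤ g) (x : ℝ) :
    ∑ j ∈ range g, dig g (x + j / g) ≤ (4 + 2 * log g) / π := by
  have hg' : (g : ℝ) ≠ 0 := by positivity
  have h := sum_range_shift_periodic g (fun n : ℤ => dig g ((Int.fract (g * x) + n) / g)) (by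
    intro n
    have := dig_add_int g ((Int.fract (g * x) + n) / g) 1
    rw [← this]
    congr 1
    push_cast
    field_simp
    ring) ⌊g * x⌋
  have e : ∀ j ∈ range g, dig g (x + j / g)
      = dig g ((Int.fract (g * x) + ((⌊g * x⌋ + j : ℤ) : ℝ)) / g) := by
    intro j _
    congr 1
    have := Int.floor_add_fract (g * x)
    rw [eq_div_iff hg', add_mul, div_mul_cancel₀ _ hg']
    push_cast
    linarith
  rw [sum_congr rfl e, h]
  exact sum_dig_aux hg (Int.fract_nonneg _) (Int.fract_lt_one _)

/-- A majorant on the residues modulo `d` of size `W / (distance to 0)`, capped by `Y`. -/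
noncomputable def grid (d : ℕ) (Y W : ℝ) (r : ℕ) : ℝ :=
  if 2 ≤ r ∧ r + 2 ≤ d then W * (((r - 1 : ℕ) : ℝ)⁻¹ + ((d - r - 1 : ℕ) : ℝ)⁻¹) else Y

lemma sum_inv_pred_le (d : ℕ) : ∑ r ∈ range (d + 1), ((r - 1 : ℕ) : ℝ)⁻¹ ≤ 1 + log d := by
  refine le_trans ?_ (harmonic_le_one_add_log d)
  rw [sum_range_succ']
  have e : ((0 - 1 : ℕ) : ℝ)⁻¹ = 0 := by simp
  rw [e, add_zero]
  simp only [Nat.add_sub_cancel]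
  have h := sum_range_succ' (fun i : ℕ => (i : ℝ)⁻¹) d
  rw [harmonic]
  push_cast
  rw [sum_range_succ] at h
  simp only [Nat.cast_zero, inv_zero, add_zero] at h
  push_cast at h
  rw [← h]
  have : (0 : ℝ) ≤ (d : ℝ)⁻¹ := by positivity
  linarith

lemma sum_grid_le {d : ℕ} {Y W : ℝ} (hY : 0 ≤ Y) (hW : 0 ≤ W) :
    ∑ r ∈ range d, grid d Y W r ≤ 3 * Y + 2 * W * (1 + log d) := by
  have hpt : ∀ r ∈ range d, grid d Y W r ≤
      ((if r = 0 then Y else 0) + (if r = 1 then Y else 0) + (if r = d - 1 then Y else 0))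
      + (W * ((r - 1 : ℕ) : ℝ)⁻¹ + W * ((d - r - 1 : ℕ) : ℝ)⁻¹) := by
    intro r hr
    have hr' := mem_range.1 hr
    unfold grid
    have p1 : 0 ≤ W * ((r - 1 : ℕ) : ℝ)⁻¹ := by positivity
    have p2 : 0 ≤ W * ((d - r - 1 : ℕ) : ℝ)⁻¹ := by positivity
    have p3 : 0 ≤ if r = 0 then Y else 0 := by positivity
    have p4 : 0 ≤ if r = 1 then Y else 0 := by positivity
    have p5 : 0 ≤ if r = d - 1 then Y else 0 := by positivity
    split_ifs with h
    all_goals first | omega | linarith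
  refine (sum_le_sum hpt).trans ?_
  rw [sum_add_distrib, sum_add_distrib, sum_add_distrib, sum_add_distrib, ← mul_sum, ← mul_sum]
  have s : ∀ k : ℕ, ∑ r ∈ range d, (if r = k then Y else 0) ≤ Y := by
    intro k
    rw [sum_ite_eq']
    split_ifs <;> linarith
  have s1 := s 0
  have s2 := s 1
  have s3 := s (d - 1)
  have h1 : ∑ r ∈ range d, ((r - 1 : ℕ) : ℝ)⁻¹ ≤ 1 + log d :=
    (sum_le_sum_of_subset_of_nonneg (range_mono (Nat.le_succ d)) fun _ _ _ => by positivity).trans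
      (sum_inv_pred_le d)
  have h2 : ∑ r ∈ range d, ((d - r - 1 : ℕ) : ℝ)⁻¹ ≤ 1 + log d := by
    refine le_trans (le_of_eq ?_) (sum_inv_pred_le d)
    rw [sum_range_succ', ← sum_range_reflect]
    simp only [Nat.zero_sub, Nat.cast_zero, inv_zero, add_zero, Nat.add_sub_cancel]
    refine sum_congr rfl fun j hj => ?_
    have := mem_range.1 hj
    congr 2
    omega
  nlinarith

lemma sum_mod_perm (d : ℕ) (hd : 0 < d) (a c : ℤ) (ha : IsCoprime a (d : ℤ)) (f : ℕ → ℝ) :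
    ∑ j ∈ range d, f ((a * j + c) % d).toNat = ∑ r ∈ range d, f r := by
  have hd' : (0 : ℤ) < d := by exact_mod_cast hd
  have maps : ∀ j ∈ range d, ((a * j + c) % d).toNat ∈ range d := by
    intro j _
    have h1 := Int.emod_lt_of_pos (a * j + c) hd'
    have h2 := Int.emod_nonneg (a * j + c) hd'.ne'
    rw [mem_range]; omega
  have inj : Set.InjOn (fun j : ℕ => ((a * j + c) % d).toNat) (range d) := by
    intro i hi j hj h
    have hi' := mem_range.1 (mem_coe.1 hi)
    have hj' := mem_range.1 (mem_coe.1 hj)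
    have h2 := Int.emod_nonneg (a * i + c) hd'.ne'
    have h3 := Int.emod_nonneg (a * j + c) hd'.ne'
    have h4 : (a * i + c) % d = (a * j + c) % d := by simp only at h; omega
    have h5 : (d : ℤ) ∣ a * (i - j) := by
      have := Int.ModEq.dvd (show (a * j + c) ≡ (a * i + c) [ZMOD d] from h4.symm)
      rwa [show a * i + c - (a * j + c) = a * (i - j) by ring] at this
    have h6 : (d : ℤ) ∣ (i - j : ℤ) := ha.symm.dvd_of_dvd_mul_left h5
    have h7 : (i - j : ℤ) = 0 := by
      apply Int.eq_zero_of_abs_lt_dvd h6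
      rw [abs_lt]; omega
    omega
  refine sum_nbij (fun j : ℕ => ((a * j + c) % d).toNat) maps inj ?_ fun _ _ => rfl
  exact Finset.surjOn_of_injOn_of_card_le _ maps inj le_rfl

lemma exists_cell_majorant {g : ℕ} (hg : 2 ≤ g) (x : ℝ) : ∃ β : ℕ → ℝ, (∀ j, 0 ≤ β j) ∧
    (∀ j < g, ∀ t : ℝ, 0 ≤ t → t ≤ 1 → dig g (x + (j + t) / g) ≤ β j) ∧
    ∑ j ∈ range g, β j ≤ 3 + (2 + 2 * log g) / π := by
  have hg' : (0 : ℝ) < g := by positivity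
  have hpi := pi_pos
  refine ⟨fun j => grid g 1 (1 / π) ((1 * (j : ℤ) + (⌊g * x⌋ + 1)) % g).toNat, ?_, ?_, ?_⟩
  · intro j; dsimp only; unfold grid; split_ifs <;> positivity
  · intro j hj t ht0 ht1
    set r := ((1 * (j : ℤ) + (⌊g * x⌋ + 1)) % g).toNat with hr
    simp only [grid]
    split_ifs with h
    swap
    · exact dig_le_one _ _
    have hgz : (g : ℤ) ≠ 0 := by exact_mod_cast (show g ≠ 0 by omega)
    have h2 := Int.emod_nonneg (1 * (j : ℤ) + (⌊g * x⌋ + 1)) hgz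
    have h3 := Int.emod_add_mul_ediv (1 * (j : ℤ) + (⌊g * x⌋ + 1)) g
    set k := (1 * (j : ℤ) + (⌊g * x⌋ + 1)) / g
    have h4 : (r : ℤ) + g * k = j + (⌊g * x⌋ + 1) := by rw [hr, Int.toNat_of_nonneg h2]; linarith
    have h5 : (r : ℝ) + g * k = j + (⌊g * x⌋ + 1) := by exact_mod_cast h4
    set η := Int.fract (g * x) + t - 1 with hη
    have hf0 := Int.fract_nonneg (g * x)
    have hf1 := Int.fract_lt_one (g * x)
    have hf := Int.floor_add_fract (g * x)
    have e : x + (j + t) / g = (r + η) / g + k := by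
      field_simp
      linarith
    have hr2 : (2 : ℝ) ≤ r := by exact_mod_cast h.1
    have hr3 : (r : ℝ) + 2 ≤ g := by exact_mod_cast h.2
    rw [e, dig_add_int]
    refine (dig_le_of_sin (s := 1) (by omega) (by linarith) (by linarith) (abs_sin_le_one _)).trans ?_
    have c1 : ((r - 1 : ℕ) : ℝ) = r - 1 := by rw [Nat.cast_sub (by omega)]; simp
    have c2 : ((g - r - 1 : ℕ) : ℝ) = g - r - 1 := by
      rw [Nat.cast_sub (by omega), Nat.cast_sub (by omega)]; simp
    rw [c1, c2, ← one_div, ← one_div]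
    gcongr 1 / π * (?_ + ?_)
    · exact one_div_le_one_div_of_le (by linarith) (by linarith)
    · exact one_div_le_one_div_of_le (by linarith) (by linarith)
  · rw [sum_mod_perm g (by omega) 1 _ isCoprime_one_left]
    refine (sum_grid_le (by norm_num) (by positivity)).trans (le_of_eq ?_)
    field_simp

lemma digit_constants {g : ℕ} (hg : 31699 ≤ g) :
    ((4 + 2 * log g) / π) ^ 5 < g ∧ (3 + (2 + 2 * log g) / π) ^ 4 < g := by
  have hg' : (31699 : ℝ) ≤ g := by exact_mod_cast hg
  have hg0 : (0 : ℝ) < g := by linarith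
  have hpi := pi_gt_d2
  have hlog0 : 0 ≤ log g := log_nonneg (by linarith)
  set z : ℝ := (g : ℝ) ^ ((1 : ℝ) / 5) with hz
  have hz5 : z ^ 5 = g := by
    rw [hz, ← Real.rpow_natCast, ← Real.rpow_mul hg0.le]; norm_num
  have hz0 : 0 < z := by positivity
  have hz1 : 7.94 ≤ z := by
    by_contra! h
    have : z ^ 5 < 7.94 ^ 5 := by gcongr
    rw [hz5] at this
    norm_num at this
    linarith
  have hlogz : log g = 5 * log z := by rw [← hz5]; simp
  have hl8 : log z ≤ 3 * log 2 + (z - 8) / 8 := by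
    have h1 := Real.log_le_sub_one_of_pos (x := z / 8) (by positivity)
    rw [log_div (by positivity) (by norm_num), show (8 : ℝ) = 2 ^ 3 by norm_num, log_pow] at h1
    push_cast at h1
    linarith
  have hl2 := Real.log_two_lt_d9
  have hlt : 4 + 2 * log g < π * z := by nlinarith
  have hC1 : (4 + 2 * log g) / π < z := by rw [div_lt_iff₀ (by linarith)]; linarith
  have hC1' : 0 ≤ (4 + 2 * log g) / π := by positivity
  refine ⟨?_, ?_⟩
  · exact (pow_lt_pow_left₀ hC1 hC1' (by norm_num)).trans_eq hz5
  · set y : ℝ := (g : ℝ) ^ ((1 : ℝ) / 20) with hy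
    have hy4 : y ^ 4 = z := by
      rw [hy, hz, ← Real.rpow_natCast, ← Real.rpow_mul hg0.le]; norm_num
    have hy0 : 0 < y := by positivity
    have hy1 : 1.5 ≤ y := by
      by_contra! h
      have : y ^ 4 < 1.5 ^ 4 := by gcongr
      rw [hy4] at this
      norm_num at this
      linarith
    have h2 : (2 + 2 * log g) / π ≤ (4 + 2 * log g) / π := by gcongr; norm_num
    have h3 : 3 + (2 + 2 * log g) / π < y ^ 5 := by
      have : y ^ 5 = z * y := by rw [← hy4]; ring
      nlinarith
    have h4 : (y ^ 5) ^ 4 = g := by rw [← hz5, ← hy4]; ring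
    exact (pow_lt_pow_left₀ h3 (by positivity) (by norm_num)).trans_eq h4

lemma sum_range_mul_eq {M : Type*} [AddCommMonoid M] (f : ℕ → M) (a b : ℕ) :
    ∑ m ∈ range (a * b), f m = ∑ j ∈ range b, ∑ i ∈ range a, f (i + a * j) := by
  induction b with
  | zero => simp
  | succ b ih =>
    rw [Nat.mul_succ, sum_range_add, ih, sum_range_succ]
    congr 1
    exact sum_congr rfl fun i _ => by rw [add_comm]

/-- The phase `∑ mᵢ ωᵢ` attached to the lowest `L` base-`g` digits `mᵢ` of `m`. -/
noncomputable def digitPhase (g L : ℕ) (ω : ℕ → ℝ) (m : ℕ) : ℝ :=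
  ∑ i ∈ range L, ((m / g ^ i % g : ℕ) : ℝ) * ω i

/-- Modulus of the `r`-th Fourier coefficient modulo `g ^ L` of the exponential of `digitPhase`. -/
noncomputable def digitCoeff (g L : ℕ) (ω : ℕ → ℝ) (r : ℕ) : ℝ :=
  ∏ i ∈ range L, dig g (ω i + r * g ^ i / g ^ L)

lemma digitCoeff_nonneg (g L : ℕ) (ω : ℕ → ℝ) (r : ℕ) : 0 ≤ digitCoeff g L ω r :=
  prod_nonneg fun _ _ => dig_nonneg _ _

lemma sum_digitPhase {g : ℕ} (hg : 0 < g) (L : ℕ) (ω : ℕ → ℝ) (α : ℝ) :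
    ∑ m ∈ range (g ^ L), ex (digitPhase g L ω m + m * α)
      = ∏ i ∈ range L, ∑ b ∈ range g, ex (b * (ω i + g ^ i * α)) := by
  induction L with
  | zero => simp [digitPhase, ex_zero]
  | succ L ih =>
    rw [pow_succ, sum_range_mul_eq, prod_range_succ, ← ih, mul_comm, sum_mul]
    refine sum_congr rfl fun b hb => ?_
    rw [mul_sum]
    refine sum_congr rfl fun m hm => ?_
    have hb' := mem_range.1 hb
    have hm' := mem_range.1 hm
    rw [← ex_add]
    congr 1
    have h1 : digitPhase g (L + 1) ω (m + g ^ L * b) = digitPhase g L ω m + b * ω L := by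
      unfold digitPhase
      rw [sum_range_succ]
      congr 1
      · refine sum_congr rfl fun i hi => ?_
        have hi' := mem_range.1 hi
        congr 2
        obtain ⟨k, rfl⟩ : ∃ k, L = i + (k + 1) := ⟨L - i - 1, by omega⟩
        rw [show g ^ (i + (k + 1)) * b = g ^ i * (g * (g ^ k * b)) by ring,
          Nat.add_mul_div_left _ _ (by positivity), Nat.add_mul_mod_self_left]
      · rw [Nat.add_mul_div_left _ _ (by positivity), Nat.div_eq_of_lt hm', zero_add,
          Nat.mod_eq_of_lt hb']
    rw [h1]
    push_cast
    ring

lemma norm_prod_eq_digitCoeff {g : ℕ} (hg : 0 < g) (L : ℕ) (ω : ℕ → ℝ) (r : ℕ) :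
    ‖∑ m ∈ range (g ^ L), ex (digitPhase g L ω m + m * (r / (g : ℝ) ^ L))‖
      = (g : ℝ) ^ L * digitCoeff g L ω r := by
  have hg' : (g : ℝ) ≠ 0 := by positivity
  rw [sum_digitPhase hg, norm_prod, digitCoeff]
  simp only [dig]
  rw [prod_div_distrib, prod_const, card_range, mul_div_cancel₀ _ (by positivity)]
  refine prod_congr rfl fun i _ => ?_
  congr 1
  refine sum_congr rfl fun b _ => ?_
  congr 3
  ring

lemma sum_ex_orthogonal {Y : ℕ} {m m' : ℕ} (hm : m < Y) (hm' : m' < Y) :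
    ∑ r ∈ range Y, ex (m' * (r / (Y : ℝ))) * ex (-(m * (r / (Y : ℝ))))
      = if m = m' then (Y : ℂ) else 0 := by
  have hY : (0 : ℝ) < Y := by exact_mod_cast (by omega : 0 < Y)
  split_ifs with h
  · subst h
    rw [sum_congr rfl fun r _ => by rw [← ex_add, add_neg_cancel, ex_zero]]
    simp
  · have e : ∀ r ∈ range Y, ex (m' * (r / (Y : ℝ))) * ex (-(m * (r / (Y : ℝ))))
        = ex (r * ((m' - m : ℝ) / Y)) := by
      intro r _
      rw [← ex_add]; congr 1; ring
    rw [sum_congr rfl e]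
    have h1 := norm_sum_ex_mul_sin Y ((m' - m : ℝ) / Y)
    have h2 : sin (π * (Y * ((m' - m : ℝ) / Y))) = 0 := by
      rw [mul_div_cancel₀ _ hY.ne', mul_comm, show ((m' : ℝ) - m) = ((m' - m : ℤ) : ℝ) by push_cast; ring]
      exact sin_int_mul_pi _
    rw [h2, abs_zero] at h1
    rcases mul_eq_zero.1 h1 with h3 | h3
    · exact norm_eq_zero.1 h3
    · exfalso
      rw [abs_eq_zero, Real.sin_eq_zero_iff] at h3
      obtain ⟨k, hk⟩ := h3
      have h4 : (k : ℝ) = (m' - m) / Y := by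
        have := pi_pos
        have h5 : π * (k : ℝ) = π * ((m' - m) / Y) := by linarith
        exact mul_left_cancel₀ this.ne' h5
      rw [eq_div_iff hY.ne'] at h4
      have h5 : k * (Y : ℤ) = m' - m := by exact_mod_cast h4
      have h6 : (m' - m : ℤ) = 0 := by
        apply Int.eq_zero_of_abs_lt_dvd (m := (Y : ℤ)) ⟨k, by rw [← h5]; ring⟩
        rw [abs_lt]; omega
      omega

lemma norm_sum_mul_digitPhase_le {g : ℕ} (hg : 0 < g) (L : ℕ) (ω : ℕ → ℝ) (Z : ℕ → ℂ) :
    ‖∑ m ∈ range (g ^ L), Z m * ex (digitPhase g L ω m)‖ ≤ ∑ r ∈ range (g ^ L),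
      digitCoeff g L ω r * ‖∑ m ∈ range (g ^ L), Z m * ex (-(m * (r / (g : ℝ) ^ L)))‖ := by
  set Y : ℝ := (g : ℝ) ^ L with hY
  have hY0 : 0 < Y := by positivity
  have hYc : ((g ^ L : ℕ) : ℝ) = Y := by rw [hY]; push_cast; rfl
  set c : ℕ → ℂ := fun r => ∑ m ∈ range (g ^ L), ex (digitPhase g L ω m + m * (r / Y)) with hc
  have inv : ∀ m ∈ range (g ^ L),
      (Y : ℂ) * ex (digitPhase g L ω m) = ∑ r ∈ range (g ^ L), c r * ex (-(m * (r / Y))) := by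
    intro m hm
    simp only [hc, sum_mul]
    rw [sum_comm]
    have e : ∀ m' ∈ range (g ^ L),
        ∑ r ∈ range (g ^ L), ex (digitPhase g L ω m' + m' * (r / Y)) * ex (-(m * (r / Y)))
        = if m = m' then (Y : ℂ) * ex (digitPhase g L ω m') else 0 := by
      intro m' hm'
      have h := sum_ex_orthogonal (mem_range.1 hm) (mem_range.1 hm')
      rw [hYc] at h
      simp only [ex_add, mul_assoc]
      rw [← mul_sum, h]
      split_ifs
      · rw [← hYc]; push_cast; ring
      · simp
    rw [sum_congr rfl e, sum_ite_eq, if_pos hm]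
  have key : (Y : ℂ) * ∑ m ∈ range (g ^ L), Z m * ex (digitPhase g L ω m)
      = ∑ r ∈ range (g ^ L), c r * ∑ m ∈ range (g ^ L), Z m * ex (-(m * (r / Y))) := by
    simp only [mul_sum]
    rw [sum_comm]
    refine sum_congr rfl fun m hm => ?_
    have := inv m hm
    calc _ = Z m * ((Y : ℂ) * ex (digitPhase g L ω m)) := by ring
      _ = _ := by
        rw [this, mul_sum]
        exact sum_congr rfl fun r _ => by ring
  have h2 := congrArg norm key
  rw [norm_mul, Complex.norm_real, Real.norm_of_nonneg hY0.le] at h2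
  have h3 : ‖∑ r ∈ range (g ^ L), c r * ∑ m ∈ range (g ^ L), Z m * ex (-(m * (r / Y)))‖
      ≤ Y * ∑ r ∈ range (g ^ L),
        digitCoeff g L ω r * ‖∑ m ∈ range (g ^ L), Z m * ex (-(m * (r / Y)))‖ := by
    refine (norm_sum_le _ _).trans (le_of_eq ?_)
    rw [mul_sum]
    refine sum_congr rfl fun r _ => ?_
    rw [norm_mul, hc]
    simp only
    rw [hY, norm_prod_eq_digitCoeff hg]
    ring
  rw [← h2] at h3
  exact le_of_mul_le_mul_left h3 hY0

lemma digitCoeff_succ {g : ℕ} (hg : 0 < g) (L : ℕ) (ω : ℕ → ℝ) (r j : ℕ) :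
    digitCoeff g (L + 1) ω (r + g ^ L * j)
      = dig g (ω 0 + r / g ^ (L + 1) + j / g) * digitCoeff g L (fun i => ω (i + 1)) r := by
  have hg' : (g : ℝ) ≠ 0 := by positivity
  unfold digitCoeff
  rw [prod_range_succ', mul_comm]
  congr 1
  · congr 1
    push_cast
    field_simp
    ring
  · refine prod_congr rfl fun i _ => ?_
    rw [← dig_add_int g (ω (i + 1) + r * g ^ i / g ^ L) (j * g ^ i : ℕ)]
    congr 1
    push_cast
    field_simp
    ring

lemma sum_digitCoeff_le {g : ℕ} (hg : 3 ≤ g) (L : ℕ) (ω : ℕ → ℝ) :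
    ∑ r ∈ range (g ^ L), digitCoeff g L ω r ≤ ((4 + 2 * log g) / π) ^ L := by
  induction L generalizing ω with
  | zero => simp [digitCoeff]
  | succ L ih =>
    rw [pow_succ, sum_range_mul_eq, sum_comm]
    have hC : 0 ≤ (4 + 2 * log g) / π := by
      have := pi_pos
      have : 0 ≤ log (g : ℝ) := log_natCast_nonneg g
      positivity
    calc _ ≤ ∑ r ∈ range (g ^ L),
          (4 + 2 * log g) / π * digitCoeff g L (fun i => ω (i + 1)) r := by
          refine sum_le_sum fun r _ => ?_
          simp only [digitCoeff_succ (by omega : 0 < g)]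
          rw [← sum_mul]
          gcongr
          · exact digitCoeff_nonneg _ _ _ _
          · exact sum_dig_le hg _
      _ ≤ _ := by
          rw [← mul_sum, pow_succ, mul_comm]
          gcongr
          exact ih _

lemma exists_cells_majorant {g : ℕ} (hg : 2 ≤ g) (m : ℕ) (ω : ℕ → ℝ) :
    ∃ b : ℕ → ℝ, (∀ v, 0 ≤ b v) ∧
    (∀ v < g ^ m, ∀ t : ℝ, 0 ≤ t → t ≤ 1 →
      ∏ i ∈ range m, dig g (ω i + (v + t) / g ^ m * g ^ i) ≤ b v) ∧
    ∑ v ∈ range (g ^ m), b v ≤ (3 + (2 + 2 * log g) / π) ^ m := by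
  have hg' : (g : ℝ) ≠ 0 := by positivity
  induction m generalizing ω with
  | zero => exact ⟨fun _ => 1, by simp, by simp, by simp⟩
  | succ m ih =>
    obtain ⟨b, hb0, hb1, hb2⟩ := ih fun i => ω (i + 1)
    obtain ⟨β, hβ0, hβ1, hβ2⟩ := exists_cell_majorant hg (ω 0)
    refine ⟨fun v => β (v / g ^ m) * b (v % g ^ m), fun v => mul_nonneg (hβ0 _) (hb0 _), ?_, ?_⟩
    · intro v hv t ht0 ht1
      have hp : 0 < g ^ m := by positivity
      have hp' : (0 : ℝ) < (g : ℝ) ^ m := by positivity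
      have hj : v / g ^ m < g := by
        rw [Nat.div_lt_iff_lt_mul hp, ← pow_succ']; exact hv
      have hv' : v % g ^ m < g ^ m := Nat.mod_lt _ hp
      have hdm : (v : ℝ) = (v % g ^ m : ℕ) + (g : ℝ) ^ m * (v / g ^ m : ℕ) := by
        exact_mod_cast (Nat.mod_add_div v (g ^ m)).symm
      set j := v / g ^ m
      set u := v % g ^ m
      have hu1 : (u : ℝ) + 1 ≤ (g : ℝ) ^ m := by exact_mod_cast hv'
      rw [prod_range_succ', mul_comm]
      refine mul_le_mul ?_ ?_ (prod_nonneg fun _ _ => dig_nonneg _ _) (hβ0 _)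
      · have := hβ1 j hj ((u + t) / g ^ m) (by positivity)
          (by rw [div_le_one hp']; linarith)
        refine le_trans (le_of_eq ?_) this
        congr 1
        rw [hdm]
        field_simp
        ring
      · refine le_trans (le_of_eq ?_) (hb1 u hv' t ht0 ht1)
        refine prod_congr rfl fun i _ => ?_
        rw [← dig_add_int g (ω (i + 1) + (u + t) / g ^ m * g ^ i) (j * g ^ i : ℕ)]
        congr 1
        rw [hdm]
        push_cast
        field_simp
        ring
    · rw [pow_succ, sum_range_mul_eq]
      have hp : 0 < g ^ m := by positivity
      have e : ∀ j ∈ range g, ∑ u ∈ range (g ^ m),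
          β ((u + g ^ m * j) / g ^ m) * b ((u + g ^ m * j) % g ^ m)
          = β j * ∑ u ∈ range (g ^ m), b u := by
        intro j _
        rw [mul_sum]
        refine sum_congr rfl fun u hu => ?_
        have hu' := mem_range.1 hu
        rw [Nat.add_mul_div_left _ _ hp, Nat.div_eq_of_lt hu', zero_add,
          Nat.add_mul_mod_self_left, Nat.mod_eq_of_lt hu']
      rw [sum_congr rfl e, ← sum_mul, pow_succ, mul_comm]
      exact mul_le_mul hb2 hβ2 (sum_nonneg fun _ _ => hβ0 _) (by
        have := pi_pos
        have : 0 ≤ log (g : ℝ) := log_natCast_nonneg g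
        positivity)

lemma digitCoeff_mod {g : ℕ} (hg : 0 < g) (l : ℕ) (ω : ℕ → ℝ) (r : ℕ) :
    digitCoeff g l ω (r % g ^ l) = digitCoeff g l ω r := by
  have hg' : (g : ℝ) ≠ 0 := by positivity
  unfold digitCoeff
  refine prod_congr rfl fun i _ => ?_
  have hdm : (r : ℝ) = (r % g ^ l : ℕ) + (g : ℝ) ^ l * (r / g ^ l : ℕ) := by
    exact_mod_cast (Nat.mod_add_div r (g ^ l)).symm
  generalize r / g ^ l = k at hdm
  rw [← dig_add_int g _ (k * g ^ i : ℕ)]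
  congr 1
  conv_rhs => rw [hdm]
  push_cast
  field_simp
  ring

lemma sum_digitCoeff_subset_le {g : ℕ} (hg : 3 ≤ g) {L m l : ℕ} (hml : m + l ≤ L) (ω : ℕ → ℝ)
    (s : Finset ℕ) (hs : ∀ r ∈ s, r < g ^ L)
    (inj : Set.InjOn (fun r : ℕ => (r / g ^ (L - m), r % g ^ l)) s) :
    ∑ r ∈ s, digitCoeff g L ω r
      ≤ (3 + (2 + 2 * log g) / π) ^ m * ((4 + 2 * log g) / π) ^ l ∧
    s.card ≤ g ^ m * g ^ l := by
  have hg' : (g : ℝ) ≠ 0 := by positivity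
  obtain ⟨b, hb0, hb1, hb2⟩ := exists_cells_majorant (by omega : 2 ≤ g) m ω
  set ω' : ℕ → ℝ := fun i => ω (i + (L - l)) with hω'
  have maps : ∀ r ∈ s, (r / g ^ (L - m), r % g ^ l) ∈ range (g ^ m) ×ˢ range (g ^ l) := by
    intro r hr
    rw [mem_product, mem_range, mem_range]
    refine ⟨?_, Nat.mod_lt _ (by positivity)⟩
    rw [Nat.div_lt_iff_lt_mul (by positivity), ← pow_add, show m + (L - m) = L by omega]
    exact hs r hr
  have hpt : ∀ r ∈ s, digitCoeff g L ω r
      ≤ b (r / g ^ (L - m)) * digitCoeff g l ω' (r % g ^ l) := by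
    intro r hr
    rw [digitCoeff_mod (by omega)]
    have h1 : ∏ i ∈ range m, dig g (ω i + r * g ^ i / g ^ L) ≤ b (r / g ^ (L - m)) := by
      have hv := (mem_product.1 (maps r hr)).1
      have hp : (0 : ℝ) < (g : ℝ) ^ (L - m) := by positivity
      have hmod : r % g ^ (L - m) < g ^ (L - m) := Nat.mod_lt _ (by positivity)
      have hmod' : ((r % g ^ (L - m) : ℕ) : ℝ) ≤ (g : ℝ) ^ (L - m) := by exact_mod_cast hmod.le
      refine le_trans (le_of_eq ?_) (hb1 _ (mem_range.1 hv)
        ((r % g ^ (L - m) : ℕ) / (g : ℝ) ^ (L - m)) (by positivity)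
        (by rw [div_le_one hp]; exact hmod'))
      refine prod_congr rfl fun i _ => ?_
      congr 2
      have hdm : (r : ℝ) = (r % g ^ (L - m) : ℕ) + (g : ℝ) ^ (L - m) * (r / g ^ (L - m) : ℕ) := by
        exact_mod_cast (Nat.mod_add_div r (g ^ (L - m))).symm
      have hL : (g : ℝ) ^ L = g ^ m * g ^ (L - m) := by rw [← pow_add]; congr 1; omega
      rw [hL]
      conv_lhs => rw [hdm]
      field_simp
      ring
    have h2 : ∏ i ∈ range l, dig g (ω (L - l + i) + r * g ^ (L - l + i) / g ^ L)
        = digitCoeff g l ω' r := by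
      unfold digitCoeff
      refine prod_congr rfl fun i _ => ?_
      rw [hω']
      simp only
      rw [add_comm i]
      congr 2
      have hL : (g : ℝ) ^ L = g ^ l * g ^ (L - l) := by rw [← pow_add]; congr 1; omega
      rw [hL, pow_add]
      field_simp
    have h3 : digitCoeff g L ω r
        = (∏ i ∈ range (L - l), dig g (ω i + r * g ^ i / g ^ L)) * digitCoeff g l ω' r := by
      rw [← h2, ← prod_range_add, show L - l + l = L by omega, digitCoeff]
    have h4 : ∏ i ∈ range (L - l), dig g (ω i + r * g ^ i / g ^ L)
        ≤ ∏ i ∈ range m, dig g (ω i + r * g ^ i / g ^ L) := by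
      refine prod_le_prod_of_subset_of_le_one (range_mono (by omega))
        (fun i _ => dig_nonneg _ _) fun i _ _ => dig_le_one _ _
    rw [h3]
    exact mul_le_mul_of_nonneg_right (h4.trans h1) (digitCoeff_nonneg _ _ _ _)
  constructor
  · calc _ ≤ ∑ r ∈ s, b (r / g ^ (L - m)) * digitCoeff g l ω' (r % g ^ l) := sum_le_sum hpt
      _ = ∑ p ∈ s.image (fun r : ℕ => (r / g ^ (L - m), r % g ^ l)),
          b p.1 * digitCoeff g l ω' p.2 := by rw [sum_image inj]
      _ ≤ ∑ p ∈ range (g ^ m) ×ˢ range (g ^ l), b p.1 * digitCoeff g l ω' p.2 := by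
          refine sum_le_sum_of_subset_of_nonneg (image_subset_iff.2 maps) fun p _ _ => ?_
          exact mul_nonneg (hb0 _) (digitCoeff_nonneg _ _ _ _)
      _ = (∑ v ∈ range (g ^ m), b v) * ∑ w ∈ range (g ^ l), digitCoeff g l ω' w := by
          rw [sum_product, sum_mul_sum]
      _ ≤ _ := by
          refine mul_le_mul hb2 (sum_digitCoeff_le hg l ω')
            (sum_nonneg fun _ _ => digitCoeff_nonneg _ _ _ _) ?_
          have := pi_pos
          have : 0 ≤ log (g : ℝ) := log_natCast_nonneg g
          positivity
  · have := card_le_card_of_injOn _ maps inj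
    rwa [card_product, card_range, card_range] at this

lemma exists_dig_lt_one {g : ℕ} (hg : 2 ≤ g) {κ : ℝ} (hκ : 0 < κ) :
    ∃ ρ : ℝ, 0 < ρ ∧ ρ < 1 ∧ ∀ x : ℝ, (∀ n : ℤ, κ ≤ |x - n|) → dig g x ≤ ρ := by
  have hg' : (2 : ℝ) ≤ g := by exact_mod_cast hg
  have hpi := pi_pos
  rcases le_or_gt 1 κ with hk | hk
  · refine ⟨1 / 2, by norm_num, by norm_num, fun x hx => ?_⟩
    have h1 := hx ⌊x⌋
    have h2 := Int.fract_lt_one x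
    have h3 := Int.fract_nonneg x
    rw [Int.self_sub_floor, abs_of_nonneg h3] at h1
    linarith
  set σ : ℝ := π * (κ * (1 - κ)) with hσ
  have hσ0 : 0 < σ := by
    have : 0 < 1 - κ := by linarith
    positivity
  have hsq : √(1 - σ ^ 2) < 1 := by
    rw [Real.sqrt_lt' one_pos]
    nlinarith
  refine ⟨(2 * √(1 - σ ^ 2) + (g - 2) + 1) / (g + 1), ?_, ?_, ?_⟩
  · have : 0 < (g : ℝ) - 2 + 1 := by linarith
    have := Real.sqrt_nonneg (1 - σ ^ 2)
    apply div_pos <;> linarith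
  · rw [div_lt_one (by linarith)]; linarith
  · intro x hx
    have h1 := hx ⌊x⌋
    have h2 := hx (⌊x⌋ + 1)
    have hf0 := Int.fract_nonneg x
    have hf1 := Int.fract_lt_one x
    have hff := Int.floor_add_fract x
    rw [Int.self_sub_floor, abs_of_nonneg hf0] at h1
    have h3 : κ ≤ 1 - Int.fract x := by
      push_cast at h2
      rw [abs_of_nonpos (by linarith)] at h2
      linarith
    have h4 := sin_pi_lower (z := Int.fract x) (by linarith) (by linarith)
    have h5 : σ ≤ |sin (π * x)| := by
      rw [← Int.fract_add_floor x, abs_sin_pi_add_int]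
      refine le_trans ?_ (h4.trans (le_abs_self _))
      rw [hσ]
      gcongr ?_ * ?_
      nlinarith
    have h6 : |cos (π * x)| ≤ √(1 - σ ^ 2) := by
      apply Real.abs_le_sqrt
      rw [cos_sq', ← sq_abs (sin _)]
      gcongr
    have h7 : ‖1 + ex x‖ = 2 * |cos (π * x)| := by
      have e1 : ex (x + 1 / 2) = - ex x := by
        rw [ex_add]
        have : ex (1 / 2) = -1 := by
          unfold ex
          rw [show ((2 * π * (1 / 2) : ℝ) : ℂ) = π by push_cast; ring, Complex.exp_pi_mul_I]
        rw [this]; ring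
      have := norm_ex_sub_one (x + 1 / 2)
      rw [e1, mul_add, mul_one_div, sin_add_pi_div_two] at this
      rw [← this, ← norm_neg]
      congr 1; ring
    have h8 : ‖∑ b ∈ range g, ex (b * x)‖ ≤ 2 * √(1 - σ ^ 2) + (g - 2) := by
      obtain ⟨n, rfl⟩ : ∃ n, g = 2 + n := ⟨g - 2, by omega⟩
      rw [sum_range_add]
      refine (norm_add_le _ _).trans ?_
      gcongr
      · rw [sum_range_succ, sum_range_one]
        simp only [Nat.cast_zero, zero_mul, ex_zero, Nat.cast_one, one_mul]
        rw [h7]; linarith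
      · refine (norm_sum_le _ _).trans ?_
        simp [norm_ex]
    have h9 : dig g x * g ≤ 2 * √(1 - σ ^ 2) + (g - 2) := by
      unfold dig
      rwa [div_mul_cancel₀ _ (by linarith)]
    rw [le_div_iff₀ (by linarith)]
    linarith [dig_le_one g x]

lemma exists_digitCoeff_le_pow {g : ℕ} (hg : 2 ≤ g) {κ : ℝ} (hκ : 0 < κ) :
    ∃ ρ : ℝ, 0 < ρ ∧ ρ < 1 ∧ ∀ (L : ℕ) (ω : ℕ → ℝ),
      (∀ i, i + 1 < L → ∀ n : ℤ, κ ≤ |ω (i + 1) - g * ω i - n|) →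
      ∀ r, digitCoeff g L ω r ≤ ρ ^ (L / 2) := by
  have hg' : (g : ℝ) ≠ 0 := by positivity
  obtain ⟨ρ, hρ0, hρ1, hρ⟩ := exists_dig_lt_one hg (κ := κ / (2 * (g + 1))) (by positivity)
  refine ⟨ρ, hρ0, hρ1, fun L ω hω r => ?_⟩
  have pair : ∀ i, i + 1 < L → dig g (ω i + r * g ^ i / g ^ L) *
      dig g (ω (i + 1) + r * g ^ (i + 1) / g ^ L) ≤ ρ := by
    intro i hi
    by_cases h1 : ∀ n : ℤ, κ / (2 * (g + 1)) ≤ |ω i + r * g ^ i / g ^ L - n|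
    · exact (mul_le_of_le_one_right (dig_nonneg _ _) (dig_le_one _ _)).trans (hρ _ h1)
    by_cases h2 : ∀ n : ℤ, κ / (2 * (g + 1)) ≤ |ω (i + 1) + r * g ^ (i + 1) / g ^ L - n|
    · exact (mul_le_of_le_one_left (dig_nonneg _ _) (dig_le_one _ _)).trans (hρ _ h2)
    exfalso
    push Not at h1 h2
    obtain ⟨n, hn⟩ := h1
    obtain ⟨n', hn'⟩ := h2
    have h3 := hω i hi (n' - g * n)
    have e : ω (i + 1) - g * ω i - ((n' - g * n : ℤ) : ℝ)
        = (ω (i + 1) + r * g ^ (i + 1) / g ^ L - n') - g * (ω i + r * g ^ i / g ^ L - n) := by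
      push_cast
      field_simp
      ring
    rw [e] at h3
    have h4 := abs_sub (ω (i + 1) + r * g ^ (i + 1) / g ^ L - n') (g * (ω i + r * g ^ i / g ^ L - n))
    rw [abs_mul, Nat.abs_cast] at h4
    have h5 : κ / (2 * (g + 1)) + g * (κ / (2 * (g + 1))) = κ / 2 := by field_simp; ring
    have h6 : (g : ℝ) * |ω i + r * g ^ i / g ^ L - n| ≤ g * (κ / (2 * (g + 1))) := by gcongr
    linarith
  have main : ∀ M, 2 * M ≤ L →
      ∏ i ∈ range (2 * M), dig g (ω i + r * g ^ i / g ^ L) ≤ ρ ^ M := by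
    intro M
    induction M with
    | zero => simp
    | succ M ih =>
      intro hM
      rw [show 2 * (M + 1) = 2 * M + 1 + 1 by ring, prod_range_succ, prod_range_succ, mul_assoc,
        pow_succ]
      exact mul_le_mul (ih (by omega)) (pair _ (by omega))
        (mul_nonneg (dig_nonneg _ _) (dig_nonneg _ _)) (pow_nonneg hρ0.le _)
  refine le_trans ?_ (main (L / 2) (by omega))
  exact prod_le_prod_of_subset_of_le_one (range_mono (by omega))
        (fun i _ => dig_nonneg _ _) fun i _ _ => dig_le_one _ _

/-- A convenient form of `min T (1 / |sin (π x)|)`. -/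
noncomputable def cut (T x : ℝ) : ℝ := T / max 1 (T * |sin (π * x)|)

lemma cut_nonneg {T : ℝ} (hT : 0 ≤ T) (x : ℝ) : 0 ≤ cut T x := by
  unfold cut; positivity

lemma cut_le {T : ℝ} (hT : 0 ≤ T) (x : ℝ) : cut T x ≤ T :=
  div_le_self hT (le_max_left _ _)

lemma cut_mul_sin_le (T x : ℝ) : cut T x * |sin (π * x)| ≤ 1 := by
  unfold cut
  rw [div_mul_eq_mul_div, div_le_one (by positivity)]
  exact le_max_right _ _

lemma le_cut {A T x : ℝ} (hT : 0 ≤ T) (h1 : A ≤ T) (h2 : A * |sin (π * x)| ≤ 1) :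
    A ≤ cut T x := by
  unfold cut
  rw [le_div_iff₀ (by positivity)]
  rcases le_total 1 (T * |sin (π * x)|) with h | h
  · rw [max_eq_right h]; nlinarith
  · rw [max_eq_left h]; linarith

lemma cut_mono {T T' : ℝ} (hT : 0 ≤ T) (h : T ≤ T') (x : ℝ) : cut T x ≤ cut T' x :=
  le_cut (hT.trans h) ((cut_le hT x).trans h) (cut_mul_sin_le T x)

lemma norm_sum_Ioc_ex_le_cut {a b : ℕ} {T : ℝ} (hT : (b : ℝ) ≤ T) (x : ℝ) :
    ‖∑ k ∈ Ioc a b, ex (k * x)‖ ≤ cut T x := by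
  have hT0 : 0 ≤ T := (Nat.cast_nonneg b).trans hT
  have e : ‖∑ k ∈ Ioc a b, ex (k * x)‖ = ‖∑ j ∈ range (b - a), ex (j * x)‖ := by
    have : ∑ k ∈ Ioc a b, ex (k * x) = ex ((a + 1) * x) * ∑ j ∈ range (b - a), ex (j * x) := by
      rw [← Ico_add_one_add_one_eq_Ioc, sum_Ico_eq_sum_range, mul_sum,
        show b + 1 - (a + 1) = b - a by omega]
      refine sum_congr rfl fun j _ => ?_
      rw [← ex_add]; congr 1; push_cast; ring
    rw [this, norm_mul, norm_ex, one_mul]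
  rw [e]
  refine le_cut hT0 ?_ ?_
  · refine (norm_sum_ex_le _ _).trans (le_trans ?_ hT)
    exact_mod_cast Nat.sub_le _ _
  · rw [norm_sum_ex_mul_sin]; exact abs_sin_le_one _

lemma norm_sum_Ioc_mul_le {w : ℕ → ℝ} (hw : Monotone w) {z : ℕ → ℂ} {B : ℝ} {b : ℕ}
    (hB : ∀ a ≤ b, ‖∑ k ∈ Ioc a b, z k‖ ≤ B) {a : ℕ} (hab : a ≤ b) (h0 : 0 ≤ w a) :
    ‖∑ k ∈ Ioc a b, w k * z k‖ ≤ w b * B := by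
  have key : ∀ n a, a + n = b →
      ‖∑ k ∈ Ioc a b, w k * z k - w a * ∑ k ∈ Ioc a b, z k‖ ≤ (w b - w a) * B := by
    intro n
    induction n with
    | zero => rintro a rfl; simp
    | succ n ih =>
      intro a ha
      have h := ih (a + 1) (by omega)
      have hI : Ioc a b = insert (a + 1) (Ioc (a + 1) b) := by
        ext k; simp only [mem_Ioc, mem_insert]; omega
      have hn : a + 1 ∉ Ioc (a + 1) b := by simp
      have e : ∑ k ∈ Ioc a b, w k * z k - w a * ∑ k ∈ Ioc a b, z k
          = (∑ k ∈ Ioc (a + 1) b, w k * z k - w (a + 1) * ∑ k ∈ Ioc (a + 1) b, z k)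
            + ((w (a + 1) - w a : ℝ) : ℂ) * ∑ k ∈ Ioc a b, z k := by
        rw [hI, sum_insert hn, sum_insert hn]; push_cast; ring
      rw [e]
      refine (norm_add_le _ _).trans ?_
      rw [norm_mul, Complex.norm_real, Real.norm_of_nonneg (by linarith [hw (Nat.le_succ a)])]
      have := mul_le_mul_of_nonneg_left (hB a (by omega))
        (by linarith [hw (Nat.le_succ a)] : 0 ≤ w (a + 1) - w a)
      linarith
  have h := key (b - a) a (by omega)
  have h2 := mul_le_mul_of_nonneg_left (hB a hab) h0
  have h3 := norm_le_norm_sub_add (∑ k ∈ Ioc a b, w k * z k) (w a * ∑ k ∈ Ioc a b, z k)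
  rw [norm_mul, Complex.norm_real, Real.norm_of_nonneg h0] at h3
  linarith

lemma one_le_abs_sin_mul {d r : ℕ} (h2 : 2 ≤ r) (hr : r + 2 ≤ d) {δ : ℝ} (hδ : |δ| ≤ 3 / 2) :
    1 ≤ |sin (π * ((r + δ) / d))| * (d * (((r - 1 : ℕ) : ℝ)⁻¹ + ((d - r - 1 : ℕ) : ℝ)⁻¹)) := by
  obtain ⟨u, rfl⟩ : ∃ u, r = u + 2 := ⟨r - 2, by omega⟩
  obtain ⟨v, rfl⟩ : ∃ v, d = u + 2 + (v + 2) := ⟨d - (u + 2) - 2, by omega⟩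
  rw [show u + 2 - 1 = u + 1 by omega, show u + 2 + (v + 2) - (u + 2) - 1 = v + 1 by omega]
  obtain ⟨hl, hu⟩ := abs_le.1 hδ
  push_cast
  have hu0 : (0 : ℝ) ≤ u := Nat.cast_nonneg u
  have hv0 : (0 : ℝ) ≤ v := Nat.cast_nonneg v
  set D : ℝ := u + 2 + (v + 2) with hD
  have hD0 : 0 < D := by positivity
  set p : ℝ := u + 2 + δ with hp
  set q : ℝ := v + 2 - δ with hq
  have hp1 : ((u : ℝ) + 1) / 2 ≤ p := by linarith
  have hq1 : ((v : ℝ) + 1) / 2 ≤ q := by linarith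
  have hp0 : 0 < p := by linarith
  have hq0 : 0 < q := by linarith
  have hz := sin_pi_lower (z := p / D) (by positivity) (by rw [div_lt_one hD0]; linarith)
  have e1 : p / D * (1 - p / D) = p * q / D ^ 2 := by
    have : q = D - p := by rw [hD]; ring
    rw [this]; field_simp
  rw [e1] at hz
  have h1 : 1 / ((u : ℝ) + 1) + 1 / ((v : ℝ) + 1) ≥ 1 / (2 * p) + 1 / (2 * q) := by
    gcongr <;> linarith
  have e2 : D * (1 / (2 * p) + 1 / (2 * q)) = D ^ 2 / (2 * (p * q)) := by
    have : D = p + q := by rw [hD]; ring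
    rw [this]; field_simp; ring
  have hpi : 2 ≤ π := two_le_pi
  calc (1 : ℝ) ≤ π / 2 := by linarith
    _ = π * (p * q / D ^ 2) * (D ^ 2 / (2 * (p * q))) := by field_simp
    _ ≤ |sin (π * (p / D))| * (D * (((u : ℝ) + 1)⁻¹ + ((v : ℝ) + 1)⁻¹)) := by
      rw [← e2]
      simp only [one_div] at h1 ⊢
      refine mul_le_mul (hz.trans (le_abs_self _)) ?_ (by positivity) (abs_nonneg _)
      gcongr ?_ * ?_

lemma sum_cut_block_le {d : ℕ} (hd : 0 < d) {a : ℤ} (ha : IsCoprime a (d : ℤ)) {α : ℝ}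
    (hα : |α - a / d| ≤ 1 / d ^ 2) (h₀ : ℕ) {T : ℝ} (hT : 0 ≤ T) :
    ∑ j ∈ range d, cut T (α * (h₀ + j)) ≤ 3 * T + 2 * d * (1 + log d) := by
  have hd' : (0 : ℝ) < d := by exact_mod_cast hd
  set c : ℤ := round (d * (α * h₀)) with hc
  refine le_trans ?_ (sum_grid_le (d := d) (Y := T) (W := d) hT hd'.le)
  rw [← sum_mod_perm d hd a c ha (grid d T d)]
  refine sum_le_sum fun j hj => ?_
  have hj' : (j : ℝ) ≤ d := by exact_mod_cast (mem_range.1 hj).le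
  unfold grid
  split_ifs with h
  · set r := ((a * j + c) % d).toNat with hr
    have hd'' : (0 : ℤ) < d := by exact_mod_cast hd
    have hr' : (r : ℤ) = (a * j + c) % d := Int.toNat_of_nonneg (Int.emod_nonneg _ hd''.ne')
    have hr2 : a * j + c = r + d * ((a * j + c) / d) := by rw [hr', Int.emod_add_mul_ediv]
    set k : ℤ := (a * j + c) / d with hk
    have hr3 : (a : ℝ) * j + c = r + d * k := by exact_mod_cast hr2
    set δ : ℝ := (d * (α * h₀) - c) + d * j * (α - a / d) with hδ
    have hδ1 : |δ| ≤ 3 / 2 := by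
      have h1 : |d * (α * h₀) - c| ≤ 1 / 2 := abs_sub_round _
      have h2 : |d * j * (α - a / d)| ≤ 1 := by
        rw [abs_mul, abs_of_nonneg (by positivity : (0 : ℝ) ≤ d * j)]
        calc _ ≤ (d : ℝ) * d * (1 / d ^ 2) := by gcongr
          _ = 1 := by field_simp
      have := abs_add_le (d * (α * h₀) - c) (d * j * (α - a / d))
      linarith
    have e : α * (h₀ + j) = (r + δ) / d + k := by
      have : (r : ℝ) = a * j + c - d * k := by linarith
      rw [this, hδ]; field_simp; ring
    have hs := one_le_abs_sin_mul h.1 h.2 hδ1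
    have hcut := cut_mul_sin_le T (α * (h₀ + j))
    rw [e, abs_sin_pi_add_int] at hcut
    rw [e]
    have hne : 0 < |sin (π * ((r + δ) / d))| := by
      rcases (abs_nonneg (sin (π * ((r + δ) / d)))).eq_or_lt with h0 | h0
      · rw [← h0] at hs; norm_num at hs
      · exact h0
    refine le_of_mul_le_mul_right ?_ hne
    rw [mul_comm (_ * (_ + _))]
    exact hcut.trans hs
  · exact cut_le hT _

lemma sum_cut_le {d : ℕ} (hd : 0 < d) {a : ℤ} (ha : IsCoprime a (d : ℤ)) {α : ℝ}
    (hα : |α - a / d| ≤ 1 / d ^ 2) (H : ℕ) {T : ℝ} (hT : 0 ≤ T) :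
    ∑ h ∈ range H, cut T (α * h) ≤ (H / d + 1) * (3 * T + 2 * d * (1 + log d)) := by
  have hd' : (0 : ℝ) < d := by exact_mod_cast hd
  have hl : 0 ≤ log (d : ℝ) := log_natCast_nonneg d
  calc _ ≤ ∑ h ∈ range (d * (H / d + 1)), cut T (α * h) := by
        refine sum_le_sum_of_subset_of_nonneg (range_mono ?_) fun _ _ _ => cut_nonneg hT _
        have := Nat.div_add_mod H d
        have := Nat.mod_lt H hd
        rw [mul_add]; omega
    _ = ∑ j ∈ range (H / d + 1), ∑ i ∈ range d, cut T (α * ((d * j : ℕ) + i)) := by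
        rw [sum_range_mul_eq]
        refine sum_congr rfl fun j _ => sum_congr rfl fun i _ => ?_
        congr 2; push_cast; ring
    _ ≤ ∑ j ∈ range (H / d + 1), (3 * T + 2 * d * (1 + log d)) :=
        sum_le_sum fun j _ => sum_cut_block_le hd ha hα _ hT
    _ = ((H / d : ℕ) + 1) * (3 * T + 2 * d * (1 + log d)) := by
        rw [sum_const, card_range, nsmul_eq_mul]; push_cast; ring
    _ ≤ _ := by
        gcongr
        exact Nat.cast_div_le

lemma cut_le_of_half {d : ℕ} {a : ℤ} (ha : IsCoprime a (d : ℤ)) {α : ℝ}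
    (hα : |α - a / d| ≤ 1 / d ^ 2) {m : ℕ} (hm : 0 < m) (hmd : 2 * m ≤ d) (T : ℝ) :
    cut T (α * m) ≤ 2 * d := by
  have hd' : (0 : ℝ) < d := by exact_mod_cast (by omega : 0 < d)
  have hm' : 2 * (m : ℝ) ≤ d := by exact_mod_cast hmd
  have hd1 : (2 : ℝ) ≤ d := by exact_mod_cast (by omega : 2 ≤ d)
  have far : ∀ n : ℤ, 1 / (2 * d) ≤ |α * m - n| := by
    intro n
    have h1 : (1 : ℝ) ≤ |((a * m - n * d : ℤ) : ℝ)| := by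
      rw [← Int.cast_abs]
      exact_mod_cast Int.one_le_abs (fun h => by
        have h2 : (d : ℤ) ∣ a * m := ⟨n, by linarith⟩
        have h3 : (d : ℤ) ∣ m := ha.symm.dvd_of_dvd_mul_left h2
        have := Nat.le_of_dvd hm (Int.natCast_dvd_natCast.1 h3)
        omega)
    have h2 : |m * (α - a / d)| ≤ 1 / (2 * d) := by
      rw [abs_mul, Nat.abs_cast]
      calc _ ≤ (d / 2 : ℝ) * (1 / d ^ 2) := by gcongr; linarith
        _ = 1 / (2 * d) := by field_simp
    have h3 : ((a * m - n * d : ℤ) : ℝ) = d * ((α * m - n) - m * (α - a / d)) := by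
      push_cast; field_simp; ring
    rw [h3, abs_mul, Nat.abs_cast] at h1
    have h4 := abs_sub (α * m - n) (m * (α - a / d))
    have h5 : 1 / (d : ℝ) ≤ |α * m - n - m * (α - a / d)| := by
      rw [div_le_iff₀ hd', mul_comm]; exact h1
    have h6 : 1 / (d : ℝ) = 1 / (2 * d) + 1 / (2 * d) := by field_simp; norm_num
    linarith
  set x := α * m with hx
  set f := Int.fract x with hf
  have hf0 := Int.fract_nonneg x
  have hf1 := Int.fract_lt_one x
  have hff := Int.floor_add_fract x
  have h1 := far ⌊x⌋
  have h2 := far (⌊x⌋ + 1)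
  rw [Int.self_sub_floor, abs_of_nonneg hf0] at h1
  push_cast at h2
  rw [abs_of_nonpos (by linarith)] at h2
  have h3 : 1 / (2 * d) ≤ 1 - f := by linarith
  have hpos : (0 : ℝ) < 1 / (2 * d) := by positivity
  have hsin := sin_pi_lower (z := f) (by linarith) (by linarith)
  have hs : 1 / (2 * d) ≤ |sin (π * x)| := by
    rw [← Int.fract_add_floor x, abs_sin_pi_add_int]
    refine le_trans ?_ (hsin.trans (le_abs_self _))
    have h4 : 1 / (2 * d) ≤ 2 * (f * (1 - f)) := by
      rcases le_total f (1 / 2) with h | h <;> nlinarith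
    have : 0 ≤ f * (1 - f) := mul_nonneg hf0 (by linarith)
    nlinarith [two_le_pi]
  have hc := cut_mul_sin_le T x
  have hne : 0 < |sin (π * x)| := hpos.trans_le hs
  refine le_of_mul_le_mul_right (hc.trans ?_) hne
  calc (1 : ℝ) = 2 * d * (1 / (2 * d)) := by field_simp
    _ ≤ _ := by gcongr

lemma sum_cut_div_le {d : ℕ} (hd : 0 < d) {a : ℤ} (ha : IsCoprime a (d : ℤ)) {α : ℝ}
    (hα : |α - a / d| ≤ 1 / d ^ 2) (M : ℕ) {X ℓ : ℝ} (hX : 0 ≤ X) (hℓ : 1 + log d ≤ ℓ)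
    (hM : 1 + log M ≤ ℓ) :
    ∑ m ∈ Ioc 0 M, cut (X / m) (α * m) ≤ ℓ * (9 * X / d + 10 * d + 2 * M) := by
  have hd' : (0 : ℝ) < d := by exact_mod_cast hd
  have hd1 : (1 : ℝ) ≤ d := by exact_mod_cast hd
  have hl : 0 ≤ log (d : ℝ) := log_natCast_nonneg d
  have hl1 : 1 ≤ ℓ := by linarith
  have first : ∑ i ∈ range d, cut (X / i) (α * i) ≤ 3 * (2 * X / d + 2 * d) + 2 * d * ℓ := by
    have hT : 0 ≤ 2 * X / d + 2 * d := by positivity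
    refine le_trans ?_ ((sum_cut_block_le hd ha hα 0 hT).trans (by gcongr))
    refine sum_le_sum fun i hi => ?_
    simp only [Nat.cast_zero, zero_add]
    refine le_cut hT ?_ (cut_mul_sin_le _ _)
    rcases Nat.eq_zero_or_pos i with rfl | h0
    · simp [cut]; exact hT
    rcases le_or_gt (2 * i) d with h | h
    · have := cut_le_of_half ha hα h0 h (X / i)
      have : 0 ≤ 2 * X / d := by positivity
      linarith
    · refine (cut_le (by positivity) _).trans ?_
      have h0' : (0 : ℝ) < i := by exact_mod_cast h0
      have h' : (d : ℝ) ≤ 2 * i := by exact_mod_cast h.le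
      have : X / i ≤ 2 * X / d := by
        rw [div_le_div_iff₀ h0' hd']; nlinarith
      linarith
  have other : ∀ j : ℕ, ∑ i ∈ range d, cut (X / ((i + d * (j + 1) : ℕ) : ℝ))
      (α * ((i + d * (j + 1) : ℕ) : ℝ)) ≤ 3 * (X / d * ((j + 1 : ℕ) : ℝ)⁻¹) + 2 * d * ℓ := by
    intro j
    have hT : 0 ≤ X / d * ((j + 1 : ℕ) : ℝ)⁻¹ := by positivity
    refine le_trans ?_ ((sum_cut_block_le hd ha hα (d * (j + 1)) hT).trans (by gcongr))
    refine sum_le_sum fun i hi => ?_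
    have e : ((i + d * (j + 1) : ℕ) : ℝ) = ((d * (j + 1) : ℕ) : ℝ) + i := by push_cast; ring
    rw [e]
    refine cut_mono (by positivity) ?_ _
    rw [← div_eq_mul_inv, div_div]
    gcongr
    push_cast
    have : (0 : ℝ) ≤ i := Nat.cast_nonneg i
    linarith
  have hlog : log ((M / d : ℕ) : ℝ) ≤ log M := by
    rcases Nat.eq_zero_or_pos (M / d) with h | h
    · rw [h]; simpa using log_natCast_nonneg M
    · exact log_le_log (by exact_mod_cast h) (by exact_mod_cast Nat.div_le_self M d)
  have hharm : ∑ j ∈ range (M / d), ((j + 1 : ℕ) : ℝ)⁻¹ ≤ ℓ := by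
    have := harmonic_le_one_add_log (M / d)
    unfold harmonic at this
    push_cast at this ⊢
    linarith
  have hMd : ((M / d : ℕ) : ℝ) * d ≤ M := by exact_mod_cast Nat.div_mul_le_self M d
  calc _ ≤ ∑ m ∈ range (d * (M / d + 1)), cut (X / m) (α * m) := by
        refine sum_le_sum_of_subset_of_nonneg ?_ fun _ _ _ => cut_nonneg (by positivity) _
        intro m hm
        rw [mem_Ioc] at hm
        rw [mem_range]
        have := Nat.div_add_mod M d
        have := Nat.mod_lt M hd
        rw [mul_add]; omega
    _ = ∑ j ∈ range (M / d), ∑ i ∈ range d, cut (X / ((i + d * (j + 1) : ℕ) : ℝ))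
          (α * ((i + d * (j + 1) : ℕ) : ℝ)) + ∑ i ∈ range d, cut (X / i) (α * i) := by
        rw [sum_range_mul_eq, sum_range_succ']
        simp
    _ ≤ ∑ j ∈ range (M / d), (3 * (X / d * ((j + 1 : ℕ) : ℝ)⁻¹) + 2 * d * ℓ)
          + (3 * (2 * X / d + 2 * d) + 2 * d * ℓ) :=
        add_le_add (sum_le_sum fun j _ => other j) first
    _ = 3 * (X / d) * ∑ j ∈ range (M / d), ((j + 1 : ℕ) : ℝ)⁻¹ + 2 * ℓ * (((M / d : ℕ) : ℝ) * d)
          + (6 * (X / d) + 6 * d + 2 * d * ℓ) := by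
        rw [sum_add_distrib, ← mul_sum, ← mul_sum, sum_const, card_range, nsmul_eq_mul]; ring
    _ ≤ 3 * (X / d) * ℓ + 2 * ℓ * M + (6 * (X / d) * ℓ + 6 * d * ℓ + 2 * d * ℓ) := by
        have : 0 ≤ X / d := by positivity
        gcongr ?_ + ?_ + (?_ + ?_ + _)
        · gcongr
        · gcongr
        · nlinarith
        · nlinarith
    _ ≤ _ := by
        have : 0 ≤ d * ℓ := by positivity
        rw [mul_div_assoc]
        nlinarith

open scoped ArithmeticFunction.vonMangoldt ArithmeticFunction.zeta ArithmeticFunction.Moebius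

/-- The restriction of an arithmetic function to `n ≤ U`. -/
def lowPart (f : ArithmeticFunction ℝ) (U : ℕ) : ArithmeticFunction ℝ :=
  ⟨fun n => if n ≤ U then f n else 0, by simp⟩

/-- The restriction of an arithmetic function to `n > U`. -/
def highPart (f : ArithmeticFunction ℝ) (U : ℕ) : ArithmeticFunction ℝ :=
  ⟨fun n => if U < n then f n else 0, by simp⟩

lemma lowPart_apply (f : ArithmeticFunction ℝ) (U n : ℕ) :
    lowPart f U n = if n ≤ U then f n else 0 := rfl

lemma highPart_apply (f : ArithmeticFunction ℝ) (U n : ℕ) :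
    highPart f U n = if U < n then f n else 0 := rfl

lemma lowPart_add_highPart (f : ArithmeticFunction ℝ) (U : ℕ) :
    lowPart f U + highPart f U = f := by
  ext n
  rw [ArithmeticFunction.add_apply, lowPart_apply, highPart_apply]
  rcases le_or_gt n U with h | h
  · simp [h, h.not_gt]
  · simp [h, h.not_ge]

/-- The Vaughan identity. -/
lemma vaughan (U : ℕ) : (Λ : ArithmeticFunction ℝ) = lowPart Λ U
    + lowPart (μ : ArithmeticFunction ℝ) U * ArithmeticFunction.log
    - lowPart (μ : ArithmeticFunction ℝ) U * lowPart Λ U * (ζ : ArithmeticFunction ℝ)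
    + highPart (μ : ArithmeticFunction ℝ) U * (ζ : ArithmeticFunction ℝ) * highPart Λ U := by
  have h1 := lowPart_add_highPart Λ U
  have h2 := lowPart_add_highPart (μ : ArithmeticFunction ℝ) U
  have h3 : (μ : ArithmeticFunction ℝ) * (ζ : ArithmeticFunction ℝ) = 1 :=
    ArithmeticFunction.coe_moebius_mul_coe_zeta
  have h4 := ArithmeticFunction.vonMangoldt_mul_zeta
  rw [← h2] at h3
  rw [← h1] at h4
  rw [← h4]
  conv_lhs => rw [← h1]
  linear_combination -(highPart Λ U) * h3

lemma sum_Ioc_mul_twist (f h : ArithmeticFunction ℝ) (F : ℕ → ℂ) (N : ℕ) :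
    ∑ n ∈ Ioc 0 N, ((f * h) n : ℂ) * F n
      = ∑ m ∈ Ioc 0 N, (f m : ℂ) * ∑ k ∈ Ioc 0 (N / m), (h k : ℂ) * F (m * k) := by
  have step1 : ∑ n ∈ Ioc 0 N, ((f * h) n : ℂ) * F n
      = ∑ x ∈ Ioc 0 N ×ˢ Ioc 0 N with x.1 * x.2 ≤ N, (f x.1 : ℂ) * h x.2 * F (x.1 * x.2) := by
    trans ∑ n ∈ Ioc 0 N, ∑ x ∈ Ioc 0 N ×ˢ Ioc 0 N with x.1 * x.2 = n,
      (f x.1 : ℂ) * h x.2 * F (x.1 * x.2)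
    · refine sum_congr rfl fun n hn ↦ ?_
      simp only [mem_Ioc] at hn
      rw [ArithmeticFunction.mul_apply,
        Nat.divisorsAntidiagonal_eq_prod_filter_of_le hn.1.ne' hn.2]
      push_cast
      rw [sum_mul]
      refine sum_congr rfl fun x hx => ?_
      rw [(mem_filter.1 hx).2]
    · simp_rw [sum_filter]
      rw [sum_comm]
      exact sum_congr rfl fun _ _ ↦ (by simp_all)
  rw [step1, sum_filter, sum_product]
  refine sum_congr rfl fun n hn ↦ ?_
  rw [← sum_filter, mul_sum]
  simp only [mul_assoc]
  refine sum_congr ?_ fun _ _ => rfl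
  ext k
  simp only [mem_filter, mem_Ioc] at hn ⊢
  rw [Nat.le_div_iff_mul_le hn.1, mul_comm k]
  constructor
  · rintro ⟨⟨h1, _⟩, h2⟩; exact ⟨h1, h2⟩
  · rintro ⟨h1, h2⟩
    exact ⟨⟨h1, le_trans (Nat.le_mul_of_pos_left k hn.1) h2⟩, h2⟩

lemma norm_sum_typeI_le {f h : ArithmeticFunction ℝ} {A W : ℝ} {M X : ℕ} (hA : 0 ≤ A)
    (hf : ∀ m, |f m| ≤ A) (hM : ∀ m, M < m → f m = 0) {w : ℕ → ℝ} (hw : Monotone w)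
    (hw0 : 0 ≤ w 0) (hwX : w X ≤ W) (hh : ∀ k, 0 < k → h k = w k) (α : ℝ) :
    ‖∑ n ∈ Ioc 0 X, ((f * h) n : ℂ) * ex (n * α)‖
      ≤ A * W * ∑ m ∈ Ioc 0 M, cut (X / m) (α * m) := by
  rw [sum_Ioc_mul_twist f h (fun n => ex (n * α)) X]
  have hW : 0 ≤ W := hw0.trans ((hw (Nat.zero_le X)).trans hwX)
  have hc : ∀ m : ℕ, 0 ≤ cut (X / m) (α * m) := fun m => cut_nonneg (by positivity) _
  have inner : ∀ m ∈ Ioc 0 X, ‖∑ k ∈ Ioc 0 (X / m), (h k : ℂ) * ex ((m * k : ℕ) * α)‖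
      ≤ W * cut (X / m) (α * m) := by
    intro m _
    have e : ∑ k ∈ Ioc 0 (X / m), (h k : ℂ) * ex ((m * k : ℕ) * α)
        = ∑ k ∈ Ioc 0 (X / m), (w k : ℂ) * ex (k * (α * m)) := by
      refine sum_congr rfl fun k hk => ?_
      rw [hh k (mem_Ioc.1 hk).1]; congr 2; push_cast; ring
    rw [e]
    refine (norm_sum_Ioc_mul_le hw (B := cut (X / m) (α * m)) (fun a _ => ?_) (Nat.zero_le _)
      hw0).trans ?_
    · exact norm_sum_Ioc_ex_le_cut Nat.cast_div_le _
    · exact mul_le_mul_of_nonneg_right ((hw (Nat.div_le_self X m)).trans hwX) (hc m)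
  refine (norm_sum_le _ _).trans ?_
  calc _ ≤ ∑ m ∈ Ioc 0 X, |f m| * (W * cut (X / m) (α * m)) := by
        refine sum_le_sum fun m hm => ?_
        rw [norm_mul, Complex.norm_real, Real.norm_eq_abs]
        exact mul_le_mul_of_nonneg_left (inner m hm) (abs_nonneg _)
    _ ≤ ∑ m ∈ Ioc 0 X, if m ≤ M then A * W * cut (X / m) (α * m) else 0 := by
        refine sum_le_sum fun m hm => ?_
        split_ifs with hmM
        · rw [mul_assoc]
          exact mul_le_mul_of_nonneg_right (hf m) (mul_nonneg hW (hc m))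
        · rw [hM m (by omega)]; simp
    _ ≤ ∑ m ∈ Ioc 0 M, A * W * cut (X / m) (α * m) := by
        rw [← sum_filter]
        refine sum_le_sum_of_subset_of_nonneg ?_ fun m _ _ =>
          mul_nonneg (mul_nonneg hA hW) (hc m)
        intro m hm
        simp only [mem_filter, mem_Ioc] at hm ⊢
        omega
    _ = _ := by rw [mul_sum]

lemma card_divisors_mul_le (a b : ℕ) :
    (a * b).divisors.card ≤ a.divisors.card * b.divisors.card := by
  classical
  rw [Nat.divisors_mul]
  exact card_mul_le

lemma card_divisorsAntidiagonal (n : ℕ) : n.divisorsAntidiagonal.card = n.divisors.card := by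
  rw [← Nat.map_div_right_divisors, card_map]

lemma sum_Ioc_inv_le (X : ℕ) : ∑ m ∈ Ioc 0 X, (m : ℝ)⁻¹ ≤ 1 + log X := by
  have := harmonic_le_one_add_log X
  rw [harmonic_eq_sum_Icc] at this
  push_cast at this
  exact this

lemma sum_divisor_sum_le {f h : ℕ → ℝ} (hf : ∀ n, 0 ≤ f n) (hh : ∀ n, 0 ≤ h n) (X : ℕ) :
    ∑ n ∈ Ioc 0 X, ∑ p ∈ n.divisorsAntidiagonal, f p.1 * h p.2
      ≤ (∑ n ∈ Ioc 0 X, f n) * ∑ n ∈ Ioc 0 X, h n := by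
  let f' : ArithmeticFunction ℝ := ⟨fun n => if n = 0 then 0 else f n, by simp⟩
  let h' : ArithmeticFunction ℝ := ⟨fun n => if n = 0 then 0 else h n, by simp⟩
  have key := ArithmeticFunction.sum_Ioc_mul_eq_sum_prod_filter f' h' X
  have e1 : ∑ n ∈ Ioc 0 X, ∑ p ∈ n.divisorsAntidiagonal, f p.1 * h p.2
      = ∑ n ∈ Ioc 0 X, (f' * h') n := by
    refine sum_congr rfl fun n _ => ?_
    rw [ArithmeticFunction.mul_apply]
    refine sum_congr rfl fun p hp => ?_
    have h1 := Nat.ne_zero_of_mem_divisorsAntidiagonal hp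
    change _ = (if p.1 = 0 then 0 else f p.1) * (if p.2 = 0 then 0 else h p.2)
    rw [if_neg h1.1, if_neg h1.2]
  rw [e1, key, sum_mul_sum, ← sum_product']
  calc _ ≤ ∑ x ∈ Ioc 0 X ×ˢ Ioc 0 X, f' x.1 * h' x.2 := by
        refine sum_le_sum_of_subset_of_nonneg (filter_subset _ _) fun x _ _ => ?_
        change 0 ≤ (if x.1 = 0 then 0 else f x.1) * (if x.2 = 0 then 0 else h x.2)
        have := hf x.1
        have := hh x.2
        split_ifs <;> positivity
    _ = _ := by
        refine sum_congr rfl fun x hx => ?_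
        simp only [mem_product, mem_Ioc] at hx
        change (if x.1 = 0 then 0 else f x.1) * (if x.2 = 0 then 0 else h x.2) = _
        rw [if_neg hx.1.1.ne', if_neg hx.2.1.ne']

lemma sum_card_divisors_sq_div_le (X : ℕ) :
    ∑ m ∈ Ioc 0 X, (m.divisors.card : ℝ) ^ 2 / m ≤ (1 + log X) ^ 4 := by
  have one : ∑ m ∈ Ioc 0 X, (m.divisors.card : ℝ) / m ≤ (∑ m ∈ Ioc 0 X, (m : ℝ)⁻¹) ^ 2 := by
    rw [sq]
    refine le_trans (le_of_eq ?_) (sum_divisor_sum_le (f := fun n => (n : ℝ)⁻¹)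
      (h := fun n => (n : ℝ)⁻¹) (fun n => by positivity) (fun n => by positivity) X)
    refine sum_congr rfl fun m hm => ?_
    have e : ∀ p ∈ m.divisorsAntidiagonal, (p.1 : ℝ)⁻¹ * (p.2 : ℝ)⁻¹ = (m : ℝ)⁻¹ := by
      intro p hp
      rw [← mul_inv, ← Nat.cast_mul, (Nat.mem_divisorsAntidiagonal.1 hp).1]
    rw [sum_congr rfl e, sum_const, nsmul_eq_mul, card_divisorsAntidiagonal, div_eq_mul_inv]
  have two : ∑ m ∈ Ioc 0 X, (m.divisors.card : ℝ) ^ 2 / m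
      ≤ (∑ m ∈ Ioc 0 X, (m.divisors.card : ℝ) / m) ^ 2 := by
    rw [sq (∑ m ∈ Ioc 0 X, (m.divisors.card : ℝ) / m)]
    refine le_trans ?_ (sum_divisor_sum_le (f := fun n => (n.divisors.card : ℝ) / n)
      (h := fun n => (n.divisors.card : ℝ) / n) (fun n => by positivity) (fun n => by positivity) X)
    refine sum_le_sum fun m hm => ?_
    have e : ∀ p ∈ m.divisorsAntidiagonal, (m.divisors.card : ℝ) / m
        ≤ (p.1.divisors.card : ℝ) / p.1 * ((p.2.divisors.card : ℝ) / p.2) := by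
      intro p hp
      rw [div_mul_div_comm, ← Nat.cast_mul p.1, (Nat.mem_divisorsAntidiagonal.1 hp).1]
      gcongr
      rw [← (Nat.mem_divisorsAntidiagonal.1 hp).1]
      exact_mod_cast card_divisors_mul_le p.1 p.2
    refine le_trans (le_of_eq ?_) (sum_le_sum e)
    rw [sum_const, nsmul_eq_mul, card_divisorsAntidiagonal]
    ring
  have h3 := sum_Ioc_inv_le X
  have h0 : 0 ≤ ∑ m ∈ Ioc 0 X, (m : ℝ)⁻¹ := sum_nonneg fun _ _ => by positivity
  have h1 : 0 ≤ ∑ m ∈ Ioc 0 X, (m.divisors.card : ℝ) / m := sum_nonneg fun _ _ => by positivity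
  calc _ ≤ _ := two
    _ ≤ ((∑ m ∈ Ioc 0 X, (m : ℝ)⁻¹) ^ 2) ^ 2 := by gcongr
    _ ≤ ((1 + log X) ^ 2) ^ 2 := by gcongr
    _ = _ := by ring

open scoped ArithmeticFunction.vonMangoldt ArithmeticFunction.zeta ArithmeticFunction.Moebius

lemma abs_highPart_moebius_mul_zeta_le (U m : ℕ) :
    |(highPart (μ : ArithmeticFunction ℝ) U * (ζ : ArithmeticFunction ℝ)) m|
      ≤ m.divisors.card := by
  rw [ArithmeticFunction.coe_mul_zeta_apply]
  refine (abs_sum_le_sum_abs _ _).trans ?_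
  have : ∀ i ∈ m.divisors, |highPart (μ : ArithmeticFunction ℝ) U i| ≤ 1 := by
    intro i _
    rw [highPart_apply]
    split_ifs
    · rw [ArithmeticFunction.intCoe_apply]
      exact_mod_cast ArithmeticFunction.abs_moebius_le_one (n := i)
    · simp
  refine (sum_le_sum this).trans ?_
  simp

lemma highPart_mul_zeta_eq_zero (f : ArithmeticFunction ℝ) {U m : ℕ} (hm : m ≤ U) :
    (highPart f U * (ζ : ArithmeticFunction ℝ)) m = 0 := by
  rw [ArithmeticFunction.coe_mul_zeta_apply]
  refine sum_eq_zero fun i hi => ?_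
  rw [highPart_apply, if_neg]
  have := Nat.divisor_le hi
  omega

/-- The bilinear form obtained by squaring out the inner sums. -/
lemma sum_mul_norm_sq_le (β : ℕ → ℝ) (U X K : ℕ) (α : ℝ) (B : ℝ) (hβ0 : ∀ k, 0 ≤ β k)
    (hβ : ∀ k ≤ X, β k ≤ B) (hKX : K ≤ X) :
    ∑ m ∈ Ioc U X, (m : ℝ) * ‖∑ k ∈ Ioc U K with k * m ≤ X, (β k : ℂ) * ex (k * (α * m))‖ ^ 2
      ≤ B ^ 2 * (2 * ∑ k ∈ Ioc U K, (X / k : ℝ) *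
        ∑ h ∈ range k, cut (X / k) (α * h)) := by
  set b : ℕ → ℕ → ℝ := fun k l => ‖∑ m ∈ Ioc U (X / max k l), ((m : ℝ) : ℂ) * ex (m * (α * k - α * l))‖
    with hb
  have hsq : ∀ m ∈ Ioc U X,
      (((m : ℝ) * ‖∑ k ∈ Ioc U K with k * m ≤ X, (β k : ℂ) * ex (k * (α * m))‖ ^ 2 : ℝ) : ℂ)
      = ∑ k ∈ Ioc U K, ∑ l ∈ Ioc U K, ((β k * β l : ℝ) : ℂ) *
        (if k * m ≤ X ∧ l * m ≤ X then ((m : ℝ) : ℂ) * ex (m * (α * k - α * l)) else 0) := by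
    intro m _
    push_cast
    rw [← Complex.mul_conj', map_sum, sum_filter, sum_filter, sum_mul_sum, mul_sum]
    refine sum_congr rfl fun k _ => ?_
    rw [mul_sum]
    refine sum_congr rfl fun l _ => ?_
    by_cases h1 : k * m ≤ X <;> by_cases h2 : l * m ≤ X <;> simp only [h1, h2, if_true, if_false,
      and_true, and_false, mul_zero, zero_mul, and_self]
    rw [map_mul, ← ex_neg, Complex.conj_ofReal]
    have : ex (m * (α * k - α * l)) = ex (k * (α * m)) * ex (-(l * (α * m))) := by
      rw [← ex_add]; congr 1; ring
    rw [this]; ring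
  have step1 : ∑ m ∈ Ioc U X, (m : ℝ) *
      ‖∑ k ∈ Ioc U K with k * m ≤ X, (β k : ℂ) * ex (k * (α * m))‖ ^ 2
      ≤ ∑ k ∈ Ioc U K, ∑ l ∈ Ioc U K, β k * β l * b k l := by
    have e : ((∑ m ∈ Ioc U X, (m : ℝ) *
        ‖∑ k ∈ Ioc U K with k * m ≤ X, (β k : ℂ) * ex (k * (α * m))‖ ^ 2 : ℝ) : ℂ)
        = ∑ k ∈ Ioc U K, ∑ l ∈ Ioc U K, ((β k * β l : ℝ) : ℂ) *
          ∑ m ∈ Ioc U (X / max k l), ((m : ℝ) : ℂ) * ex (m * (α * k - α * l)) := by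
      rw [Complex.ofReal_sum, sum_congr rfl hsq, sum_comm]
      refine sum_congr rfl fun k hk => ?_
      rw [sum_comm]
      refine sum_congr rfl fun l hl => ?_
      rw [← mul_sum, ← sum_filter]
      congr 1
      refine sum_congr ?_ fun _ _ => rfl
      ext m
      rw [mem_Ioc] at hk hl
      have hmax : 0 < max k l := lt_max_of_lt_left (by omega)
      simp only [mem_filter, mem_Ioc]
      rw [Nat.le_div_iff_mul_le hmax, ← Nat.mul_max_mul_left, max_le_iff, mul_comm m k, mul_comm m l]
      constructor
      · rintro ⟨⟨h1, _⟩, h2⟩; exact ⟨h1, h2⟩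
      · rintro ⟨h1, h2⟩
        exact ⟨⟨h1, le_trans (Nat.le_mul_of_pos_left m (by omega)) h2.1⟩, h2⟩
    have nn : 0 ≤ ∑ m ∈ Ioc U X, (m : ℝ) *
        ‖∑ k ∈ Ioc U K with k * m ≤ X, (β k : ℂ) * ex (k * (α * m))‖ ^ 2 :=
      sum_nonneg fun _ _ => by positivity
    rw [← abs_of_nonneg nn, ← Real.norm_eq_abs, ← Complex.norm_real, e]
    refine (norm_sum_le _ _).trans (sum_le_sum fun k _ => ?_)
    refine (norm_sum_le _ _).trans (sum_le_sum fun l _ => ?_)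
    rw [norm_mul, Complex.norm_real, Real.norm_of_nonneg (mul_nonneg (hβ0 k) (hβ0 l))]
  have hb0 : ∀ k l, 0 ≤ b k l := fun k l => norm_nonneg _
  have hbs : ∀ k l, b k l = b l k := by
    intro k l
    simp only [hb]
    rw [max_comm, ← RCLike.norm_conj, map_sum]
    congr 1
    refine sum_congr rfl fun m _ => ?_
    rw [map_mul, ← ex_neg, Complex.conj_ofReal]
    congr 2; ring
  have hbc : ∀ k l, 0 < k → l ≤ k → b k l ≤ (X / k : ℝ) * cut (X / k) (α * ((k - l : ℕ) : ℝ)) := by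
    intro k l hk hl
    have hc := cut_nonneg (T := (X / k : ℝ)) (by positivity) (α * ((k - l : ℕ) : ℝ))
    simp only [hb, max_eq_left hl]
    rcases le_or_gt U (X / k) with h | h
    · refine (norm_sum_Ioc_mul_le (w := fun m => (m : ℝ)) Nat.mono_cast
        (B := cut (X / k) (α * ((k - l : ℕ) : ℝ))) (fun a _ => ?_) h (Nat.cast_nonneg _)).trans ?_
      · rw [Nat.cast_sub hl, mul_sub]
        exact norm_sum_Ioc_ex_le_cut Nat.cast_div_le _
      · gcongr
        exact Nat.cast_div_le
    · rw [Ioc_eq_empty (by omega)]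
      simp only [sum_empty, norm_zero]
      positivity
  have hB : ∀ k l, k ∈ Ioc U K → l ∈ Ioc U K → β k * β l * b k l ≤ B ^ 2 * b k l := by
    intro k l hk hl
    rw [mem_Ioc] at hk hl
    have h1 := hβ k (by omega)
    have h2 := hβ l (by omega)
    rw [sq]
    exact mul_le_mul_of_nonneg_right (mul_le_mul h1 h2 (hβ0 l) ((hβ0 k).trans h1)) (hb0 k l)
  refine step1.trans ((sum_le_sum fun k hk => sum_le_sum fun l hl => hB k l hk hl).trans ?_)
  simp_rw [← mul_sum]
  gcongr ?_ * ?_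
  have split : ∑ k ∈ Ioc U K, ∑ l ∈ Ioc U K, b k l
      ≤ 2 * ∑ k ∈ Ioc U K, ∑ l ∈ Ioc U k, b k l := by
    have h1 : ∑ k ∈ Ioc U K, ∑ l ∈ Ioc U K, b k l ≤
        ∑ k ∈ Ioc U K, ∑ l ∈ Ioc U K, ((if l ≤ k then b k l else 0) +
          (if k ≤ l then b l k else 0)) := by
      refine sum_le_sum fun k _ => sum_le_sum fun l _ => ?_
      have := hb0 k l
      rcases le_total l k with h | h
      · rw [if_pos h]
        split_ifs
        · rw [hbs l k]; linarith
        · linarith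
      · rw [if_pos h, hbs l k]
        split_ifs <;> linarith
    simp_rw [sum_add_distrib] at h1
    rw [sum_comm (f := fun k l => if k ≤ l then b l k else 0), ← two_mul] at h1
    refine h1.trans (le_of_eq ?_)
    congr 1
    refine sum_congr rfl fun k hk => ?_
    rw [← sum_filter]
    refine sum_congr ?_ fun _ _ => rfl
    ext l
    rw [mem_Ioc] at hk
    simp only [mem_filter, mem_Ioc]
    omega
  refine split.trans ?_
  gcongr with k hk
  rw [mem_Ioc] at hk
  rw [mul_sum]
  have hc : ∀ h : ℕ, 0 ≤ (X / k : ℝ) * cut (X / k) (α * h) := fun h =>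
    mul_nonneg (by positivity) (cut_nonneg (by positivity) _)
  calc _ ≤ ∑ l ∈ Ioc U k, (X / k : ℝ) * cut (X / k) (α * ((k - l : ℕ) : ℝ)) :=
        sum_le_sum fun l hl => hbc k l (by omega) (mem_Ioc.1 hl).2
    _ = ∑ h ∈ (Ioc U k).image (fun l => k - l), (X / k : ℝ) * cut (X / k) (α * h) := by
        rw [sum_image]
        intro x hx y hy hxy
        simp only [coe_Ioc, Set.mem_Ioc] at hx hy hxy
        omega
    _ ≤ _ := by
        refine sum_le_sum_of_subset_of_nonneg ?_ fun h _ _ => hc h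
        intro h hh
        obtain ⟨l, hl, rfl⟩ := mem_image.1 hh
        rw [mem_Ioc] at hl
        rw [mem_range]
        omega

lemma sum_bilinear_le {d : ℕ} (hd : 0 < d) {a : ℤ} (ha : IsCoprime a (d : ℤ)) {α : ℝ}
    (hα : |α - a / d| ≤ 1 / d ^ 2) {U X : ℕ} (hU : 0 < U) {ℓ : ℝ} (hdl : 1 + log d ≤ ℓ)
    (hXl : 1 + log X ≤ ℓ) :
    ∑ k ∈ Ioc U (X / U), (X / k : ℝ) * ∑ h ∈ range k, cut (X / k) (α * h)
      ≤ ℓ ^ 2 * (3 * X ^ 2 / d + 5 * X ^ 2 / U + 2 * X * d) := by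
  have hd' : (0 : ℝ) < d := by exact_mod_cast hd
  have hU' : (0 : ℝ) < U := by exact_mod_cast hU
  have hl1 : 1 ≤ ℓ := by linarith [log_natCast_nonneg d]
  have hpt : ∀ k ∈ Ioc U (X / U), (X / k : ℝ) * ∑ h ∈ range k, cut (X / k) (α * h)
      ≤ (3 * X ^ 2 / d + 2 * X * d * ℓ) * (k : ℝ)⁻¹ + 3 * X ^ 2 * ((k : ℝ) ^ 2)⁻¹ + 2 * X * ℓ := by
    intro k hk
    have hk0 : (0 : ℝ) < k := by exact_mod_cast (by have := (mem_Ioc.1 hk).1; omega : 0 < k)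
    have h1 := sum_cut_le hd ha hα k (T := (X / k : ℝ)) (by positivity)
    have h2 : ((k : ℝ) / d + 1) * (3 * (X / k) + 2 * d * (1 + log d))
        ≤ ((k : ℝ) / d + 1) * (3 * (X / k) + 2 * d * ℓ) := by gcongr
    calc _ ≤ (X / k : ℝ) * (((k : ℝ) / d + 1) * (3 * (X / k) + 2 * d * ℓ)) := by
          gcongr; exact h1.trans h2
      _ = _ := by field_simp; ring
  have hKX : X / U ≤ X := Nat.div_le_self X U
  have hinv : ∑ k ∈ Ioc U (X / U), (k : ℝ)⁻¹ ≤ ℓ := by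
    refine le_trans ?_ hXl
    refine le_trans ?_ (sum_Ioc_inv_le X)
    refine sum_le_sum_of_subset_of_nonneg (fun k hk => ?_) fun _ _ _ => by positivity
    rw [mem_Ioc] at hk ⊢; omega
  have hsq : ∑ k ∈ Ioc U (X / U), ((k : ℝ) ^ 2)⁻¹ ≤ (U : ℝ)⁻¹ := by
    rcases le_or_gt U (X / U) with h | h
    · have := sum_Ioc_inv_sq_le_sub (α := ℝ) hU.ne' h
      have h0 : (0 : ℝ) ≤ ((X / U : ℕ) : ℝ)⁻¹ := by positivity
      linarith
    · rw [Ioc_eq_empty (by omega)]; simp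
  have hcard : ∑ _k ∈ Ioc U (X / U), 2 * X * ℓ ≤ X / U * (2 * X * ℓ) := by
    rw [sum_const, nsmul_eq_mul, Nat.card_Ioc]
    gcongr
    refine le_trans ?_ (Nat.cast_div_le (α := ℝ))
    exact_mod_cast Nat.sub_le _ _
  calc _ ≤ ∑ k ∈ Ioc U (X / U), ((3 * X ^ 2 / d + 2 * X * d * ℓ) * (k : ℝ)⁻¹
          + 3 * X ^ 2 * ((k : ℝ) ^ 2)⁻¹ + 2 * X * ℓ) := sum_le_sum hpt
    _ ≤ (3 * X ^ 2 / d + 2 * X * d * ℓ) * ℓ + 3 * X ^ 2 * (U : ℝ)⁻¹ + X / U * (2 * X * ℓ) := by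
        rw [sum_add_distrib, sum_add_distrib, ← mul_sum, ← mul_sum]
        gcongr
    _ = 3 * X ^ 2 / d * ℓ + 2 * X * d * ℓ ^ 2 + 3 * X ^ 2 / U + 2 * X ^ 2 / U * ℓ := by
        field_simp
    _ ≤ 3 * X ^ 2 / d * ℓ ^ 2 + 2 * X * d * ℓ ^ 2 + 3 * X ^ 2 / U * ℓ ^ 2
          + 2 * X ^ 2 / U * ℓ ^ 2 := by
        have e1 : ℓ ≤ ℓ ^ 2 := by nlinarith
        have e2 : 1 ≤ ℓ ^ 2 := by nlinarith
        gcongr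
        exact le_mul_of_one_le_right (by positivity) e2
    _ = _ := by field_simp; ring

lemma vonMangoldt_le_of_le {n X : ℕ} (h : n ≤ X) : Λ n ≤ log X := by
  rcases Nat.eq_zero_or_pos n with rfl | hn
  · simpa using log_natCast_nonneg X
  · exact ArithmeticFunction.vonMangoldt_le_log.trans
      (log_le_log (by exact_mod_cast hn) (by exact_mod_cast h))

lemma norm_sum_typeII_le {d : ℕ} (hd : 0 < d) {a : ℤ} (ha : IsCoprime a (d : ℤ)) {α : ℝ}
    (hα : |α - a / d| ≤ 1 / d ^ 2) {U X : ℕ} (hU : 0 < U) {ℓ : ℝ} (hdl : 1 + log d ≤ ℓ)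
    (hXl : 1 + log X ≤ ℓ) :
    ‖∑ n ∈ Ioc 0 X, ((highPart (μ : ArithmeticFunction ℝ) U * (ζ : ArithmeticFunction ℝ)
        * highPart Λ U) n : ℂ) * ex (n * α)‖ ^ 2
      ≤ 2 * ℓ ^ 8 * (3 * X ^ 2 / d + 5 * X ^ 2 / U + 2 * X * d) := by
  set B := highPart (μ : ArithmeticFunction ℝ) U * (ζ : ArithmeticFunction ℝ) with hB
  have hl1 : 1 ≤ ℓ := by linarith [log_natCast_nonneg d]
  set c : ℕ → ℂ := fun m => ∑ k ∈ Ioc U (X / U) with k * m ≤ X, (Λ k : ℂ) * ex (k * (α * m)) with hc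
  have hcc : ∀ m, U < m → ∑ k ∈ Ioc 0 (X / m), (highPart Λ U k : ℂ) * ex ((m * k : ℕ) * α) = c m := by
    intro m hm
    have hm0 : 0 < m := by omega
    have e : ∀ k, (highPart Λ U k : ℂ) * ex ((m * k : ℕ) * α)
        = if U < k then (Λ k : ℂ) * ex (k * (α * m)) else 0 := by
      intro k
      rw [highPart_apply]
      split_ifs
      · congr 2; push_cast; ring
      · simp
    simp_rw [e]
    rw [← sum_filter, hc]
    refine sum_congr ?_ fun _ _ => rfl
    ext k
    simp only [mem_filter, mem_Ioc]
    rw [Nat.le_div_iff_mul_le hm0, Nat.le_div_iff_mul_le hU]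
    constructor
    · rintro ⟨⟨_, h1⟩, h2⟩
      exact ⟨⟨h2, (Nat.mul_le_mul_left k hm.le).trans h1⟩, h1⟩
    · rintro ⟨⟨h1, _⟩, h2⟩
      exact ⟨⟨by omega, h2⟩, h1⟩
  rw [sum_Ioc_mul_twist B (highPart Λ U) (fun n => ex (n * α)) X]
  have h1 : ‖∑ m ∈ Ioc 0 X, (B m : ℂ) * ∑ k ∈ Ioc 0 (X / m), (highPart Λ U k : ℂ) *
      ex ((m * k : ℕ) * α)‖ ≤ ∑ m ∈ Ioc U X, ((m.divisors.card : ℝ) / √m) * (√m * ‖c m‖) := by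
    have hsub : ∑ m ∈ Ioc 0 X, (B m : ℂ) * ∑ k ∈ Ioc 0 (X / m), (highPart Λ U k : ℂ) *
      ex ((m * k : ℕ) * α) = ∑ m ∈ Ioc U X, (B m : ℂ) * c m := by
      symm
      refine sum_subset_zero_on_sdiff ?_ ?_ ?_
      · intro m hm; rw [mem_Ioc] at hm ⊢; omega
      · intro m hm
        simp only [mem_sdiff, mem_Ioc] at hm
        rw [hB, highPart_mul_zeta_eq_zero _ (by omega)]
        simp
      · intro m hm
        rw [hcc m (mem_Ioc.1 hm).1]
    rw [hsub]
    refine (norm_sum_le _ _).trans (sum_le_sum fun m hm => ?_)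
    have hm0 : (0 : ℝ) < √m := by
      rw [Real.sqrt_pos]; exact_mod_cast (by have := (mem_Ioc.1 hm).1; omega : 0 < m)
    rw [norm_mul, Complex.norm_real, Real.norm_eq_abs, ← mul_assoc, div_mul_cancel₀ _ hm0.ne']
    gcongr
    exact abs_highPart_moebius_mul_zeta_le U m
  have h2 := sum_mul_sq_le_sq_mul_sq (Ioc U X) (fun m : ℕ => (m.divisors.card : ℝ) / √m)
    (fun m : ℕ => √m * ‖c m‖)
  have h3 : ∑ m ∈ Ioc U X, ((m.divisors.card : ℝ) / √m) ^ 2 ≤ ℓ ^ 4 := by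
    have e : ∀ m : ℕ, ((m.divisors.card : ℝ) / √m) ^ 2 = (m.divisors.card : ℝ) ^ 2 / m := by
      intro m; rw [div_pow, Real.sq_sqrt (Nat.cast_nonneg _)]
    simp_rw [e]
    refine le_trans ?_ ((sum_card_divisors_sq_div_le X).trans ?_)
    · refine sum_le_sum_of_subset_of_nonneg ?_ fun _ _ _ => by positivity
      intro m hm; rw [mem_Ioc] at hm ⊢; omega
    · have := log_natCast_nonneg X
      gcongr
  have h4 : ∑ m ∈ Ioc U X, (√m * ‖c m‖) ^ 2
      ≤ ℓ ^ 2 * (2 * (ℓ ^ 2 * (3 * X ^ 2 / d + 5 * X ^ 2 / U + 2 * X * d))) := by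
    simp_rw [mul_pow, Real.sq_sqrt (Nat.cast_nonneg _)]
    refine (sum_mul_norm_sq_le (fun k => Λ k) U X (X / U) α ℓ
      (fun _ => ArithmeticFunction.vonMangoldt_nonneg) (fun k hk => ?_)
      (Nat.div_le_self X U)).trans ?_
    · linarith [vonMangoldt_le_of_le hk]
    · gcongr
      exact sum_bilinear_le hd ha hα hU hdl hXl
  calc _ ≤ (∑ m ∈ Ioc U X, ((m.divisors.card : ℝ) / √m) * (√m * ‖c m‖)) ^ 2 := by gcongr
    _ ≤ _ := h2
    _ ≤ ℓ ^ 4 * (ℓ ^ 2 * (2 * (ℓ ^ 2 * (3 * X ^ 2 / d + 5 * X ^ 2 / U + 2 * X * d)))) := by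
        gcongr
    _ = _ := by ring

lemma lowPart_mul_lowPart_eq_zero (f h : ArithmeticFunction ℝ) {U m : ℕ} (hm : U * U < m) :
    (lowPart f U * lowPart h U) m = 0 := by
  rw [ArithmeticFunction.mul_apply]
  refine sum_eq_zero fun p hp => ?_
  have h1 := (Nat.mem_divisorsAntidiagonal.1 hp).1
  rw [lowPart_apply, lowPart_apply]
  rcases le_or_gt p.1 U with h | h
  · rcases le_or_gt p.2 U with h' | h'
    · have := Nat.mul_le_mul h h'; omega
    · rw [if_neg h'.not_ge, mul_zero]
  · rw [if_neg h.not_ge, zero_mul]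

lemma abs_lowPart_moebius_le (U m : ℕ) : |lowPart (μ : ArithmeticFunction ℝ) U m| ≤ 1 := by
  rw [lowPart_apply]
  split_ifs
  · rw [ArithmeticFunction.intCoe_apply]
    exact_mod_cast ArithmeticFunction.abs_moebius_le_one (n := m)
  · simp

lemma abs_lowPart_mul_lowPart_le (U m : ℕ) :
    |(lowPart (μ : ArithmeticFunction ℝ) U * lowPart Λ U) m| ≤ log m := by
  rw [ArithmeticFunction.mul_apply, ← ArithmeticFunction.vonMangoldt_sum]
  refine (abs_sum_le_sum_abs _ _).trans ?_
  rw [Nat.sum_divisorsAntidiagonal' (f := fun i j =>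
    |lowPart (μ : ArithmeticFunction ℝ) U i * lowPart Λ U j|)]
  refine sum_le_sum fun i _ => ?_
  rw [abs_mul]
  have h2 : |lowPart Λ U i| ≤ Λ i := by
    rw [lowPart_apply]
    split_ifs
    · rw [abs_of_nonneg ArithmeticFunction.vonMangoldt_nonneg]
    · simp
  calc _ ≤ 1 * Λ i := mul_le_mul (abs_lowPart_moebius_le _ _) h2 (abs_nonneg _) zero_le_one
    _ = _ := one_mul _

lemma norm_sum_vonMangoldt_le {d : ℕ} (hd : 0 < d) {a : ℤ} (ha : IsCoprime a (d : ℤ)) {α : ℝ}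
    (hα : |α - a / d| ≤ 1 / d ^ 2) {U X : ℕ} (hU : 0 < U) {ℓ : ℝ} (hdl : 1 + log d ≤ ℓ)
    (hXl : 1 + log X ≤ ℓ) (hUl : 1 + log ((U * U : ℕ) : ℝ) ≤ ℓ) :
    ‖∑ n ∈ Ioc 0 X, (Λ n : ℂ) * ex (n * α)‖
      ≤ U * ℓ + 2 * ℓ ^ 2 * (9 * X / d + 10 * d + 2 * (U * U : ℕ))
        + √(2 * ℓ ^ 8 * (3 * X ^ 2 / d + 5 * X ^ 2 / U + 2 * X * d)) := by
  have hl1 : 1 ≤ ℓ := by linarith [log_natCast_nonneg d]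
  have hC := sum_cut_div_le hd ha hα (U * U) (X := X) (Nat.cast_nonneg _) hdl hUl
  set C := ∑ m ∈ Ioc 0 (U * U), cut (X / m) (α * m) with hCdef
  have hC0 : 0 ≤ C := sum_nonneg fun _ _ => cut_nonneg (by positivity) _
  have hUU : U ≤ U * U := Nat.le_mul_self U
  have logmono : Monotone fun n : ℕ => log (n : ℝ) := by
    intro m n h
    rcases Nat.eq_zero_or_pos m with rfl | hm
    · simpa using log_natCast_nonneg n
    · exact log_le_log (by exact_mod_cast hm) (by exact_mod_cast h)
  have hI1 : ‖∑ n ∈ Ioc 0 X, ((lowPart (μ : ArithmeticFunction ℝ) U * ArithmeticFunction.log) n : ℂ)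
      * ex (n * α)‖ ≤ 1 * ℓ * C := by
    refine norm_sum_typeI_le zero_le_one (abs_lowPart_moebius_le U) (fun m hm => ?_) logmono
      (by simp) (by linarith) (fun k _ => rfl) α
    rw [lowPart_apply, if_neg (by omega)]
  have hI2 : ‖∑ n ∈ Ioc 0 X, ((lowPart (μ : ArithmeticFunction ℝ) U * lowPart Λ U *
      (ζ : ArithmeticFunction ℝ)) n : ℂ) * ex (n * α)‖ ≤ ℓ * 1 * C := by
    refine norm_sum_typeI_le (by linarith) (fun m => ?_)
      (fun m hm => lowPart_mul_lowPart_eq_zero _ _ hm) (w := fun _ => 1) monotone_const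
      zero_le_one le_rfl (fun k hk => ?_) α
    · rcases le_or_gt m (U * U) with h | h
      · have := abs_lowPart_mul_lowPart_le U m
        have := logmono h
        simp only at this
        linarith
      · rw [lowPart_mul_lowPart_eq_zero _ _ h]; simp; linarith
    · rw [ArithmeticFunction.natCoe_apply, ArithmeticFunction.zeta_apply, if_neg hk.ne']
      simp
  have hII := norm_sum_typeII_le hd ha hα hU hdl hXl
  have hII' := Real.abs_le_sqrt hII
  rw [abs_of_nonneg (norm_nonneg _)] at hII'
  have h0 : ‖∑ n ∈ Ioc 0 X, (lowPart Λ U n : ℂ) * ex (n * α)‖ ≤ U * ℓ := by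
    refine (norm_sum_le _ _).trans ?_
    calc _ ≤ ∑ n ∈ Ioc 0 X, if n ≤ U then ℓ else 0 := by
          refine sum_le_sum fun n hn => ?_
          rw [norm_mul, norm_ex, mul_one, Complex.norm_real, lowPart_apply]
          split_ifs
          · rw [Real.norm_of_nonneg ArithmeticFunction.vonMangoldt_nonneg]
            linarith [vonMangoldt_le_of_le (mem_Ioc.1 hn).2]
          · simp
      _ ≤ ∑ n ∈ Ioc 0 U, ℓ := by
          rw [← sum_filter]
          refine sum_le_sum_of_subset_of_nonneg (fun n hn => ?_) fun _ _ _ => by linarith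
          simp only [mem_filter, mem_Ioc] at hn ⊢
          omega
      _ = _ := by simp
  have e : ∑ n ∈ Ioc 0 X, (Λ n : ℂ) * ex (n * α)
      = ∑ n ∈ Ioc 0 X, (lowPart Λ U n : ℂ) * ex (n * α)
      + ∑ n ∈ Ioc 0 X, ((lowPart (μ : ArithmeticFunction ℝ) U * ArithmeticFunction.log) n : ℂ)
        * ex (n * α)
      - ∑ n ∈ Ioc 0 X, ((lowPart (μ : ArithmeticFunction ℝ) U * lowPart Λ U *
        (ζ : ArithmeticFunction ℝ)) n : ℂ) * ex (n * α)
      + ∑ n ∈ Ioc 0 X, ((highPart (μ : ArithmeticFunction ℝ) U * (ζ : ArithmeticFunction ℝ)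
        * highPart Λ U) n : ℂ) * ex (n * α) := by
    rw [← sum_add_distrib, ← sum_sub_distrib, ← sum_add_distrib]
    refine sum_congr rfl fun n _ => ?_
    have hv : (Λ : ArithmeticFunction ℝ)
        + lowPart (μ : ArithmeticFunction ℝ) U * lowPart Λ U * (ζ : ArithmeticFunction ℝ)
        = lowPart Λ U + lowPart (μ : ArithmeticFunction ℝ) U * ArithmeticFunction.log
        + highPart (μ : ArithmeticFunction ℝ) U * (ζ : ArithmeticFunction ℝ) * highPart Λ U := by
      linear_combination vaughan U
    have h := congrArg (fun f : ArithmeticFunction ℝ => ((f n : ℝ) : ℂ)) hv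
    simp only [ArithmeticFunction.add_apply] at h
    push_cast at h
    linear_combination ex (n * α) * h
  rw [e]
  refine (norm_add_le _ _).trans (add_le_add ((norm_sub_le _ _).trans ?_) hII')
  refine (add_le_add (norm_add_le _ _) le_rfl).trans ?_
  have : ℓ * C ≤ ℓ * (ℓ * (9 * X / d + 10 * d + 2 * (U * U : ℕ))) := by gcongr
  nlinarith

/-- The exponential sum over primes, weighted by the von Mangoldt function. -/
noncomputable def primeSum (X : ℕ) (α : ℝ) : ℂ := ∑ n ∈ range X, (Λ n : ℂ) * ex (n * α)

lemma primeSum_succ_eq (X : ℕ) (α : ℝ) :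
    primeSum (X + 1) α = ∑ n ∈ Ioc 0 X, (Λ n : ℂ) * ex (n * α) := by
  unfold primeSum
  rw [range_eq_Ico, ← add_sum_Ioo_eq_sum_Ico (by omega)]
  simp only [ArithmeticFunction.map_zero, Complex.ofReal_zero, zero_mul, zero_add]
  refine sum_congr ?_ fun _ _ => rfl
  ext n; simp only [mem_Ioo, mem_Ioc]; omega

lemma norm_primeSum_le_trivial (X : ℕ) (α : ℝ) : ‖primeSum X α‖ ≤ X * log X := by
  unfold primeSum
  refine (norm_sum_le _ _).trans ?_
  calc _ ≤ ∑ n ∈ range X, log X := by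
        refine sum_le_sum fun n hn => ?_
        rw [norm_mul, norm_ex, mul_one, Complex.norm_real,
          Real.norm_of_nonneg ArithmeticFunction.vonMangoldt_nonneg]
        exact vonMangoldt_le_of_le (mem_range.1 hn).le
    _ = _ := by simp

lemma norm_primeSum_le_or {c₀ X Y K : ℕ} (hc : 1 ≤ c₀) (hY : 1 ≤ Y) (hX : X ≤ c₀ * Y) (hK : 1 ≤ K)
    (hKY : K ^ 5 ≤ Y ^ 2) (α : ℝ) :
    ‖primeSum X α‖ ≤ 48 * c₀ * (1 + log (c₀ * Y)) ^ 4 * Y / √K ∨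
    ∃ d : ℕ, 1 ≤ d ∧ d ≤ K ∧ ∃ a : ℤ, |d * α - a| ≤ K / Y := by
  have hY' : (1 : ℝ) ≤ Y := by exact_mod_cast hY
  have hK' : (1 : ℝ) ≤ K := by exact_mod_cast hK
  have hc' : (1 : ℝ) ≤ c₀ := by exact_mod_cast hc
  have hK2 : K ^ 2 ≤ Y := by
    have : (K ^ 2) ^ 2 ≤ Y ^ 2 := by
      rw [← pow_mul]; exact (Nat.pow_le_pow_right hK (by norm_num)).trans hKY
    exact (Nat.pow_le_pow_iff_left (by norm_num)).1 this
  have hKY1 : K ≤ Y := (Nat.le_self_pow (by norm_num) K).trans hK2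
  have hn : 0 < Y / K := Nat.div_pos hKY1 hK
  obtain ⟨q, hq1, hq2⟩ := Real.exists_rat_abs_sub_le_and_den_le α hn
  have hd : 0 < q.den := q.den_pos
  have hd' : (0 : ℝ) < q.den := by exact_mod_cast hd
  have hYK : (Y : ℝ) / K < ((Y / K : ℕ) : ℝ) + 1 := by
    rw [div_lt_iff₀ (by linarith)]
    have : Y < (Y / K + 1) * K := by
      have h1 := Nat.div_add_mod Y K
      have h2 := Nat.mod_lt Y hK
      nlinarith
    exact_mod_cast this
  have hdYK : (q.den : ℝ) ≤ Y / K := (by exact_mod_cast hq2 : (q.den : ℝ) ≤ (Y / K : ℕ)).trans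
    Nat.cast_div_le
  have hqe : (q : ℝ) = q.num / q.den := by exact_mod_cast (Rat.num_div_den q).symm
  rw [hqe] at hq1
  rcases le_or_gt q.den K with hdK | hdK
  · right
    refine ⟨q.den, hd, hdK, q.num, ?_⟩
    have e : q.den * α - q.num = q.den * (α - q.num / q.den) := by field_simp
    rw [e, abs_mul, Nat.abs_cast]
    calc _ ≤ (q.den : ℝ) * (1 / ((((Y / K : ℕ) : ℝ) + 1) * q.den)) := by gcongr
      _ = 1 / (((Y / K : ℕ) : ℝ) + 1) := by field_simp
      _ ≤ 1 / (Y / K) := by gcongr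
      _ = _ := by field_simp
  · left
    have hdK' : (K : ℝ) ≤ q.den := by exact_mod_cast hdK.le
    have hα : |α - q.num / q.den| ≤ 1 / (q.den : ℝ) ^ 2 := by
      refine hq1.trans ?_
      rw [sq]
      gcongr
      linarith
    have hcop : IsCoprime q.num (q.den : ℤ) := by
      rw [Int.isCoprime_iff_gcd_eq_one]; exact q.reduced
    set ℓ := 1 + log (c₀ * Y) with hℓ
    have hcY : (1 : ℝ) ≤ c₀ * Y := by nlinarith
    have hl1 : 1 ≤ ℓ := by have := log_nonneg hcY; linarith
    have logle : ∀ n : ℕ, (n : ℝ) ≤ c₀ * Y → 1 + log n ≤ ℓ := by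
      intro n h
      rcases Nat.eq_zero_or_pos n with rfl | h0
      · simpa using hl1
      · have := log_le_log (by exact_mod_cast h0) h
        linarith
    have hYc : (Y : ℝ) ≤ c₀ * Y := by nlinarith
    set k := √K with hk
    have hk2 : k ^ 2 = K := Real.sq_sqrt (by linarith)
    have hk1 : 1 ≤ k := Real.one_le_sqrt.2 hK'
    have hk5 : k ^ 5 ≤ Y := by
      have h : (K : ℝ) ^ 5 ≤ (Y : ℝ) ^ 2 := by exact_mod_cast hKY
      rw [← hk2, ← pow_mul, show 2 * 5 = 5 * 2 by norm_num, pow_mul] at h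
      exact (pow_le_pow_iff_left₀ (by positivity) (by linarith) (by norm_num)).1 h
    have hR : 0 ≤ (Y : ℝ) / k := by positivity
    rcases X with _ | X
    · simp only [primeSum, range_zero, sum_empty, norm_zero]
      positivity
    rw [primeSum_succ_eq]
    have hX' : (X : ℝ) ≤ c₀ * Y := by exact_mod_cast (Nat.le_succ X).trans hX
    have hmain := norm_sum_vonMangoldt_le hd hcop hα (U := K) (X := X) hK (ℓ := ℓ)
      (logle _ (hdYK.trans ((div_le_self (by linarith) hK').trans hYc)))
      (logle _ hX') (logle _ (by
        refine le_trans ?_ hYc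
        rw [← sq]; exact_mod_cast hK2))
    refine hmain.trans ?_
    have hk_le : ∀ j, j ≤ 4 → k ^ j ≤ Y / k := by
      intro j hj
      rw [le_div_iff₀ (by linarith), ← pow_succ]
      exact (pow_le_pow_right₀ hk1 (by omega)).trans hk5
    have hYK' : (Y : ℝ) / K ≤ Y / k := by
      rw [← hk2]
      gcongr
      nlinarith
    have t1 : K * ℓ ≤ Y / k * ℓ ^ 4 := by
      have := hk_le 2 (by norm_num)
      rw [hk2] at this
      have h4 : ℓ ≤ ℓ ^ 4 := le_self_pow₀ hl1 (by norm_num)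
      gcongr
    have t2 : 9 * X / q.den + 10 * q.den + 2 * (K * K : ℕ) ≤ Y / k * (9 * c₀ + 12) := by
      have h1 : (X : ℝ) / q.den ≤ c₀ * (Y / k) := by
        calc (X : ℝ) / q.den ≤ (c₀ * Y) / K := by gcongr
          _ = c₀ * (Y / K) := by ring
          _ ≤ _ := by gcongr
      have h2 : ((K * K : ℕ) : ℝ) ≤ Y / k := by
        have := hk_le 4 (by norm_num)
        push_cast
        rw [← hk2]
        linarith
      rw [mul_div_assoc]
      linarith
    have t3 : √(2 * ℓ ^ 8 * (3 * X ^ 2 / q.den + 5 * X ^ 2 / K + 2 * X * q.den))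
        ≤ 5 * c₀ * ℓ ^ 4 * (Y / k) := by
      rw [Real.sqrt_le_left (by positivity)]
      have h1 : 3 * (X : ℝ) ^ 2 / q.den + 5 * (X : ℝ) ^ 2 / K + 2 * (X : ℝ) * q.den
          ≤ 3 * ((c₀ : ℝ) * Y) ^ 2 / K + 5 * ((c₀ : ℝ) * Y) ^ 2 / K + 2 * ((c₀ : ℝ) * Y) * (Y / K) := by
        gcongr
      have h2 : 2 * ((c₀ : ℝ) * Y) * (Y / K) ≤ 2 * (c₀ * Y) * (c₀ * Y / K) := by gcongr
      have h3 : (Y / k) ^ 2 = (Y : ℝ) ^ 2 / K := by rw [div_pow, hk2]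
      calc _ ≤ 2 * ℓ ^ 8 * (3 * (c₀ * Y) ^ 2 / K + 5 * (c₀ * Y) ^ 2 / K
            + 2 * (c₀ * Y) * (c₀ * Y / K)) :=
            mul_le_mul_of_nonneg_left (h1.trans (add_le_add le_rfl h2)) (by positivity)
        _ = 20 * (c₀ ^ 2 * ℓ ^ 8 * (Y / k) ^ 2) := by rw [h3]; ring
        _ ≤ 25 * (c₀ ^ 2 * ℓ ^ 8 * (Y / k) ^ 2) := by gcongr; norm_num
        _ = _ := by ring
    have t2' : 2 * ℓ ^ 2 * (9 * X / q.den + 10 * q.den + 2 * (K * K : ℕ))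
        ≤ 2 * ℓ ^ 4 * (Y / k * (9 * c₀ + 12)) := by
      have : ℓ ^ 2 ≤ ℓ ^ 4 := pow_le_pow_right₀ hl1 (by norm_num)
      gcongr
    have hz : 0 ≤ ℓ ^ 4 * (Y / k) := by positivity
    calc _ ≤ Y / k * ℓ ^ 4 + 2 * ℓ ^ 4 * (Y / k * (9 * c₀ + 12)) + 5 * c₀ * ℓ ^ 4 * (Y / k) := by
          gcongr
      _ = (25 + 23 * c₀) * (ℓ ^ 4 * (Y / k)) := by ring
      _ ≤ (48 * c₀) * (ℓ ^ 4 * (Y / k)) := by gcongr; linarith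
      _ = _ := by ring

lemma sum_biUnion_le {α β : Type*} [DecidableEq α] [DecidableEq β] (t : Finset β) (S : β → Finset α)
    {f : α → ℝ} (hf : ∀ a, 0 ≤ f a) : ∑ a ∈ t.biUnion S, f a ≤ ∑ u ∈ t, ∑ a ∈ S u, f a := by
  induction t using Finset.induction_on with
  | empty => simp
  | insert u t hu ih =>
    rw [biUnion_insert, sum_insert hu]
    have := sum_union_inter (s₁ := S u) (s₂ := t.biUnion S) (f := f)
    have := sum_nonneg fun a (_ : a ∈ S u ∩ t.biUnion S) => hf a
    linarith

/-- The residues `r` modulo `g ^ L` for which `r / g ^ L` is within `g ^ s / (d g ^ L)` of a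
fraction with some denominator `d ≤ g ^ s`. -/
noncomputable def nearRat (g L s : ℕ) : Finset ℕ := by
  classical
  exact {r ∈ range (g ^ L) | ∃ d : ℕ, 1 ≤ d ∧ d ≤ g ^ s ∧
    ∃ a : ℤ, |d * (r / (g : ℝ) ^ L) - a| ≤ (g : ℝ) ^ s / (g : ℝ) ^ L}

lemma mem_nearRat {g L s r : ℕ} : r ∈ nearRat g L s ↔ r < g ^ L ∧ ∃ d : ℕ, 1 ≤ d ∧ d ≤ g ^ s ∧
    ∃ a : ℤ, |d * (r / (g : ℝ) ^ L) - a| ≤ (g : ℝ) ^ s / (g : ℝ) ^ L := by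
  simp [nearRat]

lemma abs_sub_lt_of_div_eq {r r' n : ℕ} (hn : 0 < n) (h : r / n = r' / n) :
    |(r : ℝ) - r'| < n := by
  have h1 := Nat.div_add_mod r n
  have h2 := Nat.div_add_mod r' n
  have h3 := Nat.mod_lt r hn
  have h4 := Nat.mod_lt r' hn
  rw [h] at h1
  have h5 : r < r' + n := by omega
  have h6 : r' < r + n := by omega
  rw [abs_lt]
  constructor
  · have : (r' : ℝ) < r + n := by exact_mod_cast h6
    linarith
  · have : (r : ℝ) < r' + n := by exact_mod_cast h5
    linarith

lemma eq_of_modEq_of_abs_sub_lt {r r' n : ℕ} (h : r % n = r' % n) (h' : |(r : ℝ) - r'| < n) :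
    r = r' := by
  have h1 : |(r : ℤ) - r'| < n := by exact_mod_cast h'
  have h2 : (n : ℤ) ∣ r - r' := (Nat.modEq_iff_dvd (n := n)).1 (show r' ≡ r [MOD n] from h.symm)
  have := Int.eq_zero_of_abs_lt_dvd h2 h1
  omega

lemma injOn_div_mod {g L s u : ℕ} (hg : 3 ≤ g) (hL : s + u + 4 ≤ L) (hus : u ≤ s) :
    Set.InjOn (fun r => (r / g ^ (L - (2 * u + 3)), r % g ^ (s - u + 1)))
      {r : ℕ | ∃ d : ℕ, g ^ u ≤ d ∧ d < g ^ (u + 1) ∧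
        ∃ a : ℤ, |d * (r / (g : ℝ) ^ L) - a| ≤ (g : ℝ) ^ s / (g : ℝ) ^ L} := by
  rintro r ⟨d, hd1, hd2, a, ha⟩ r' ⟨d', hd1', hd2', a', ha'⟩ h
  simp only [Prod.mk.injEq] at h
  obtain ⟨h1, h2⟩ := h
  have hg' : (3 : ℝ) ≤ g := by exact_mod_cast hg
  have hg0 : (0 : ℝ) < g := by linarith
  have hY : (0 : ℝ) < (g : ℝ) ^ L := by positivity
  have hu : 0 < g ^ u := by positivity
  have e1 : (g : ℝ) ^ u ≤ d := by exact_mod_cast hd1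
  have e1' : (g : ℝ) ^ u ≤ d' := by exact_mod_cast hd1'
  have e2 : (d : ℝ) ≤ g ^ (u + 1) := by exact_mod_cast hd2.le
  have e2' : (d' : ℝ) ≤ g ^ (u + 1) := by exact_mod_cast hd2'.le
  have hd0 : (0 : ℝ) < d := lt_of_lt_of_le (by positivity) e1
  have hd0' : (0 : ℝ) < d' := lt_of_lt_of_le (by positivity) e1'
  have h3 := abs_sub_lt_of_div_eq (by positivity) h1
  push_cast at h3
  set Y := (g : ℝ) ^ L with hYd
  have h4 : |(r : ℝ) / Y - r' / Y| < 1 / g ^ (2 * u + 3) := by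
    rw [← sub_div, abs_div, abs_of_pos hY, div_lt_div_iff₀ hY (by positivity), one_mul, hYd]
    calc _ < (g : ℝ) ^ (L - (2 * u + 3)) * g ^ (2 * u + 3) := by gcongr
      _ = _ := by rw [← pow_add]; congr 1; omega
  have key : (a : ℤ) * d' = a' * d := by
    have hb : |((a * d' - a' * d : ℤ) : ℝ)| < 1 := by
      have e : ((a * d' - a' * d : ℤ) : ℝ) = (d * d') * (r / Y - r' / Y)
          - (d' * (d * (r / Y) - a) - d * (d' * (r' / Y) - a')) := by push_cast; ring
      have b1 : (d * d') * |(r : ℝ) / Y - r' / Y| ≤ 1 / g := by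
        calc _ ≤ ((g : ℝ) ^ (u + 1) * g ^ (u + 1)) * (1 / g ^ (2 * u + 3)) := by gcongr
          _ = 1 / g := by
            field_simp
            ring
      have b2 : ∀ d₁ : ℝ, 0 ≤ d₁ → d₁ ≤ g ^ (u + 1) → ∀ x : ℝ, x ≤ g ^ s / Y → 0 ≤ x →
          d₁ * x ≤ 1 / 27 := by
        intro d₁ h0 h1 x h2 h3
        calc _ ≤ (g : ℝ) ^ (u + 1) * (g ^ s / Y) := by gcongr
          _ = (g : ℝ) ^ (s + u + 1) / Y := by rw [← mul_div_assoc, ← pow_add]; congr 2; omega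
          _ ≤ 1 / 27 := by
            rw [div_le_div_iff₀ hY (by norm_num), one_mul]
            calc (g : ℝ) ^ (s + u + 1) * 27 = g ^ (s + u + 1) * 3 ^ 3 := by norm_num
              _ ≤ (g : ℝ) ^ (s + u + 1) * g ^ 3 := by gcongr
              _ = (g : ℝ) ^ (s + u + 4) := by rw [← pow_add]
              _ ≤ Y := pow_le_pow_right₀ (by linarith) hL
      have b3 : (1 : ℝ) / g ≤ 1 / 3 := by gcongr
      rw [e]
      have c1 := b2 d' hd0'.le e2' _ ha (abs_nonneg _)
      have c2 := b2 d hd0.le e2 _ ha' (abs_nonneg _)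
      calc _ ≤ |(d * d') * ((r : ℝ) / Y - r' / Y)| + |d' * (d * (r / Y) - a) - d * (d' * (r' / Y) - a')| :=
            abs_sub _ _
        _ ≤ (d * d') * |(r : ℝ) / Y - r' / Y| + (d' * |d * (r / Y) - a| + d * |d' * (r' / Y) - a'|) := by
          gcongr
          · rw [abs_mul, abs_of_pos (mul_pos hd0 hd0')]
          · refine (abs_sub _ _).trans (le_of_eq ?_)
            rw [abs_mul, abs_mul, abs_of_pos hd0, abs_of_pos hd0']
        _ < 1 := by linarith
    have : |a * d' - a' * d| < 1 := by exact_mod_cast hb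
    have := Int.abs_lt_one_iff.1 this
    linarith
  refine eq_of_modEq_of_abs_sub_lt h2 ?_
  have key' : (a : ℝ) / d = a' / d' := by
    rw [div_eq_div_iff hd0.ne' hd0'.ne']; exact_mod_cast key
  have dist : ∀ (x d₁ b : ℝ), (g : ℝ) ^ u ≤ d₁ → 0 < d₁ → |d₁ * (x / Y) - b| ≤ g ^ s / Y →
      |x - b / d₁ * Y| ≤ g ^ (s - u) := by
    intro x d₁ b h1 h2 h3
    have e : x - b / d₁ * Y = (Y / d₁) * (d₁ * (x / Y) - b) := by field_simp
    rw [e, abs_mul, abs_of_pos (by positivity)]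
    calc _ ≤ Y / d₁ * (g ^ s / Y) := by gcongr
      _ = (g : ℝ) ^ s / d₁ := by field_simp
      _ ≤ (g : ℝ) ^ s / g ^ u := by gcongr
      _ = _ := by rw [div_eq_iff (by positivity), ← pow_add]; congr 1; omega
  have d1 := dist r d a e1 hd0 ha
  have d2 := dist r' d' a' e1' hd0' ha'
  rw [← key'] at d2
  have d3 : |(r : ℝ) - r'| ≤ g ^ (s - u) + g ^ (s - u) := by
    have : (r : ℝ) - r' = (r - a / d * Y) - (r' - a / d * Y) := by ring
    rw [this]
    exact (abs_sub _ _).trans (add_le_add d1 d2)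
  refine lt_of_le_of_lt d3 ?_
  push_cast
  rw [pow_succ]
  have : (0 : ℝ) < g ^ (s - u) := by positivity
  nlinarith

lemma sum_nearRat_le {g L s : ℕ} (hg : 3 ≤ g) (hL : 2 * s + 4 ≤ L) (ω : ℕ → ℝ) :
    ∑ r ∈ nearRat g L s, digitCoeff g L ω r ≤ (s + 1) * (3 + (2 + 2 * log g) / π) ^ (2 * s + 4) ∧
    (#(nearRat g L s) : ℝ) ≤ (s + 1) * (g : ℝ) ^ (2 * s + 4) := by
  classical
  have hlog : 0 ≤ log g := log_nonneg (by exact_mod_cast (by omega : 1 ≤ g))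
  set B₁ := (4 + 2 * log g) / π with hB1
  set B₂ := 3 + (2 + 2 * log g) / π with hB2
  have hB0 : 0 ≤ B₁ := by positivity
  have hB1' : (1 : ℝ) ≤ B₂ := by
    have : 0 ≤ (2 + 2 * log g) / π := by positivity
    linarith
  have hB12 : B₁ ≤ B₂ := by
    have e : B₁ = 2 / π + (2 + 2 * log g) / π := by rw [hB1]; ring
    have : 2 / π ≤ 3 := by
      rw [div_le_iff₀ pi_pos]; linarith [pi_gt_three]
    linarith
  set S : ℕ → Finset ℕ := fun u => {r ∈ range (g ^ L) | ∃ d : ℕ, g ^ u ≤ d ∧ d < g ^ (u + 1) ∧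
        ∃ a : ℤ, |d * (r / (g : ℝ) ^ L) - a| ≤ (g : ℝ) ^ s / (g : ℝ) ^ L} with hS
  have hsub : nearRat g L s ⊆ (range (s + 1)).biUnion S := by
    intro r hr
    obtain ⟨hr, d, hd1, hd2, a, ha⟩ := mem_nearRat.1 hr
    simp only [mem_biUnion, mem_range, hS, mem_filter]
    refine ⟨Nat.log g d, ?_, hr, d, Nat.pow_log_le_self g (by omega),
      Nat.lt_pow_succ_log_self (by omega) d, a, ha⟩
    have : g ^ Nat.log g d ≤ g ^ s := (Nat.pow_log_le_self g (by omega)).trans hd2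
    have := (Nat.pow_le_pow_iff_right (by omega : 1 < g)).1 this
    omega
  have hu : ∀ u ∈ range (s + 1), ∑ r ∈ S u, digitCoeff g L ω r ≤ B₂ ^ (2 * s + 4) ∧
      (#(S u) : ℝ) ≤ (g : ℝ) ^ (2 * s + 4) := by
    intro u hu
    rw [mem_range] at hu
    obtain ⟨h1, h2⟩ := sum_digitCoeff_subset_le (m := 2 * u + 3) (l := s - u + 1) hg (by omega) ω (S u)
      (fun r hr => mem_range.1 (mem_filter.1 hr).1)
      ((injOn_div_mod (s := s) (u := u) hg (by omega) (by omega)).mono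
        fun r hr => (mem_filter.1 (mem_coe.1 hr)).2)
    constructor
    · refine h1.trans ?_
      calc _ ≤ B₂ ^ (2 * u + 3) * B₂ ^ (s - u + 1) := by gcongr
        _ = B₂ ^ (2 * u + 3 + (s - u + 1)) := by rw [pow_add _ (2 * u + 3)]
        _ ≤ _ := pow_le_pow_right₀ hB1' (by omega)
    · rw [← pow_add] at h2
      exact_mod_cast h2.trans (Nat.pow_le_pow_right (by omega) (by omega))
  constructor
  · calc _ ≤ ∑ r ∈ (range (s + 1)).biUnion S, digitCoeff g L ω r :=
          sum_le_sum_of_subset_of_nonneg hsub fun _ _ _ => digitCoeff_nonneg ..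
      _ ≤ ∑ u ∈ range (s + 1), ∑ r ∈ S u, digitCoeff g L ω r := by
          exact sum_biUnion_le _ _ fun _ => digitCoeff_nonneg ..
      _ ≤ ∑ u ∈ range (s + 1), B₂ ^ (2 * s + 4) := sum_le_sum fun u h => (hu u h).1
      _ = _ := by simp
  · have : #(nearRat g L s) ≤ ∑ u ∈ range (s + 1), #(S u) := (card_le_card hsub).trans card_biUnion_le
    calc (#(nearRat g L s) : ℝ) ≤ ∑ u ∈ range (s + 1), (#(S u) : ℝ) := by exact_mod_cast this
      _ ≤ ∑ u ∈ range (s + 1), (g : ℝ) ^ (2 * s + 4) := sum_le_sum fun u h => (hu u h).2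
      _ = _ := by simp

/-- `f` is bounded by a decaying geometric sequence. -/
def GeomDecay (f : ℕ → ℝ) : Prop :=
  ∃ C lam : ℝ, 0 ≤ C ∧ 0 < lam ∧ lam < 1 ∧ ∀ L, f L ≤ C * lam ^ L

namespace GeomDecay

lemma mono {f h : ℕ → ℝ} (hh : GeomDecay h) (hfh : ∀ L, f L ≤ h L) : GeomDecay f := by
  obtain ⟨C, l, h1, h2, h3, h4⟩ := hh
  exact ⟨C, l, h1, h2, h3, fun L => (hfh L).trans (h4 L)⟩

lemma add {f h : ℕ → ℝ} (hf : GeomDecay f) (hh : GeomDecay h) :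
    GeomDecay (fun L => f L + h L) := by
  obtain ⟨C, l, h1, h2, h3, h4⟩ := hf
  obtain ⟨C', l', h1', h2', h3', h4'⟩ := hh
  refine ⟨C + C', max l l', by positivity, lt_max_of_lt_left h2, max_lt h3 h3', fun L => ?_⟩
  rw [add_mul]
  refine add_le_add ((h4 L).trans ?_) ((h4' L).trans ?_)
  · gcongr; exact le_max_left _ _
  · gcongr; exact le_max_right _ _

lemma sum {ι : Type*} (s : Finset ι) {f : ι → ℕ → ℝ} (hf : ∀ i ∈ s, GeomDecay (f i)) :
    GeomDecay (fun L => ∑ i ∈ s, f i L) := by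
  classical
  induction s using Finset.induction_on with
  | empty => exact ⟨0, 1 / 2, le_rfl, by norm_num, by norm_num, by simp⟩
  | insert i s hi ih =>
    simp only [sum_insert hi]
    exact (hf i (mem_insert_self _ _)).add (ih fun j hj => hf j (mem_insert_of_mem hj))

lemma const_mul {f : ℕ → ℝ} (hf : GeomDecay f) {c : ℝ} (hc : 0 ≤ c) :
    GeomDecay (fun L => c * f L) := by
  obtain ⟨C, l, h1, h2, h3, h4⟩ := hf
  refine ⟨c * C, l, by positivity, h2, h3, fun L => ?_⟩
  rw [mul_assoc]
  exact mul_le_mul_of_nonneg_left (h4 L) hc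

lemma of_eventually {f h : ℕ → ℝ} (hh : GeomDecay h) (L₀ : ℕ) (hfh : ∀ L ≥ L₀, f L ≤ h L) :
    GeomDecay f := by
  obtain ⟨C, l, h1, h2, h3, h4⟩ := hh
  have hnn : ∀ L, 0 ≤ |f L| / l ^ L := fun L => by positivity
  refine ⟨C + ∑ L ∈ range L₀, |f L| / l ^ L, l, add_nonneg h1 (sum_nonneg fun L _ => hnn L), h2, h3,
    fun L => ?_⟩
  rcases le_or_gt L₀ L with hL | hL
  · refine ((hfh L hL).trans (h4 L)).trans ?_
    gcongr
    have := sum_nonneg fun L (_ : L ∈ range L₀) => hnn L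
    linarith
  · have h5 := single_le_sum (fun L _ => hnn L) (mem_range.2 hL)
    have h6 : |f L| = |f L| / l ^ L * l ^ L := by field_simp
    calc f L ≤ |f L| := le_abs_self _
      _ = |f L| / l ^ L * l ^ L := h6
      _ ≤ _ := by gcongr; linarith

lemma pow_div {x : ℝ} (hx : 0 < x) (hx1 : x < 1) {N : ℕ} (hN : 0 < N) :
    GeomDecay (fun L => x ^ (L / N)) := by
  have hN' : (0 : ℝ) < N := by exact_mod_cast hN
  set l := x ^ ((1 : ℝ) / N) with hl
  have hl0 : 0 < l := rpow_pos_of_pos hx _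
  have hlN : l ^ N = x := by
    rw [hl, ← rpow_natCast, ← rpow_mul hx.le, one_div_mul_cancel hN'.ne', rpow_one]
  have hl1 : l < 1 := rpow_lt_one hx.le hx1 (by positivity)
  refine ⟨1 / l ^ N, l, by positivity, hl0, hl1, fun L => ?_⟩
  rw [div_mul_eq_mul_div, one_mul, le_div_iff₀ (by positivity)]
  calc x ^ (L / N) * l ^ N = l ^ (N * (L / N) + N) := by rw [pow_add, pow_mul, hlN]
    _ ≤ l ^ L := pow_le_pow_of_le_one hl0.le hl1.le (by
      have := Nat.div_add_mod L N
      have := Nat.mod_lt L hN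
      omega)

lemma mul_succ {f : ℕ → ℝ} (hf : GeomDecay f) : GeomDecay (fun L => ((L : ℝ) + 1) * f L) := by
  obtain ⟨C, l, h1, h2, h3, h4⟩ := hf
  set m := (1 + l) / 2 with hm
  have hm1 : m < 1 := by rw [hm]; linarith
  have hm2 : l < m := by rw [hm]; linarith
  have hm0 : 0 < m := by linarith
  set δ := m / l - 1 with hδ
  have hδ0 : 0 < δ := by
    have : 1 < m / l := by rw [lt_div_iff₀ h2]; linarith
    linarith
  refine ⟨(1 + 1 / δ) * C, m, by positivity, hm0, hm1, fun L => ?_⟩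
  have hb : 1 + L * δ ≤ (m / l) ^ L := by
    have := one_add_mul_le_pow (a := δ) (by linarith) L
    rwa [show 1 + δ = m / l by rw [hδ]; ring] at this
  have hb' : (L : ℝ) + 1 ≤ (1 + 1 / δ) * (m / l) ^ L := by
    have h0 : (0 : ℝ) ≤ L := Nat.cast_nonneg L
    calc (L : ℝ) + 1 ≤ (1 + 1 / δ) * (1 + L * δ) := by
          have : (1 + 1 / δ) * (1 + L * δ) = 1 + L + 1 / δ + L * δ := by field_simp; ring
          rw [this]
          have : 0 ≤ 1 / δ + L * δ := by positivity
          linarith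
      _ ≤ _ := by gcongr
  calc ((L : ℝ) + 1) * f L ≤ (L + 1) * (C * l ^ L) := by gcongr; exact h4 L
    _ ≤ (1 + 1 / δ) * (m / l) ^ L * (C * l ^ L) := by gcongr
    _ = _ := by rw [div_pow]; field_simp

lemma mul_pow {f : ℕ → ℝ} (hf : GeomDecay f) (k : ℕ) :
    GeomDecay (fun L => ((L : ℝ) + 1) ^ k * f L) := by
  induction k with
  | zero => simpa using hf
  | succ k ih =>
    refine ih.mul_succ.mono fun L => le_of_eq ?_
    ring

end GeomDecay

lemma digit_sum_pointwise {g L : ℕ} {A Y : ℝ} (hA : 0 ≤ A * Y) {W : ℕ → ℝ} {s₀ s₁ : ℕ}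
    (hs : s₀ ≤ s₁) (hT : ∀ r < g ^ L, W r ≤ A * Y)
    (hW : ∀ s ≤ s₁, ∀ r < g ^ L, r ∉ nearRat g L s → W r ≤ A * Y / √g ^ s) {r : ℕ}
    (hr : r < g ^ L) :
    W r ≤ A * Y * (1 / √g ^ s₁ + ∑ s ∈ Ico s₀ s₁, (if r ∈ nearRat g L (s + 1) then 1 / √g ^ s else 0)
      + (if r ∈ nearRat g L s₀ then 1 else 0)) := by
  have hnn : ∀ t, 0 ≤ ∑ s ∈ Ico s₀ t, (if r ∈ nearRat g L (s + 1) then 1 / √g ^ s else 0) := by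
    intro t
    refine sum_nonneg fun s _ => ?_
    split_ifs <;> positivity
  have h0 : (0 : ℝ) ≤ (if r ∈ nearRat g L s₀ then 1 else 0) := by split_ifs <;> norm_num
  have out : ∀ s ≤ s₁, s₀ ≤ s → r ∉ nearRat g L s → W r ≤ A * Y * (1 / √g ^ s +
      ∑ s ∈ Ico s₀ s, (if r ∈ nearRat g L (s + 1) then 1 / √g ^ s else 0)
      + (if r ∈ nearRat g L s₀ then 1 else 0)) := by
    intro s h1 h2 h3
    refine (hW s h1 r hr h3).trans ?_
    rw [← mul_one_div]
    refine mul_le_mul_of_nonneg_left ?_ hA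
    have := hnn s
    linarith
  suffices ∀ t, s₀ ≤ t → t ≤ s₁ → W r ≤ A * Y * (1 / √g ^ t +
      ∑ s ∈ Ico s₀ t, (if r ∈ nearRat g L (s + 1) then 1 / √g ^ s else 0)
      + (if r ∈ nearRat g L s₀ then 1 else 0)) from this s₁ hs le_rfl
  intro t ht
  induction t, ht using Nat.le_induction with
  | base =>
    intro _
    by_cases h : r ∈ nearRat g L s₀
    · refine (hT r hr).trans (le_mul_of_one_le_right hA ?_)
      have : 0 ≤ 1 / √g ^ s₀ := by positivity
      simp only [h, if_true, Ico_self, sum_empty]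
      linarith
    · exact out s₀ hs le_rfl h
  | succ t ht ih =>
    intro ht1
    by_cases h : r ∈ nearRat g L (t + 1)
    · refine (ih (by omega)).trans (mul_le_mul_of_nonneg_left ?_ hA)
      rw [sum_Ico_succ_top ht, if_pos h]
      have : 0 ≤ 1 / √g ^ (t + 1) := by positivity
      linarith
    · exact out _ ht1 (by omega) h

lemma sum_digitCoeff_mul_le {g L : ℕ} (hg : 3 ≤ g) {ω : ℕ → ℝ} {A Y ρ : ℝ} (hA : 0 ≤ A * Y)
    {W : ℕ → ℝ} {s₀ s₁ : ℕ} (hs : s₀ ≤ s₁) (hsL : 2 * s₁ + 4 ≤ L) (hρ : 0 ≤ ρ)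
    (hd : ∀ r, digitCoeff g L ω r ≤ ρ) (hT : ∀ r < g ^ L, W r ≤ A * Y)
    (hW : ∀ s ≤ s₁, ∀ r < g ^ L, r ∉ nearRat g L s → W r ≤ A * Y / √g ^ s)
    (hB : (3 + (2 + 2 * log g) / π) ^ 2 ≤ √g) :
    ∑ r ∈ range (g ^ L), digitCoeff g L ω r * W r ≤ A * Y *
      (((4 + 2 * log g) / π) ^ L / √g ^ s₁
      + (3 + (2 + 2 * log g) / π) ^ 6 * (L + 1) ^ 2 * ((3 + (2 + 2 * log g) / π) ^ 2 / √g) ^ s₀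
      + (L + 1) * (g : ℝ) ^ (2 * s₀ + 4) * ρ) := by
  have hlog : 0 ≤ log g := log_nonneg (by exact_mod_cast (by omega : 1 ≤ g))
  have hg0 : (0 : ℝ) < √g := Real.sqrt_pos.2 (by exact_mod_cast (by omega : 0 < g))
  set B₂ := 3 + (2 + 2 * log g) / π with hB2
  have hB0 : 0 < B₂ := by positivity
  set f := digitCoeff g L ω with hf
  have hf0 : ∀ r, 0 ≤ f r := fun r => digitCoeff_nonneg ..
  have sub : ∀ s, nearRat g L s ⊆ range (g ^ L) := fun s r h => mem_range.2 (mem_nearRat.1 h).1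
  have ind : ∀ s (c : ℝ), ∑ r ∈ range (g ^ L), f r * (if r ∈ nearRat g L s then c else 0)
      = c * ∑ r ∈ nearRat g L s, f r := by
    intro s c
    rw [mul_sum]
    simp only [mul_ite, mul_zero]
    rw [sum_ite_mem, inter_eq_right.2 (sub s)]
    exact sum_congr rfl fun _ _ => mul_comm _ _
  have hmid : ∑ r ∈ range (g ^ L), f r *
      ∑ s ∈ Ico s₀ s₁, (if r ∈ nearRat g L (s + 1) then 1 / √g ^ s else 0)
      ≤ B₂ ^ 6 * (L + 1) ^ 2 * (B₂ ^ 2 / √g) ^ s₀ := by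
    simp only [mul_sum]
    rw [sum_comm]
    calc _ ≤ ∑ s ∈ Ico s₀ s₁, B₂ ^ 6 * (L + 1) * (B₂ ^ 2 / √g) ^ s₀ := by
          refine sum_le_sum fun s hs => ?_
          rw [mem_Ico] at hs
          rw [ind]
          have h1 := (sum_nearRat_le (s := s + 1) (L := L) hg (by omega) ω).1
          have h2 : ((s + 1 : ℕ) : ℝ) + 1 ≤ L + 1 := by
            have : ((s + 1 : ℕ) : ℝ) ≤ L := by exact_mod_cast (by omega : s + 1 ≤ L)
            linarith
          calc _ ≤ 1 / √g ^ s * ((L + 1) * B₂ ^ (2 * (s + 1) + 4)) := by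
                gcongr
                exact h1.trans (by gcongr)
            _ = B₂ ^ 6 * (L + 1) * (B₂ ^ 2 / √g) ^ s := by
                rw [show 2 * (s + 1) + 4 = 2 * s + 6 by ring, pow_add, pow_mul, div_pow]
                field_simp
            _ ≤ _ := by
                gcongr ?_ * ?_
                exact pow_le_pow_of_le_one (by positivity) ((div_le_one hg0).2 hB) hs.1
      _ = ((s₁ - s₀ : ℕ) : ℝ) * (B₂ ^ 6 * (L + 1) * (B₂ ^ 2 / √g) ^ s₀) := by simp
      _ ≤ (L + 1) * (B₂ ^ 6 * (L + 1) * (B₂ ^ 2 / √g) ^ s₀) := by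
          gcongr
          exact_mod_cast (by omega : s₁ - s₀ ≤ L + 1)
      _ = _ := by ring
  have hlast : ∑ r ∈ range (g ^ L), f r * (if r ∈ nearRat g L s₀ then 1 else 0)
      ≤ (L + 1) * (g : ℝ) ^ (2 * s₀ + 4) * ρ := by
    rw [ind, one_mul]
    have h1 := (sum_nearRat_le (s := s₀) (L := L) hg (by omega) ω).2
    have h2 : (s₀ : ℝ) ≤ L := by exact_mod_cast (by omega : s₀ ≤ L)
    calc _ ≤ ∑ r ∈ nearRat g L s₀, ρ := sum_le_sum fun r _ => hd r
      _ = #(nearRat g L s₀) * ρ := by simp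
      _ ≤ (s₀ + 1) * (g : ℝ) ^ (2 * s₀ + 4) * ρ := by gcongr
      _ ≤ _ := by gcongr
  calc _ ≤ ∑ r ∈ range (g ^ L), f r * (A * Y * (1 / √g ^ s₁
        + ∑ s ∈ Ico s₀ s₁, (if r ∈ nearRat g L (s + 1) then 1 / √g ^ s else 0)
        + (if r ∈ nearRat g L s₀ then 1 else 0))) := by
        refine sum_le_sum fun r hr => mul_le_mul_of_nonneg_left ?_ (hf0 r)
        exact digit_sum_pointwise hA hs hT hW (mem_range.1 hr)
    _ = A * Y * ((∑ r ∈ range (g ^ L), f r) / √g ^ s₁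
        + (∑ r ∈ range (g ^ L), f r *
          ∑ s ∈ Ico s₀ s₁, (if r ∈ nearRat g L (s + 1) then 1 / √g ^ s else 0))
        + ∑ r ∈ range (g ^ L), f r * (if r ∈ nearRat g L s₀ then 1 else 0)) := by
        rw [sum_div, ← sum_add_distrib, ← sum_add_distrib, mul_sum]
        exact sum_congr rfl fun r _ => by ring
    _ ≤ _ := by
        refine mul_le_mul_of_nonneg_left ?_ hA
        refine add_le_add (add_le_add ?_ hmid) hlast
        gcongr
        exact sum_digitCoeff_le hg L ω

lemma norm_sum_shift_le (c Y : ℕ) (α : ℝ) :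
    ‖∑ m ∈ range Y, (Λ (c * Y + m) : ℂ) * ex (m * α)‖
      ≤ ‖primeSum ((c + 1) * Y) α‖ + ‖primeSum (c * Y) α‖ := by
  have h : primeSum ((c + 1) * Y) α = primeSum (c * Y) α
      + ex ((c * Y : ℕ) * α) * ∑ m ∈ range Y, (Λ (c * Y + m) : ℂ) * ex (m * α) := by
    unfold primeSum
    rw [add_mul, one_mul, sum_range_add, mul_sum]
    congr 1
    refine sum_congr rfl fun m _ => ?_
    rw [mul_left_comm, ← ex_add]
    congr 2
    push_cast; ring
  have h2 : ‖∑ m ∈ range Y, (Λ (c * Y + m) : ℂ) * ex (m * α)‖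
      = ‖primeSum ((c + 1) * Y) α - primeSum (c * Y) α‖ := by
    rw [h, add_sub_cancel_left, norm_mul, norm_ex, one_mul]
  rw [h2]
  exact norm_sub_le _ _

lemma norm_sum_shift_le_trivial {c Y : ℕ} (hY : 1 ≤ Y) (α : ℝ) :
    ‖∑ m ∈ range Y, (Λ (c * Y + m) : ℂ) * ex (m * α)‖
      ≤ 96 * (c + 1) * (1 + log ((c + 1) * Y)) ^ 4 * Y := by
  have hY' : (1 : ℝ) ≤ Y := by exact_mod_cast hY
  have hc : (0 : ℝ) ≤ c := by positivity
  have hcY : (1 : ℝ) ≤ (c + 1) * Y := by nlinarith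
  have hl : 0 ≤ log ((c + 1) * (Y : ℝ)) := log_nonneg hcY
  have h1 := norm_primeSum_le_trivial ((c + 1) * Y) α
  have h2 := norm_primeSum_le_trivial (c * Y) α
  push_cast at h1 h2
  have h3 : (c * Y : ℝ) * log (c * Y) ≤ (c + 1) * Y * log ((c + 1) * Y) := by
    rcases Nat.eq_zero_or_pos c with rfl | h0
    · simpa using mul_nonneg (by linarith) (log_nonneg hY')
    · have : (1 : ℝ) ≤ c := by exact_mod_cast h0
      have : 0 ≤ log ((c : ℝ) * Y) := log_nonneg (by nlinarith)
      gcongr <;> linarith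
  have h4 : 1 + log ((c + 1) * (Y : ℝ)) ≤ (1 + log ((c + 1) * Y)) ^ 4 :=
    le_self_pow₀ (by linarith) (by norm_num)
  have h5 : ((c : ℝ) + 1) * Y * log ((c + 1) * Y) ≤ (c + 1) * Y * (1 + log ((c + 1) * Y)) ^ 4 := by
    gcongr; linarith
  have h6 : 0 ≤ ((c : ℝ) + 1) * Y * (1 + log ((c + 1) * Y)) ^ 4 := by positivity
  refine (norm_sum_shift_le c Y α).trans ?_
  linarith

lemma norm_sum_shift_le_of_notMem {g c L s r : ℕ} (hg : 1 ≤ g) (hs : 5 * s ≤ 2 * L) (hr : r < g ^ L)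
    (hn : r ∉ nearRat g L s) :
    ‖∑ m ∈ range (g ^ L), (Λ (c * g ^ L + m) : ℂ) * ex (m * -(r / (g : ℝ) ^ L))‖
      ≤ 96 * (c + 1) * (1 + log ((c + 1) * (g ^ L : ℕ))) ^ 4 * (g ^ L : ℕ) / √g ^ s := by
  have hK : 1 ≤ g ^ s := Nat.one_le_pow _ _ hg
  have hY : 1 ≤ g ^ L := Nat.one_le_pow _ _ hg
  have hKY : (g ^ s) ^ 5 ≤ (g ^ L) ^ 2 := by
    rw [← pow_mul, ← pow_mul]; exact Nat.pow_le_pow_right hg (by omega)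
  have hnot : ¬ ∃ d : ℕ, 1 ≤ d ∧ d ≤ g ^ s ∧
      ∃ a : ℤ, |d * (-(r / (g : ℝ) ^ L)) - a| ≤ (g ^ s : ℕ) / (g ^ L : ℕ) := by
    rintro ⟨d, h1, h2, a, h3⟩
    refine hn (mem_nearRat.2 ⟨hr, d, h1, h2, -a, ?_⟩)
    push_cast at h3 ⊢
    rw [← abs_neg]
    convert h3 using 2
    ring
  have sq : √((g ^ s : ℕ) : ℝ) = √g ^ s := by
    rw [← Real.sqrt_sq (show 0 ≤ √(g : ℝ) ^ s by positivity), ← pow_mul, mul_comm, pow_mul,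
      Real.sq_sqrt (by positivity)]
    push_cast; rfl
  have b : ∀ X ≤ (c + 1) * g ^ L, ‖primeSum X (-(r / (g : ℝ) ^ L))‖
      ≤ 48 * (c + 1) * (1 + log ((c + 1) * (g ^ L : ℕ))) ^ 4 * (g ^ L : ℕ) / √g ^ s := by
    intro X hX
    have := (norm_primeSum_le_or (c₀ := c + 1) (by omega) hY hX hK hKY (-(r / (g : ℝ) ^ L))).resolve_right
      hnot
    rw [sq] at this
    exact_mod_cast this
  refine (norm_sum_shift_le c _ _).trans ((add_le_add (b _ le_rfl)
    (b _ (Nat.mul_le_mul_right _ (by omega)))).trans (le_of_eq ?_))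
  ring

/-- Exponential sums over primes in `[c g ^ L, (c + 1) g ^ L)` twisted by a digit phase whose
frequencies are not nearly multiplied by `g` from one digit to the next have power saving. -/
theorem geomDecay_sum_digitPhase {g : ℕ} (hg : 31699 ≤ g) (c : ℕ) {κ : ℝ} (hκ : 0 < κ)
    (ω : ℕ → ℕ → ℝ)
    (hω : ∀ L i, i + 1 < L → ∀ n : ℤ, κ ≤ |ω L (i + 1) - g * ω L i - n|) :
    GeomDecay fun L => ‖∑ m ∈ range (g ^ L),
      (Λ (c * g ^ L + m) : ℂ) * ex (digitPhase g L (ω L) m)‖ / (g : ℝ) ^ L := by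
  have hgR : (31699 : ℝ) ≤ g := by exact_mod_cast hg
  have hg0 : (0 : ℝ) < g := by linarith
  have hsg : 0 < √(g : ℝ) := Real.sqrt_pos.2 hg0
  have hlog : 0 ≤ log g := log_nonneg (by linarith)
  obtain ⟨hB1, hB2⟩ := digit_constants hg
  set B₁ := (4 + 2 * log g) / π with hB1d
  set B₂ := 3 + (2 + 2 * log g) / π with hB2d
  have hB1' : 1 ≤ B₁ := by
    rw [hB1d, one_le_div pi_pos]; linarith [pi_lt_four]
  have hB20 : 0 < B₂ := by positivity
  have hB2' : B₂ ^ 2 < √g := by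
    rw [Real.lt_sqrt (by positivity), ← pow_mul]; exact hB2
  obtain ⟨ρ, hρ0, hρ1, hρ⟩ := exists_digitCoeff_le_pow (by omega : 2 ≤ g) hκ
  obtain ⟨E₀, hE₀⟩ := exists_pow_lt_of_lt_one (show (0 : ℝ) < 1 / g ^ 2 by positivity) hρ1
  set E := E₀ + 3 with hE
  have hx3 : (g : ℝ) ^ 2 * ρ ^ E < 1 := by
    have : ρ ^ E ≤ ρ ^ E₀ := pow_le_pow_of_le_one hρ0.le hρ1.le (by omega)
    calc _ ≤ (g : ℝ) ^ 2 * ρ ^ E₀ := by gcongr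
      _ < (g : ℝ) ^ 2 * (1 / g ^ 2) := by gcongr
      _ = 1 := by field_simp
  have d1 := GeomDecay.pow_div (x := B₁ ^ 5 / g) (by positivity) ((div_lt_one hg0).2 hB1)
    (N := 5) (by norm_num)
  have d2 := GeomDecay.pow_div (x := B₂ ^ 2 / √g) (by positivity) ((div_lt_one hsg).2 hB2')
    (N := 2 * E) (by omega)
  have d3 := GeomDecay.pow_div (x := (g : ℝ) ^ 2 * ρ ^ E) (by positivity) hx3
    (N := 2 * E) (by omega)
  have d := ((((d1.const_mul (c := B₁ ^ 4) (by positivity)).add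
    ((d2.mul_pow 2).const_mul (c := B₂ ^ 6) (by positivity))).add
    ((d3.mul_pow 1).const_mul (c := (g : ℝ) ^ 4) (by positivity))).mul_pow 4).const_mul
    (c := 96 * (c + 1) * (1 + log (c + 1) + log g) ^ 4)
    (by
      have : 0 ≤ log ((c : ℝ) + 1) := log_nonneg (by have : (0 : ℝ) ≤ c := by positivity
                                                     linarith)
      positivity)
  refine d.of_eventually 20 fun L hL => ?_
  have hYpos : (0 : ℝ) < (g : ℝ) ^ L := by positivity
  have hY1 : (1 : ℝ) ≤ (g : ℝ) ^ L := one_le_pow₀ (by linarith)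
  have hc0 : (0 : ℝ) ≤ c := by positivity
  have hlc : 0 ≤ log ((c : ℝ) + 1) := log_nonneg (by linarith)
  set A := 96 * ((c : ℝ) + 1) * (1 + log ((c + 1) * (g ^ L : ℕ))) ^ 4 with hA
  have hlogcY : log ((c + 1) * ((g ^ L : ℕ) : ℝ)) = log (c + 1) + L * log g := by
    push_cast
    rw [log_mul (by positivity) (by positivity), log_pow]
  have hA0 : 0 ≤ A := by
    rw [hA, hlogcY]; positivity
  have hAle : A ≤ 96 * (c + 1) * (1 + log (c + 1) + log g) ^ 4 * (L + 1) ^ 4 := by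
    rw [hA, hlogcY, mul_assoc _ _ (((L : ℝ) + 1) ^ 4), ← mul_pow]
    gcongr
    have h0 : (0 : ℝ) ≤ L := by positivity
    nlinarith
  rw [div_le_iff₀ hYpos]
  refine (norm_sum_mul_digitPhase_le (by omega) L (ω L) _).trans ?_
  have hmain := sum_digitCoeff_mul_le (g := g) (L := L) (ω := ω L) (A := A) (Y := (g ^ L : ℕ))
    (ρ := ρ ^ (L / 2)) (s₀ := L / (2 * E)) (s₁ := 2 * (L / 5))
    (W := fun r => ‖∑ m ∈ range (g ^ L), (Λ (c * g ^ L + m) : ℂ) * ex (m * -(r / (g : ℝ) ^ L))‖)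
    (by omega) (by positivity)
    (by
      have : L / (2 * E) ≤ L / 6 := Nat.div_le_div_left (by omega) (by norm_num)
      omega) (by omega) (by positivity) (hρ L (ω L) (hω L))
    (fun r _ => norm_sum_shift_le_trivial (Nat.one_le_pow _ _ (by omega)) _)
    (fun s hs r hr hn => norm_sum_shift_le_of_notMem (by omega) (by omega) hr hn) hB2'.le
  simp only [mul_neg] at hmain
  refine hmain.trans ?_
  push_cast
  rw [mul_right_comm]
  refine mul_le_mul_of_nonneg_right ?_ hYpos.le
  have e1 : B₁ ^ L / √g ^ (2 * (L / 5)) ≤ B₁ ^ 4 * (B₁ ^ 5 / g) ^ (L / 5) := by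
    rw [pow_mul, Real.sq_sqrt hg0.le, div_pow (B₁ ^ 5), mul_div_assoc', ← pow_mul, ← pow_add]
    gcongr
    omega
  have e3 : (g : ℝ) ^ (2 * (L / (2 * E)) + 4) * ρ ^ (L / 2)
      ≤ g ^ 4 * ((g : ℝ) ^ 2 * ρ ^ E) ^ (L / (2 * E)) := by
    rw [mul_pow, ← pow_mul, ← pow_mul, pow_add, mul_comm _ ((g : ℝ) ^ 4), mul_assoc]
    gcongr ?_ * (?_ * ?_)
    refine pow_le_pow_of_le_one hρ0.le hρ1.le ?_
    rw [← Nat.div_div_eq_div_mul]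
    exact Nat.mul_div_le _ _
  rw [← mul_assoc _ (((L : ℝ) + 1) ^ 4)]
  refine mul_le_mul hAle ?_ (by positivity) (by positivity)
  rw [pow_one, mul_assoc (B₂ ^ 6)]
  refine add_le_add (add_le_add e1 le_rfl) ?_
  rw [mul_assoc, mul_left_comm _ ((L : ℝ) + 1)]
  gcongr

section density

open ArithmeticFunction.vonMangoldt Filter Topology

lemma tendsto_mul_LSeries_residueClass {e : ℕ} [NeZero e] {b : ZMod e} (hb : IsUnit b) (t : ℝ) :
    Tendsto (fun x : ℝ => ((x : ℂ) - 1) * LSeries (fun n => (residueClass b n : ℂ)) (x + t * Complex.I))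
      (𝓝[>] 1) (𝓝 (if t = 0 then (e.totient : ℂ)⁻¹ else 0)) := by
  have h1 : Tendsto (fun x : ℝ => (x : ℂ) - 1) (𝓝[>] 1) (𝓝 0) := by
    have : Tendsto (fun x : ℝ => (x : ℂ) - 1) (𝓝 1) (𝓝 ((1 : ℝ) - 1)) :=
      (Complex.continuous_ofReal.tendsto 1).sub_const 1
    simpa using this.mono_left nhdsWithin_le_nhds
  have h2 : Tendsto (fun x : ℝ => LFunctionResidueClassAux b (x + t * Complex.I)) (𝓝[>] 1)
      (𝓝 (LFunctionResidueClassAux b ((1 : ℝ) + t * Complex.I))) := by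
    refine (continuousOn_LFunctionResidueClassAux b ((1 : ℝ) + t * Complex.I) (by simp)).tendsto.comp ?_
    refine tendsto_nhdsWithin_iff.2 ⟨?_, ?_⟩
    · exact ((Complex.continuous_ofReal.tendsto 1).add_const _).mono_left nhdsWithin_le_nhds
    · filter_upwards [self_mem_nhdsWithin] with x hx
      simpa using (Set.mem_Ioi.1 hx).le
  have h3 : Tendsto (fun x : ℝ => ((x : ℂ) - 1) / (x + t * Complex.I - 1)) (𝓝[>] 1)
      (𝓝 (if t = 0 then 1 else 0)) := by
    split_ifs with ht
    · refine tendsto_const_nhds.congr' ?_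
      filter_upwards [self_mem_nhdsWithin] with x hx
      have : (x : ℂ) - 1 ≠ 0 := by
        rw [sub_ne_zero]
        exact_mod_cast (Set.mem_Ioi.1 hx).ne'
      simp [ht, div_self this]
    · have h4 : Tendsto (fun x : ℝ => (x : ℂ) + t * Complex.I - 1) (𝓝[>] 1)
          (𝓝 (t * Complex.I)) := by
        have : Tendsto (fun x : ℝ => (x : ℂ) - 1 + t * Complex.I) (𝓝[>] 1)
          (𝓝 (0 + t * Complex.I)) := h1.add_const _
        rw [zero_add] at this
        exact this.congr fun x => by ring
      have : Tendsto (fun x : ℝ => ((x : ℂ) - 1) / (x + t * Complex.I - 1)) (𝓝[>] 1)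
          (𝓝 (0 / (t * Complex.I))) := h1.div h4 (by simp [ht])
      rwa [zero_div] at this
  have h5 := (h1.mul h2).add (h3.const_mul (e.totient : ℂ)⁻¹)
  rw [zero_mul, zero_add, mul_ite, mul_one, mul_zero] at h5
  refine h5.congr' ?_
  filter_upwards [self_mem_nhdsWithin] with x hx
  have := eqOn_LFunctionResidueClassAux hb (show (x + t * Complex.I : ℂ) ∈ {s : ℂ | 1 < s.re} by
    simpa using hx)
  simp only at this
  rw [this]
  ring

lemma ex_mul_log_div {G : ℝ} (hG : 1 < G) (k : ℤ) {n : ℕ} (hn : n ≠ 0) (x : ℝ) :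
    (1 : ℂ) / (n : ℂ) ^ (x + ((-(2 * π * k / log G) : ℝ) : ℂ) * Complex.I)
      = ((1 / (n : ℝ) ^ x : ℝ) : ℂ) * ex (k * (log n / log G)) := by
  have hn' : (n : ℂ) ≠ 0 := by exact_mod_cast hn
  have hl : (log G : ℂ) ≠ 0 := by exact_mod_cast (log_pos hG).ne'
  rw [Complex.cpow_add _ _ hn', one_div, mul_inv]
  congr 1
  · push_cast
    rw [Complex.ofReal_cpow (by positivity)]
    simp
  · rw [Complex.cpow_def_of_ne_zero hn', ← Complex.exp_neg, ex, ← Complex.natCast_log]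
    congr 1
    push_cast
    field_simp

/-- Fejér-weighted sums over a residue class. -/
lemma hasSum_fejer {e : ℕ} [NeZero e] {b : ZMod e} {G : ℝ} (hG : 1 < G) (θ : ℝ) (N : ℕ) {x : ℝ}
    (hx : 1 < x) :
    HasSum (fun n : ℕ => ((residueClass b n / (n : ℝ) ^ x *
        ‖∑ j ∈ range N, ex (j * (log n / log G - θ))‖ ^ 2 : ℝ) : ℂ))
      (∑ j ∈ range N, ∑ k ∈ range N, ex (-(((j : ℤ) - k : ℤ) * θ)) *
        LSeries (fun n => (residueClass b n : ℂ))
          (x + ((-(2 * π * ((j : ℤ) - k : ℤ) / log G) : ℝ) : ℂ) * Complex.I)) := by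
  have key : ∀ n : ℕ, ((residueClass b n / (n : ℝ) ^ x *
        ‖∑ j ∈ range N, ex (j * (log n / log G - θ))‖ ^ 2 : ℝ) : ℂ) =
      ∑ j ∈ range N, ∑ k ∈ range N, ex (-(((j : ℤ) - k : ℤ) * θ)) *
        LSeries.term (fun n => (residueClass b n : ℂ))
          (x + ((-(2 * π * ((j : ℤ) - k : ℤ) / log G) : ℝ) : ℂ) * Complex.I) n := by
    intro n
    rcases eq_or_ne n 0 with rfl | hn
    · simp
    have sq : ((‖∑ j ∈ range N, ex (j * (log n / log G - θ))‖ ^ 2 : ℝ) : ℂ)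
        = ∑ j ∈ range N, ∑ k ∈ range N, ex (-(((j : ℤ) - k : ℤ) * θ))
          * ex (((j : ℤ) - k : ℤ) * (log n / log G)) := by
      rw [← Complex.normSq_eq_norm_sq, ← Complex.mul_conj, map_sum, sum_mul_sum]
      refine sum_congr rfl fun j _ => sum_congr rfl fun k _ => ?_
      rw [← ex_neg, ← ex_add, ← ex_add]
      congr 1
      push_cast; ring
    rw [Complex.ofReal_mul, sq, mul_sum]
    refine sum_congr rfl fun j _ => ?_
    rw [mul_sum]
    refine sum_congr rfl fun k _ => ?_
    rw [LSeries.term_of_ne_zero hn, div_eq_mul_one_div (residueClass b n : ℂ), ex_mul_log_div hG _ hn]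
    push_cast
    ring
  simp only [key]
  refine hasSum_sum fun j _ => hasSum_sum fun k _ => HasSum.mul_left _ ?_
  refine LSeriesSummable.LSeriesHasSum (LSeriesSummable_of_abscissaOfAbsConv_lt_re ?_)
  refine (abscissaOfAbsConv_residueClass_le_one b).trans_lt ?_
  simpa using mod_cast hx

lemma tendsto_fejer {e : ℕ} [NeZero e] {b : ZMod e} (hb : IsUnit b) {G : ℝ} (hG : 1 < G)
    (θ : ℝ) (N : ℕ) :
    Tendsto (fun x : ℝ => (x - 1) * ∑' n : ℕ, residueClass b n / (n : ℝ) ^ x *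
        ‖∑ j ∈ range N, ex (j * (log n / log G - θ))‖ ^ 2) (𝓝[>] 1)
      (𝓝 (N * (e.totient : ℝ)⁻¹)) := by
  have hl : log G ≠ 0 := (log_pos hG).ne'
  have h1 : Tendsto (fun x : ℝ => ∑ j ∈ range N, ∑ k ∈ range N, ex (-(((j : ℤ) - k : ℤ) * θ)) *
        (((x : ℂ) - 1) * LSeries (fun n => (residueClass b n : ℂ))
          (x + ((-(2 * π * ((j : ℤ) - k : ℤ) / log G) : ℝ) : ℂ) * Complex.I))) (𝓝[>] 1)
      (𝓝 (∑ j ∈ range N, ∑ k ∈ range N, ex (-(((j : ℤ) - k : ℤ) * θ)) *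
        (if (-(2 * π * ((j : ℤ) - k : ℤ) / log G) : ℝ) = 0 then (e.totient : ℂ)⁻¹ else 0))) :=
    tendsto_finsetSum _ fun j _ => tendsto_finsetSum _ fun k _ =>
      (tendsto_mul_LSeries_residueClass hb _).const_mul _
  have h2 : (∑ j ∈ range N, ∑ k ∈ range N, ex (-(((j : ℤ) - k : ℤ) * θ)) *
        (if (-(2 * π * ((j : ℤ) - k : ℤ) / log G) : ℝ) = 0 then (e.totient : ℂ)⁻¹ else 0))
      = ((N * (e.totient : ℝ)⁻¹ : ℝ) : ℂ) := by
    have : ∀ j ∈ range N, ∑ k ∈ range N, ex (-(((j : ℤ) - k : ℤ) * θ)) *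
        (if (-(2 * π * ((j : ℤ) - k : ℤ) / log G) : ℝ) = 0 then (e.totient : ℂ)⁻¹ else 0)
        = (e.totient : ℂ)⁻¹ := by
      intro j hj
      rw [sum_eq_single_of_mem j hj]
      · simp [ex_zero]
      · intro k _ hk
        rw [if_neg, mul_zero]
        have : (((j : ℤ) - k : ℤ) : ℝ) ≠ 0 := by
          have : (j : ℤ) - k ≠ 0 := by omega
          exact_mod_cast this
        simp [this, hl, pi_ne_zero, -Int.cast_sub]
    rw [sum_congr rfl this]
    simp
  rw [h2] at h1
  have h3 := (Complex.continuous_re.tendsto _).comp h1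
  rw [Complex.ofReal_re] at h3
  refine h3.congr' ?_
  filter_upwards [self_mem_nhdsWithin] with x hx
  have h4 := (hasSum_fejer (b := b) hG θ N (Set.mem_Ioi.1 hx)).tsum_eq
  rw [← Complex.ofReal_tsum] at h4
  have h5 : (∑ j ∈ range N, ∑ k ∈ range N, ex (-(((j : ℤ) - k : ℤ) * θ)) *
        (((x : ℂ) - 1) * LSeries (fun n => (residueClass b n : ℂ))
          (x + ((-(2 * π * ((j : ℤ) - k : ℤ) / log G) : ℝ) : ℂ) * Complex.I)))
      = (((x - 1) * ∑' n : ℕ, residueClass b n / (n : ℝ) ^ x *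
        ‖∑ j ∈ range N, ex (j * (log n / log G - θ))‖ ^ 2 : ℝ) : ℂ) := by
    rw [Complex.ofReal_mul, h4, mul_sum]
    refine sum_congr rfl fun j _ => ?_
    rw [mul_sum]
    refine sum_congr rfl fun k _ => ?_
    push_cast
    ring
  simp only [Function.comp_apply]
  rw [h5, Complex.ofReal_re]

lemma le_abs_sin_pi {δ y : ℝ} (hδ : 0 < δ) (h : ∀ j : ℤ, δ ≤ |y - j|) : δ ≤ |sin (π * y)| := by
  rw [← Int.fract_add_floor y, abs_sin_pi_add_int]
  have h1 := h ⌊y⌋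
  have h2 := h (⌊y⌋ + 1)
  have h3 := Int.fract_lt_one y
  have e : y = Int.fract y + ⌊y⌋ := (Int.fract_add_floor y).symm
  set f := Int.fract y
  push_cast at h2
  have h4 : δ ≤ f := by
    rwa [show y - ⌊y⌋ = f by linarith, abs_of_nonneg (Int.fract_nonneg y)] at h1
  have h5 : δ ≤ 1 - f := by
    rwa [show y - (⌊y⌋ + 1) = f - 1 by linarith, abs_of_neg (by linarith), neg_sub] at h2
  refine le_trans ?_ ((sin_pi_lower (by linarith) h3).trans (le_abs_self _))
  have h6 : δ * (1 / 2) ≤ f * (1 - f) := by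
    rcases le_total f (1 / 2) with h | h <;> nlinarith
  nlinarith [pi_gt_three]

lemma sum_residueClass_div_le {e : ℕ} (b : ZMod e) {G u v : ℕ} (hG : 2 ≤ G) (hu : 0 < u)
    (h : GeomDecay fun M => (∑ n ∈ Ico (u * G ^ M) (v * G ^ M), residueClass b n) / (G : ℝ) ^ M) :
    ∃ B : ℝ, ∀ T : Finset ℕ, (∀ n ∈ T, n < v ∨ ∃ j : ℕ, u * G ^ j ≤ n ∧ n < v * G ^ j) →
      ∑ n ∈ T, residueClass b n / n ≤ B := by
  classical
  obtain ⟨C, l, hC, hl0, hl1, hle⟩ := h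
  have hnn : ∀ n : ℕ, 0 ≤ residueClass b n / n := fun n =>
    div_nonneg (residueClass_nonneg b n) (Nat.cast_nonneg n)
  have hGR : (0 : ℝ) < G := by exact_mod_cast (by omega : 0 < G)
  have huR : (1 : ℝ) ≤ u := by exact_mod_cast hu
  refine ⟨∑ n ∈ range v, residueClass b n / n + C * (1 - l)⁻¹, fun T hT => ?_⟩
  have hsub : T ⊆ range v ∪ (T.image fun n => if h : ∃ j : ℕ, u * G ^ j ≤ n ∧ n < v * G ^ j then
      h.choose else 0).biUnion fun j => Ico (u * G ^ j) (v * G ^ j) := by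
    intro n hn
    rw [mem_union, mem_range]
    by_cases h : ∃ j : ℕ, u * G ^ j ≤ n ∧ n < v * G ^ j
    · right
      rw [mem_biUnion]
      refine ⟨h.choose, mem_image.2 ⟨n, hn, dif_pos h⟩, mem_Ico.2 h.choose_spec⟩
    · exact Or.inl ((hT n hn).resolve_right h)
  set I := T.image fun n => if h : ∃ j : ℕ, u * G ^ j ≤ n ∧ n < v * G ^ j then
      h.choose else 0
  have h1 : ∀ j ∈ I, ∑ n ∈ Ico (u * G ^ j) (v * G ^ j), residueClass b n / n ≤ C * l ^ j := by
    intro j _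
    refine le_trans ?_ (hle j)
    simp only [sum_div]
    refine sum_le_sum fun n hn => ?_
    have h2 : (G : ℝ) ^ j ≤ n := by
      have : G ^ j ≤ n := (Nat.le_mul_of_pos_left _ hu).trans (mem_Ico.1 hn).1
      exact_mod_cast this
    exact div_le_div_of_nonneg_left (residueClass_nonneg b n) (by positivity) h2
  calc _ ≤ ∑ n ∈ range v ∪ I.biUnion fun j => Ico (u * G ^ j) (v * G ^ j), residueClass b n / n :=
        sum_le_sum_of_subset_of_nonneg hsub fun _ _ _ => hnn _
    _ ≤ ∑ n ∈ range v, residueClass b n / n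
        + ∑ n ∈ I.biUnion fun j => Ico (u * G ^ j) (v * G ^ j), residueClass b n / n := by
        rw [← sum_union_inter]
        exact le_add_of_nonneg_right (sum_nonneg fun _ _ => hnn _)
    _ ≤ _ := by
        gcongr
        refine (sum_biUnion_le _ _ hnn).trans ((sum_le_sum h1).trans ?_)
        rw [← mul_sum, ← tsum_geometric_of_lt_one hl0.le hl1]
        gcongr
        exact (summable_geometric_of_lt_one hl0.le hl1).sum_le_tsum _ fun _ _ => by positivity

lemma norm_fejer_sq_le {G u v : ℕ} (hG : 2 ≤ G) (hu : 0 < u) (huv : u < v) (N : ℕ) {n : ℕ}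
    (hn : n ≠ 0) (hn' : ¬ (n < v ∨ ∃ j : ℕ, u * G ^ j ≤ n ∧ n < v * G ^ j)) :
    ‖∑ j ∈ range N, ex (j * (log n / log G - (log u + log v) / (2 * log G)))‖ ^ 2
      ≤ 1 / ((log v - log u) / (2 * log G)) ^ 2 := by
  have hlG : 0 < log G := log_pos (by exact_mod_cast (by omega : 1 < G))
  have hnR : (0 : ℝ) < n := by exact_mod_cast Nat.pos_of_ne_zero hn
  have huR : (0 : ℝ) < u := by exact_mod_cast hu
  have hvR : (0 : ℝ) < v := by exact_mod_cast (by omega : 0 < v)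
  have hGR : (0 : ℝ) < G := by exact_mod_cast (by omega : 0 < G)
  have hluv : log u < log v := log_lt_log huR (by exact_mod_cast huv)
  set δ := (log v - log u) / (2 * log G) with hδ
  have hδ0 : 0 < δ := div_pos (by linarith) (by linarith)
  have hs : δ ≤ |sin (π * (log n / log G - (log u + log v) / (2 * log G)))| := by
    refine le_abs_sin_pi hδ0 fun j => ?_
    by_contra! hlt
    refine hn' ?_
    rw [abs_lt] at hlt
    have e : log n / log G - (log u + log v) / (2 * log G) - j
        = (2 * log n - (log u + log v) - 2 * j * log G) / (2 * log G) := by field_simp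
    rw [e, hδ, ← neg_div, div_lt_div_iff_of_pos_right (by positivity),
      div_lt_div_iff_of_pos_right (by positivity)] at hlt
    obtain ⟨h1, h2⟩ := hlt
    rcases le_or_gt 0 j with hj | hj
    · right
      lift j to ℕ using hj
      push_cast at h1 h2
      refine ⟨j, ?_, ?_⟩
      · have : log ((u : ℝ) * G ^ j) ≤ log n := by
          rw [log_mul huR.ne' (by positivity), log_pow]; linarith
        exact_mod_cast (log_le_log_iff (by positivity) hnR).1 this
      · have : log n < log ((v : ℝ) * G ^ j) := by
          rw [log_mul hvR.ne' (by positivity), log_pow]; linarith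
        exact_mod_cast (log_lt_log_iff hnR (by positivity)).1 this
    · left
      have h3 : (j : ℝ) * log G ≤ 0 := mul_nonpos_of_nonpos_of_nonneg (by exact_mod_cast hj.le) hlG.le
      exact_mod_cast (log_lt_log_iff hnR hvR).1 (by linarith)
  have h1 := norm_sum_ex_mul_sin N (log n / log G - (log u + log v) / (2 * log G))
  set D := ‖∑ j ∈ range N, ex (j * (log n / log G - (log u + log v) / (2 * log G)))‖
  have hD : D * δ ≤ 1 := (mul_le_mul_of_nonneg_left hs (norm_nonneg _)).trans
    (h1.trans_le (abs_sin_le_one _))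
  rw [le_div_iff₀ (by positivity), ← mul_pow]
  exact pow_le_one₀ (by positivity) hD

/-- Primes in a reduced residue class are not power-sparse along a sequence of intervals
with geometrically growing end points. -/
theorem not_geomDecay_residueClass {e : ℕ} [NeZero e] {b : ZMod e} (hb : IsUnit b) {G u v : ℕ}
    (hG : 2 ≤ G) (hu : 0 < u) (huv : u < v) :
    ¬ GeomDecay fun M => (∑ n ∈ Ico (u * G ^ M) (v * G ^ M), residueClass b n) / (G : ℝ) ^ M := by
  intro h
  obtain ⟨B, hB⟩ := sum_residueClass_div_le b hG hu h
  have hGR : (1 : ℝ) < G := by exact_mod_cast (by omega : 1 < G)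
  set θ := (log u + log v) / (2 * log (G : ℝ)) with hθ
  set K := 1 / ((log v - log u) / (2 * log (G : ℝ))) ^ 2 with hK
  set D : ℕ → ℕ → ℝ := fun N n => ‖∑ j ∈ range N, ex (j * (log n / log G - θ))‖ ^ 2 with hD
  have hsum : ∀ N {x : ℝ}, 1 < x → Summable fun n : ℕ => residueClass b n / (n : ℝ) ^ x * D N n :=
    fun N x hx => Complex.summable_ofReal.1 (hasSum_fejer hGR θ N hx).summable
  have hD1 : ∀ n, D 1 n = 1 := fun n => by simp [hD, ex_zero]
  have hDN : ∀ N n, D N n ≤ N ^ 2 := fun N n => by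
    simp only [hD]
    gcongr
    exact norm_sum_ex_le _ _
  have hw : ∀ (x : ℝ) (n : ℕ), 0 ≤ residueClass b n / (n : ℝ) ^ x := fun x n =>
    div_nonneg (residueClass_nonneg b n) (by positivity)
  have bound : ∀ N {x : ℝ}, 1 < x → ∑' n : ℕ, residueClass b n / (n : ℝ) ^ x * D N n
      ≤ K * ∑' n : ℕ, residueClass b n / (n : ℝ) ^ x * D 1 n + N ^ 2 * B := by
    classical
    intro N x hx
    refine Summable.tsum_le_of_sum_le (hsum N hx) fun T => ?_
    rw [← sum_filter_add_sum_filter_not T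
      (fun n => n < v ∨ ∃ j : ℕ, u * G ^ j ≤ n ∧ n < v * G ^ j), add_comm]
    refine add_le_add ?_ ?_
    · calc _ ≤ ∑ n ∈ T with ¬ (n < v ∨ ∃ j : ℕ, u * G ^ j ≤ n ∧ n < v * G ^ j),
            K * (residueClass b n / (n : ℝ) ^ x * D 1 n) := by
            refine sum_le_sum fun n hn => ?_
            rw [hD1, mul_one, mul_comm K]
            refine mul_le_mul_of_nonneg_left ?_ (hw x n)
            have := (mem_filter.1 hn).2
            refine norm_fejer_sq_le hG hu huv N ?_ this
            rintro rfl
            exact this (Or.inl (by omega))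
        _ ≤ K * ∑' n : ℕ, residueClass b n / (n : ℝ) ^ x * D 1 n := by
            rw [← mul_sum]
            refine mul_le_mul_of_nonneg_left ((hsum 1 hx).sum_le_tsum _ fun n _ => ?_) (by positivity)
            exact mul_nonneg (hw x n) (by positivity)
    · calc _ ≤ ∑ n ∈ T with (n < v ∨ ∃ j : ℕ, u * G ^ j ≤ n ∧ n < v * G ^ j),
            (N : ℝ) ^ 2 * (residueClass b n / n) := by
            refine sum_le_sum fun n hn => ?_
            rw [mul_comm]
            rcases Nat.eq_zero_or_pos n with rfl | h0
            · simp
            have h1 : (1 : ℝ) ≤ n := by exact_mod_cast h0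
            have h2 : (n : ℝ) ≤ (n : ℝ) ^ x := by
              simpa using rpow_le_rpow_of_exponent_le h1 hx.le
            refine mul_le_mul (hDN N n) ?_ (hw x n) (by positivity)
            exact div_le_div_of_nonneg_left (residueClass_nonneg b n) (by linarith) h2
        _ ≤ _ := by
            rw [← mul_sum]
            exact mul_le_mul_of_nonneg_left (hB _ fun n hn => (mem_filter.1 hn).2) (by positivity)
  have lim : ∀ N : ℕ, (N : ℝ) * (e.totient : ℝ)⁻¹ ≤ K * (e.totient : ℝ)⁻¹ := by
    intro N
    have t1 := tendsto_fejer hb hGR θ N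
    have t2 := tendsto_fejer hb hGR θ 1
    have t0 : Tendsto (fun x : ℝ => (x - 1) * (N ^ 2 * B)) (𝓝[>] 1) (𝓝 0) := by
      have : Tendsto (fun x : ℝ => (x - 1) * (N ^ 2 * B)) (𝓝 1) (𝓝 ((1 - 1) * (N ^ 2 * B))) :=
        (tendsto_id.sub_const 1).mul_const _
      rw [sub_self, zero_mul] at this
      exact this.mono_left nhdsWithin_le_nhds
    have t3 := (t2.const_mul K).add t0
    simp only [Nat.cast_one, one_mul, add_zero] at t3
    refine le_of_tendsto_of_tendsto t1 t3 ?_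
    filter_upwards [self_mem_nhdsWithin] with x hx
    have hx' : 0 ≤ x - 1 := (sub_pos.2 (Set.mem_Ioi.1 hx)).le
    refine (mul_le_mul_of_nonneg_left (bound N (Set.mem_Ioi.1 hx)) hx').trans (le_of_eq ?_)
    simp only [hD]
    ring
  obtain ⟨N, hN⟩ := exists_nat_gt K
  have hφ : (0 : ℝ) < (e.totient : ℝ)⁻¹ :=
    inv_pos.2 (by exact_mod_cast Nat.totient_pos.2 (Nat.pos_of_ne_zero (NeZero.ne e)))
  have := le_of_mul_le_mul_right (lim N) hφ
  linarith

end density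

/-- The reversal of the lowest `L` base-`g` digits of `m`. -/
def truncRev (g L m : ℕ) : ℕ := ∑ i ∈ range L, (m / g ^ i % g) * g ^ (L - 1 - i)

lemma truncRev_succ (g L m : ℕ) :
    truncRev g (L + 1) m = m / g ^ L % g + g * truncRev g L m := by
  unfold truncRev
  rw [sum_range_succ, mul_sum, add_comm]
  congr 1
  · simp
  · refine sum_congr rfl fun i hi => ?_
    have : L + 1 - 1 - i = (L - 1 - i) + 1 := by have := mem_range.1 hi; omega
    rw [this, pow_succ]
    ring

lemma ofDigits_map_range (g L m : ℕ) :
    Nat.ofDigits g ((List.range L).map fun i => m / g ^ i % g) = m % g ^ L := by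
  induction L with
  | zero => simp [Nat.mod_one]
  | succ L ih =>
    rw [List.range_succ, List.map_append, Nat.ofDigits_append, ih, Nat.mod_pow_succ]
    simp

lemma ofDigits_map_range_reverse (g L m : ℕ) :
    Nat.ofDigits g ((List.range L).map fun i => m / g ^ i % g).reverse = truncRev g L m := by
  induction L with
  | zero => simp [truncRev]
  | succ L ih =>
    rw [List.range_succ, List.map_append, List.reverse_append, truncRev_succ, ← ih]
    simp [Nat.ofDigits_cons]

lemma digitRev_truncRev_mul_pow_add {g : ℕ} (hg : 2 ≤ g) {k a L m : ℕ} (hk : 1 ≤ k) (hm : m < g ^ L)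
    (ha : ¬ g ∣ a) :
    digitRev g (truncRev g k a * g ^ L + m) = a % g ^ k + g ^ k * truncRev g L m := by
  set l : List ℕ := (List.range L).map fun i => m / g ^ i % g with hl
  set r : List ℕ := (List.range k).map fun i => a / g ^ i % g with hr
  have hll : l.length = L := by simp [hl]
  have hrl : r.length = k := by simp [hr]
  have hn : truncRev g k a * g ^ L + m = Nat.ofDigits g (l ++ r.reverse) := by
    rw [Nat.ofDigits_append, hll, ofDigits_map_range, ofDigits_map_range_reverse, Nat.mod_eq_of_lt hm]
    ring
  have hd : Nat.digits g (truncRev g k a * g ^ L + m) = l ++ r.reverse := by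
    rw [hn]
    refine Nat.digits_ofDigits g (by omega) _ ?_ ?_
    · intro x hx
      simp only [List.mem_append, List.mem_reverse, hl, hr, List.mem_map] at hx
      rcases hx with ⟨i, -, rfl⟩ | ⟨i, -, rfl⟩ <;> exact Nat.mod_lt _ (by omega)
    · intro h
      obtain ⟨k, rfl⟩ : ∃ k', k = k' + 1 := ⟨k - 1, by omega⟩
      have : r = (a % g) :: (List.range k).map fun i => a / g ^ (i + 1) % g := by
        simp [hr, List.range_succ_eq_map, Function.comp_def]
      simp only [this, List.reverse_cons, ← List.append_assoc, List.getLast_append_singleton]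
      exact fun h => ha (Nat.dvd_of_mod_eq_zero h)
  rw [digitRev, hd, List.reverse_append, List.reverse_reverse, Nat.ofDigits_append, hrl,
    ofDigits_map_range, ofDigits_map_range_reverse]

lemma mul_truncRev_modEq {g e : ℕ} (he : (g : ℤ) ^ 2 ≡ 1 [ZMOD e]) (L m : ℕ) :
    (g : ℤ) * truncRev g L m ≡ g ^ L * (m % g ^ L : ℕ) [ZMOD e] := by
  induction L with
  | zero => simp [truncRev, Nat.mod_one]
  | succ L ih =>
    rw [truncRev_succ, Nat.mod_pow_succ]
    push_cast at ih ⊢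
    have h2 : ((g : ℤ) ^ 2) ^ L ≡ 1 [ZMOD e] := by simpa using he.pow L
    set d : ℤ := (m : ℤ) / g ^ L % g
    set s : ℤ := (m : ℤ) % g ^ L
    calc (g : ℤ) * (d + g * truncRev g L m) = g * d * 1 + g * (g * truncRev g L m) := by ring
      _ ≡ g * d * ((g : ℤ) ^ 2) ^ L + g * (g ^ L * s) [ZMOD e] :=
        (h2.symm.mul_left _).add (ih.mul_left _)
      _ = g ^ (L + 1) * (s + g ^ L * d) := by ring

lemma exists_factor_pow_coprime (g : ℕ) : ∀ q : ℕ, 0 < q →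
    ∃ q₁ q₂ k : ℕ, q = q₁ * q₂ ∧ 1 ≤ k ∧ q₁ ∣ g ^ k ∧ Nat.Coprime q₂ g := by
  intro q
  induction q using Nat.strong_induction_on with
  | _ q ih =>
    intro hq
    by_cases hc : Nat.Coprime q g
    · exact ⟨1, q, 1, by simp, le_rfl, one_dvd _, hc⟩
    · have hd : Nat.gcd q g ∣ q := Nat.gcd_dvd_left _ _
      have hd1 : 1 < Nat.gcd q g := by
        have := Nat.gcd_pos_of_pos_left g hq
        have : Nat.gcd q g ≠ 1 := hc
        omega
      obtain ⟨q₁, q₂, k, h1, h2, h3, h4⟩ := ih (q / Nat.gcd q g) (Nat.div_lt_self hq hd1)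
        (Nat.div_pos (Nat.le_of_dvd hq hd) (by omega))
      refine ⟨Nat.gcd q g * q₁, q₂, k + 1, ?_, by omega, ?_, h4⟩
      · rw [mul_assoc, ← h1, Nat.mul_div_cancel' hd]
      · rw [pow_succ']
        exact mul_dvd_mul (Nat.gcd_dvd_right _ _) h3

lemma sum_ex_mul_div {q : ℕ} (hq : 0 < q) (D : ℤ) :
    ∑ h ∈ range q, ex (h * D / q) = if (q : ℤ) ∣ D then (q : ℂ) else 0 := by
  have hq0 : (q : ℝ) ≠ 0 := by positivity
  have hqz : (q : ℤ) ≠ 0 := by positivity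
  obtain ⟨m, hm⟩ : ∃ m : ℕ, D % q = m := Int.eq_ofNat_of_zero_le (Int.emod_nonneg D hqz)
  have hmq : m < q := by
    have := Int.emod_lt_of_pos D (by positivity : (0 : ℤ) < q)
    omega
  have h := sum_ex_orthogonal hq hmq
  have hdvd : (q : ℤ) ∣ D ↔ 0 = m := by
    rw [Int.dvd_iff_emod_eq_zero, hm]
    norm_cast
    exact eq_comm
  simp only [hdvd]
  rw [← h]
  refine sum_congr rfl fun r _ => ?_
  have hD : (D : ℝ) = q * (D / q : ℤ) + m := by
    have : D = q * (D / q) + m := by rw [← hm, Int.mul_ediv_add_emod]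
    exact_mod_cast this
  have : (r : ℝ) * D / q = m * (r / (q : ℝ)) + ((r * (D / q) : ℤ) : ℝ) := by
    rw [hD]
    push_cast
    field_simp
    ring
  rw [this, ex_add_int]
  simp [ex_zero]

lemma mul_sum_dvd_le {ι : Type*} (s : Finset ι) {w : ι → ℝ} (D : ι → ℤ)
    {e f : ℕ} (he : 0 < e) (hf : 0 < f) :
    e * ∑ m ∈ s, (if (e : ℤ) ∣ D m then w m else 0) ≤
      (f * e : ℕ) * ∑ m ∈ s, (if ((f * e : ℕ) : ℤ) ∣ D m then w m else 0) +
        ∑ h ∈ range (f * e) with ¬ f ∣ h, ‖∑ m ∈ s, (w m : ℂ) * ex (h * D m / (f * e : ℕ))‖ := by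
  have key : ∀ d : ℕ, 0 < d → (((d : ℝ) * ∑ m ∈ s, (if (d : ℤ) ∣ D m then w m else 0) : ℝ) : ℂ) =
      ∑ h ∈ range d, ∑ m ∈ s, (w m : ℂ) * ex (h * D m / d) := by
    intro d hd
    rw [sum_comm]
    push_cast
    rw [mul_sum]
    refine sum_congr rfl fun m _ => ?_
    rw [← mul_sum, sum_ex_mul_div hd]
    split_ifs <;> simp [mul_comm]
  have hq := key (f * e) (by positivity)
  have hex : ∑ h ∈ range (f * e) with f ∣ h, ∑ m ∈ s, (w m : ℂ) * ex (h * D m / (f * e : ℕ)) =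
      ∑ h ∈ range e, ∑ m ∈ s, (w m : ℂ) * ex (h * D m / e) := by
    rw [sum_filter, sum_range_mul_eq]
    refine sum_congr rfl fun j _ => ?_
    rw [sum_eq_single_of_mem 0 (mem_range.2 hf)]
    · rw [if_pos (by simp)]
      refine sum_congr rfl fun m _ => ?_
      congr 2
      push_cast
      field_simp
      ring
    · intro i hi hi0
      rw [if_neg]
      rw [Nat.dvd_add_left (dvd_mul_right _ _)]
      exact fun h => hi0 (Nat.eq_zero_of_dvd_of_lt h (mem_range.1 hi))
  rw [← sum_filter_add_sum_filter_not (range (f * e)) (fun h => f ∣ h), hex, ← key e he] at hq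
  have h2 : ((e * ∑ m ∈ s, (if (e : ℤ) ∣ D m then w m else 0) : ℝ) : ℂ) =
      (((f * e : ℕ) * ∑ m ∈ s, (if ((f * e : ℕ) : ℤ) ∣ D m then w m else 0) : ℝ) : ℂ) -
      ∑ h ∈ range (f * e) with ¬ f ∣ h, ∑ m ∈ s, (w m : ℂ) * ex (h * D m / (f * e : ℕ)) := by
    rw [hq]
    ring
  have h3 := congrArg Complex.re h2
  rw [Complex.ofReal_re, Complex.sub_re, Complex.ofReal_re] at h3
  rw [h3]
  have h4 := (Complex.abs_re_le_norm (∑ h ∈ range (f * e) with ¬ f ∣ h,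
    ∑ m ∈ s, (w m : ℂ) * ex (h * D m / (f * e : ℕ)))).trans (norm_sum_le _ _)
  have h5 := (abs_le.1 h4).1
  linarith

lemma one_div_le_abs_div_sub {q : ℕ} (hq : 0 < q) {z : ℤ} (hz : ¬ (q : ℤ) ∣ z) (n : ℤ) :
    1 / (q : ℝ) ≤ |(z : ℝ) / q - n| := by
  have hq0 : (0 : ℝ) < q := by positivity
  have h1 : (z : ℝ) / q - n = ((z - q * n : ℤ) : ℝ) / q := by
    push_cast
    field_simp
  rw [h1, abs_div, abs_of_pos hq0]
  gcongr
  have : z - q * n ≠ 0 := fun h => hz ⟨n, by linarith⟩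
  exact_mod_cast Int.one_le_abs this

lemma geomDecay_sum_truncRev {g : ℕ} (hg : 31699 ≤ g) (c k : ℕ) {q h : ℕ} (hq : 0 < q)
    (hqg : Nat.Coprime q g) (hh : ¬ (q : ℤ) ∣ h * ((g : ℤ) ^ 2 - 1)) (A : ℤ) :
    GeomDecay fun L => ‖∑ m ∈ range (g ^ L), (Λ (c * g ^ L + m) : ℂ) *
      ex (h * ((A + g ^ k * truncRev g L m : ℤ) : ℝ) / q)‖ / (g : ℝ) ^ L := by
  have hq0 : (0 : ℝ) < q := by positivity
  set ω : ℕ → ℕ → ℝ := fun L i => (h : ℝ) * g ^ k * g ^ (L - 1 - i) / q with hω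
  refine (geomDecay_sum_digitPhase hg c (κ := 1 / q) (by positivity) ω ?_).mono fun L => ?_
  · intro L i hi n
    obtain ⟨j, rfl⟩ : ∃ j, L = i + 2 + j := ⟨L - (i + 2), by omega⟩
    have e1 : i + 2 + j - 1 - (i + 1) = j := by omega
    have e2 : i + 2 + j - 1 - i = j + 1 := by omega
    have h1 : ω (i + 2 + j) (i + 1) - g * ω (i + 2 + j) i =
        ((-((h * ((g : ℤ) ^ 2 - 1)) * g ^ (k + j)) : ℤ) : ℝ) / q := by
      simp only [hω, e1, e2]
      push_cast
      ring
    rw [h1]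
    refine one_div_le_abs_div_sub hq ?_ n
    rw [dvd_neg]
    intro hd
    refine hh (IsCoprime.dvd_of_dvd_mul_right ?_ hd)
    exact (Nat.isCoprime_iff_coprime.2 hqg).pow_right
  · have : ∀ m, ex (h * ((A + g ^ k * truncRev g L m : ℤ) : ℝ) / q) =
        ex (h * A / q) * ex (digitPhase g L (ω L) m) := by
      intro m
      rw [← ex_add]
      congr 1
      have : (digitPhase g L (ω L) m) = h * g ^ k * truncRev g L m / q := by
        simp only [digitPhase, truncRev, hω]
        push_cast
        rw [mul_sum, sum_div]
        refine sum_congr rfl fun i _ => ?_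
        ring
      rw [this]
      push_cast
      ring
    simp only [this, mul_left_comm _ (ex (h * A / q)), ← mul_sum, norm_mul, norm_ex, one_mul, le_refl]

lemma geomDecay_sum_of_finite {g c : ℕ} (hg : 2 ≤ g) (hc : 1 ≤ c) (T : ℕ → ℕ → Prop)
    [∀ L m, Decidable (T L m)] (P : Finset ℕ)
    (h : ∀ L m, m < g ^ L → T L m → (c * g ^ L + m).Prime → c * g ^ L + m ∈ P) :
    GeomDecay fun L =>
      (∑ m ∈ range (g ^ L), if T L m then Λ (c * g ^ L + m) else 0) / (g : ℝ) ^ L := by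
  have hg1 : (1 : ℝ) < g := by exact_mod_cast hg
  have hg0 : (0 : ℝ) < g := by linarith
  have hs : 1 < √(g : ℝ) := by rw [Real.lt_sqrt] <;> linarith
  have hs0 : 0 < √(g : ℝ) := by linarith
  set x : ℝ := 1 / √(g : ℝ) with hx
  have hx0 : 0 < x := by positivity
  have hx1 : x < 1 := by rw [hx, div_lt_one hs0]; exact hs
  have hCP : 0 ≤ ∑ p ∈ P, Λ p := sum_nonneg fun _ _ => ArithmeticFunction.vonMangoldt_nonneg
  have hlc : 0 ≤ log ((c : ℝ) + 1) := log_nonneg (by linarith [(Nat.cast_nonneg c : (0 : ℝ) ≤ c)])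
  have hlg : 0 ≤ log (g : ℝ) := log_nonneg hg1.le
  have hgd := GeomDecay.pow_div hx0 hx1 (N := 1) one_pos
  refine ((hgd.const_mul hCP).add (hgd.mul_succ.const_mul
    (c := 2 * √((c : ℝ) + 1) * (log ((c : ℝ) + 1) + log g)) (by positivity))).mono fun L => ?_
  rw [Nat.div_one]
  set X : ℝ := ((c : ℝ) + 1) * g ^ L with hX
  have hX1 : 1 ≤ X := by
    have : (1 : ℝ) ≤ (g : ℝ) ^ L := one_le_pow₀ hg1.le
    have : (0 : ℝ) ≤ c := Nat.cast_nonneg c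
    nlinarith
  have hXf : ⌊X⌋₊ = (c + 1) * g ^ L := by
    rw [hX]
    exact_mod_cast Nat.floor_natCast ((c + 1) * g ^ L)
  have hsum : (∑ m ∈ range (g ^ L), if T L m then Λ (c * g ^ L + m) else 0) ≤
      ∑ p ∈ P, Λ p + ∑ n ∈ Ioc 0 ⌊X⌋₊ with ¬ n.Prime, Λ n := by
    have h1 : (∑ m ∈ range (g ^ L), if T L m then Λ (c * g ^ L + m) else 0) ≤
        ∑ m ∈ range (g ^ L), ((if c * g ^ L + m ∈ P then Λ (c * g ^ L + m) else 0) +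
          (if ¬ (c * g ^ L + m).Prime then Λ (c * g ^ L + m) else 0)) := by
      refine sum_le_sum fun m hm => ?_
      have h0 : 0 ≤ Λ (c * g ^ L + m) := ArithmeticFunction.vonMangoldt_nonneg
      have := h L m (mem_range.1 hm)
      split_ifs <;> first | linarith | simp_all
    refine h1.trans ?_
    rw [sum_add_distrib]
    have hinj : Set.InjOn (fun m => c * g ^ L + m) (range (g ^ L)) := fun _ _ _ _ h => by simpa using h
    refine add_le_add ?_ ?_
    · rw [← sum_image (f := fun n => if n ∈ P then Λ n else 0) (g := fun m => c * g ^ L + m) hinj,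
        ← sum_filter]
      refine sum_le_sum_of_subset_of_nonneg ?_ fun _ _ _ => ArithmeticFunction.vonMangoldt_nonneg
      exact fun n hn => (mem_filter.1 hn).2
    · rw [← sum_image (f := fun n => if ¬ n.Prime then Λ n else 0) (g := fun m => c * g ^ L + m) hinj,
        ← sum_filter]
      refine sum_le_sum_of_subset_of_nonneg ?_ fun _ _ _ => ArithmeticFunction.vonMangoldt_nonneg
      refine filter_subset_filter _ fun n hn => ?_
      obtain ⟨m, hm, rfl⟩ := mem_image.1 hn
      rw [hXf, mem_Ioc, add_mul, one_mul]
      have := mem_range.1 hm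
      have : 0 < c * g ^ L := by positivity
      constructor <;> omega
  have hpsi := Chebyshev.psi_sub_theta_le hX1
  rw [Chebyshev.psi_sub_theta_eq_sum_not_prime] at hpsi
  have hgL : (0 : ℝ) < (g : ℝ) ^ L := by positivity
  have hlogX : log X ≤ (log ((c : ℝ) + 1) + log g) * ((L : ℝ) + 1) := by
    rw [hX, log_mul (by positivity) hgL.ne', log_pow]
    nlinarith [mul_nonneg hlc (Nat.cast_nonneg L : (0 : ℝ) ≤ L)]
  have hsX : √X = √((c : ℝ) + 1) * √g ^ L := by
    have : (g : ℝ) ^ L = (√g ^ L) ^ 2 := by rw [← pow_mul, mul_comm, pow_mul, sq_sqrt hg0.le]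
    rw [hX, Real.sqrt_mul (by positivity), this, Real.sqrt_sq (by positivity)]
  have hxL : x ^ L * (g : ℝ) ^ L = √g ^ L := by
    rw [← mul_pow]
    congr 1
    rw [hx, div_mul_eq_mul_div, one_mul, div_sqrt]
  have hone : (1 : ℝ) ≤ √g ^ L := one_le_pow₀ hs.le
  rw [div_le_iff₀ hgL, add_mul]
  calc _ ≤ _ := hsum
    _ ≤ (∑ p ∈ P, Λ p) * √g ^ L + 2 * √X * ((log ((c : ℝ) + 1) + log g) * ((L : ℝ) + 1)) := by
      refine add_le_add (le_mul_of_one_le_right hCP hone) (hpsi.trans ?_)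
      gcongr
    _ = _ := by
      rw [hsX, ← hxL]
      ring

lemma natCast_modEq_digitRev {g e : ℕ} (hg : 2 ≤ g) (he : (g : ℤ) ^ 2 ≡ 1 [ZMOD e]) {k a L m : ℕ}
    (hk : 1 ≤ k) (hkL : Odd (k + L)) (hm : m < g ^ L) (ha : ¬ g ∣ a) :
    ((truncRev g k a * g ^ L + m : ℕ) : ℤ) ≡
      digitRev g (truncRev g k a * g ^ L + m) [ZMOD e] := by
  rw [digitRev_truncRev_mul_pow_add hg hk hm ha]
  have hodd : (g : ℤ) ^ (k + L) ≡ g [ZMOD e] := by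
    obtain ⟨j, hj⟩ := hkL
    rw [hj, pow_succ, pow_mul]
    simpa using (he.pow j).mul_right (g : ℤ)
  have hm' := mul_truncRev_modEq he L m
  have ha' := mul_truncRev_modEq he k a
  rw [Nat.mod_eq_of_lt hm] at hm'
  have key : (g : ℤ) * (truncRev g k a * g ^ L + m : ℕ) ≡
      g * (a % g ^ k + g ^ k * truncRev g L m : ℕ) [ZMOD e] := by
    calc (g : ℤ) * (truncRev g k a * g ^ L + m : ℕ)
        = g * truncRev g k a * g ^ L + g * m := by push_cast; ring
      _ ≡ g ^ k * (a % g ^ k : ℕ) * g ^ L + g ^ (k + L) * m [ZMOD e] :=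
        (ha'.mul_right _).add (hodd.symm.mul_right _)
      _ = g ^ (k + L) * (a % g ^ k : ℕ) + g ^ k * (g ^ L * m) := by ring
      _ ≡ g * (a % g ^ k : ℕ) + g ^ k * (g * truncRev g L m) [ZMOD e] :=
        (hodd.mul_right _).add (hm'.symm.mul_left _)
      _ = g * (a % g ^ k + g ^ k * truncRev g L m : ℕ) := by push_cast; ring
  have cancel : ∀ z : ℤ, (g : ℤ) * (g * z) ≡ z [ZMOD e] := fun z => by
    have := he.mul_right z
    rwa [one_mul, sq, mul_assoc] at this
  exact ((cancel _).symm.trans (key.mul_left _)).trans (cancel _)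

lemma exists_natCast_modEq_not_dvd {g q₁ q₂ : ℕ} {a : ℤ} (hq : 0 < q₁ * q₂)
    (h : ¬ g ∣ Int.gcd a (q₁ * q₂ : ℕ)) :
    ∃ b : ℕ, (b : ℤ) ≡ a [ZMOD q₁] ∧ ¬ g ∣ b := by
  obtain ⟨b, hb⟩ : ∃ b : ℕ, (b : ℤ) ≡ a [ZMOD (q₁ * q₂ : ℕ)] :=
    ⟨(a % (q₁ * q₂ : ℕ)).toNat, by
      rw [Int.toNat_of_nonneg (Int.emod_nonneg _ (by positivity))]
      exact Int.mod_modEq _ _⟩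
  have hb1 : (b : ℤ) ≡ a [ZMOD q₁] := hb.of_dvd (by push_cast; exact dvd_mul_right _ _)
  by_cases h1 : g ∣ b
  · refine ⟨b + q₁, ?_, fun h2 => h ?_⟩
    · push_cast
      simpa using hb1
    · have h3 : g ∣ q₁ * q₂ := ((Nat.dvd_add_right h1).1 h2).mul_right _
      have h4 : (g : ℤ) ∣ (q₁ * q₂ : ℕ) := by exact_mod_cast h3
      have h5 : (g : ℤ) ∣ a := (hb.of_dvd h4).dvd_iff.1 (by exact_mod_cast h1)
      exact Int.dvd_gcd h5 h4
  · exact ⟨b, hb1, h1⟩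

theorem stmt_2 (g : ℕ) (a q : ℤ) (hg : 31699 ≤ g) (hq : 1 ≤ q)
    (h1 : Int.gcd a (Int.gcd q ((g : ℤ) ^ 2 - 1) : ℤ) = 1)
    (h2 : ¬ (g ∣ Int.gcd a q)) :
    {p : ℕ | p.Prime ∧ (digitRev g p : ℤ) ≡ a [ZMOD q]}.Infinite := by
  intro hfin
  have hg0 : 0 < g := by omega
  obtain ⟨Q, rfl⟩ : ∃ Q : ℕ, q = Q := ⟨q.toNat, by omega⟩
  have hQ : 0 < Q := by omega
  obtain ⟨q₁, q₂, k, rfl, hk, hq₁, hq₂⟩ := exists_factor_pow_coprime g Q hQ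
  obtain ⟨b, hb, hgb⟩ := exists_natCast_modEq_not_dvd hQ h2
  have hq₂0 : 0 < q₂ := Nat.pos_of_mul_pos_left hQ
  set c := truncRev g k b with hc
  have hc1 : 1 ≤ c := by
    have h3 : 0 < b % g := Nat.pos_of_ne_zero fun h => hgb (Nat.dvd_of_mod_eq_zero h)
    have h4 : (b / g ^ 0 % g) * g ^ (k - 1 - 0) ≤ truncRev g k b :=
      single_le_sum (f := fun i => (b / g ^ i % g) * g ^ (k - 1 - i)) (fun _ _ => Nat.zero_le _)
        (mem_range.2 (by omega))
    refine le_trans ?_ h4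
    rw [pow_zero, Nat.div_one]
    exact Nat.mul_pos h3 (by positivity)
  set A : ℤ := (b % g ^ k : ℕ) - a with hA
  set D : ℕ → ℕ → ℤ := fun L m => A + g ^ k * truncRev g L m with hD
  have hrev : ∀ L m, m < g ^ L → D L m = digitRev g (c * g ^ L + m) - a := by
    intro L m hm
    rw [hc, digitRev_truncRev_mul_pow_add (by omega) hk hm hgb, hD, hA]
    push_cast
    ring
  set e : ℕ := Int.gcd q₂ ((g : ℤ) ^ 2 - 1) with hedef
  have heq : e ∣ q₂ := by
    have : (e : ℤ) ∣ q₂ := Int.gcd_dvd_left _ _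
    exact_mod_cast this
  have heg : (e : ℤ) ∣ (g : ℤ) ^ 2 - 1 := Int.gcd_dvd_right _ _
  have he0 : 0 < e := Nat.pos_of_dvd_of_pos heq hq₂0
  have : NeZero e := ⟨he0.ne'⟩
  obtain ⟨f, hf⟩ : ∃ f, q₂ = f * e := by
    obtain ⟨f, hf⟩ := heq
    exact ⟨f, by rw [hf, mul_comm]⟩
  have hf0 : 0 < f := Nat.pos_of_ne_zero fun h => by simp [h] at hf; omega
  have hunit : IsUnit ((a : ℤ) : ZMod e) := by
    rw [ZMod.coe_int_isUnit_iff_isCoprime]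
    have h3 : IsCoprime a (Int.gcd ((q₁ * q₂ : ℕ) : ℤ) ((g : ℤ) ^ 2 - 1) : ℤ) :=
      Int.isCoprime_iff_gcd_eq_one.2 h1
    refine (h3.of_isCoprime_of_dvd_right ?_).symm
    refine Int.dvd_coe_gcd ?_ heg
    push_cast
    exact (Int.natCast_dvd_natCast.2 heq).mul_left _
  have hA_decay : GeomDecay fun L =>
      (∑ m ∈ range (g ^ L), if (q₂ : ℤ) ∣ D L m then Λ (c * g ^ L + m) else 0) / (g : ℝ) ^ L := by
    refine geomDecay_sum_of_finite (by omega) hc1 (fun L m => (q₂ : ℤ) ∣ D L m) hfin.toFinset ?_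
    intro L m hm hT hp
    rw [Set.Finite.mem_toFinset]
    refine ⟨hp, ?_⟩
    push_cast
    refine (Int.modEq_and_modEq_iff_modEq_mul ?_).1 ⟨?_, ?_⟩
    · simpa using (Nat.Coprime.pow_right k hq₂).symm.coprime_dvd_left hq₁
    · rw [hc, digitRev_truncRev_mul_pow_add (by omega) hk hm hgb]
      refine Int.ModEq.trans ?_ hb
      rw [Int.natCast_modEq_iff]
      have h3 : b % g ^ k ≡ b [MOD q₁] := (Nat.mod_modEq b (g ^ k)).of_dvd hq₁
      simpa using h3.add ((Nat.modEq_zero_iff_dvd.2 hq₁).mul_right (truncRev g L m))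
    · rw [hrev L m hm] at hT
      exact (Int.modEq_iff_dvd.2 hT).symm
  have hE_decay : GeomDecay fun L =>
      (∑ m ∈ range (g ^ L), if (e : ℤ) ∣ D L m then Λ (c * g ^ L + m) else 0) / (g : ℝ) ^ L := by
    have hS := GeomDecay.sum (range q₂ |>.filter fun h => ¬ f ∣ h) (f := fun h L =>
      ‖∑ m ∈ range (g ^ L), (Λ (c * g ^ L + m) : ℂ) *
        ex (h * ((A + g ^ k * truncRev g L m : ℤ) : ℝ) / q₂)‖ / (g : ℝ) ^ L) (by
      intro h hh
      refine geomDecay_sum_truncRev hg c k hq₂0 hq₂ ?_ A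
      intro hdvd
      refine (mem_filter.1 hh).2 ?_
      have h3 : (q₂ : ℤ) ∣ h * e := by
        rw [hedef, Int.gcd_eq_gcd_ab, mul_add, ← mul_assoc, ← mul_assoc]
        exact dvd_add ((dvd_mul_left _ _).mul_right _) (hdvd.mul_right _)
      rw [hf] at h3
      have h4 : f * e ∣ h * e := by exact_mod_cast h3
      exact Nat.dvd_of_mul_dvd_mul_right he0 h4)
    refine ((hA_decay.const_mul (c := q₂) (by positivity)).add hS).mono fun L => ?_
    have h3 := mul_sum_dvd_le (range (g ^ L)) (w := fun m => Λ (c * g ^ L + m)) (D L) he0 hf0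
    rw [← hf] at h3
    rw [← sum_div, ← mul_div_assoc, ← add_div]
    refine div_le_div_of_nonneg_right ?_ (by positivity)
    refine le_trans ?_ h3
    refine le_mul_of_one_le_left ?_ (by exact_mod_cast he0)
    refine sum_nonneg fun m _ => ?_
    split_ifs
    exacts [ArithmeticFunction.vonMangoldt_nonneg, le_rfl]
  set j := (k + 1) % 2 with hj
  obtain ⟨C, lam, hC, hl0, hl1, hdecay⟩ := hE_decay
  refine not_geomDecay_residueClass hunit (G := g ^ 2) (u := c * g ^ j) (v := (c + 1) * g ^ j)
    (by nlinarith) (by positivity) (by gcongr; omega) ?_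
  refine ⟨g ^ j * C * lam ^ j, lam ^ 2, by positivity, by positivity, by nlinarith, fun M => ?_⟩
  have h3 := hdecay (j + 2 * M)
  beta_reduce at h3 ⊢
  have hpow : ∀ x : ℕ, x * g ^ j * (g ^ 2) ^ M = x * g ^ (j + 2 * M) := fun x => by ring
  rw [hpow, hpow]
  have hgp : (0 : ℝ) < (g : ℝ) ^ (j + 2 * M) := by positivity
  have hsum : ∑ n ∈ Ico (c * g ^ (j + 2 * M)) ((c + 1) * g ^ (j + 2 * M)),
      ArithmeticFunction.vonMangoldt.residueClass ((a : ℤ) : ZMod e) n =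
      ∑ m ∈ range (g ^ (j + 2 * M)),
        if (e : ℤ) ∣ D (j + 2 * M) m then Λ (c * g ^ (j + 2 * M) + m) else 0 := by
    rw [sum_Ico_eq_sum_range]
    have : (c + 1) * g ^ (j + 2 * M) - c * g ^ (j + 2 * M) = g ^ (j + 2 * M) := by
      rw [add_mul, one_mul, Nat.add_sub_cancel_left]
    rw [this]
    refine sum_congr rfl fun m hm => ?_
    have hm := mem_range.1 hm
    have hmod := natCast_modEq_digitRev (e := e) (a := b) (k := k) (by omega : 2 ≤ g)
      (Int.modEq_iff_dvd.2 heg).symm hk (by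
        rw [Nat.odd_iff, hj]
        omega) hm hgb
    rw [← hc] at hmod
    have hiff : (e : ℤ) ∣ D (j + 2 * M) m ↔
        ((c * g ^ (j + 2 * M) + m : ℕ) : ZMod e) = ((a : ℤ) : ZMod e) := by
      rw [hrev _ m hm, ← Int.cast_natCast (R := ZMod e), ZMod.intCast_eq_intCast_iff,
        ← Int.modEq_iff_dvd]
      exact ⟨fun h => hmod.trans h.symm, fun h => (hmod.symm.trans h).symm⟩
    simp only [hiff, ArithmeticFunction.vonMangoldt.residueClass, Set.indicator_apply,
      Set.mem_ofPred_eq]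
  rw [hsum]
  rw [div_le_iff₀ hgp] at h3
  push_cast
  rw [div_le_iff₀ (by positivity)]
  refine h3.trans (le_of_eq ?_)
  ring
end

section
/- Let α be a real number that is not an integer, and set i₀ = ⌊ log( g/((g+1)·‖α‖) ) / log g ⌋. Then ‖g^{i₀}·α‖ ≥ 1/(g+1). -/
/-- `‖x‖`: the distance from `x` to the nearest integer. -/
noncomputable def dnear (x : ℝ) : ℝ := |x - round x|

theorem dnear_pos {x : ℝ} (hx : ∀ n : ℤ, x ≠ n) : 0 < dnear x :=
  abs_pos.mpr (sub_ne_zero.mpr (hx _))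

/-- If `c ≤ |t| ≤ 1 - c`, then `t` has distance at least `c` to every integer. -/
theorem le_abs_sub_intCast {t c : ℝ} (h₁ : c ≤ |t|) (h₂ : |t| ≤ 1 - c) (m : ℤ) :
    c ≤ |t - m| := by
  rcases eq_or_ne m 0 with rfl | hm
  · simpa using h₁
  · have hm₁ : (1 : ℝ) ≤ |(m : ℝ)| := by exact_mod_cast Int.one_le_abs hm
    have := abs_sub_abs_le_abs_sub (m : ℝ) t
    rw [abs_sub_comm] at this
    linarith

/-- Multiplication by an integer `k` with `c ≤ |k| * ‖x‖ ≤ 1 - c` gives `‖k * x‖ ≥ c`. -/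
theorem le_dnear_intCast_mul {x c : ℝ} (k : ℤ) (h₁ : c ≤ |(k : ℝ)| * dnear x)
    (h₂ : |(k : ℝ)| * dnear x ≤ 1 - c) : c ≤ dnear (k * x) := by
  rw [dnear, ← abs_mul] at h₁ h₂
  have h := le_abs_sub_intCast h₁ h₂ (round (k * x) - k * round x)
  rw [dnear]
  convert h using 2
  push_cast
  ring

/-- The floor of the base-`b` logarithm of `y` is the exponent of the largest power of `b`
not exceeding `y`. -/
theorem zpow_floor_log_div_log_bounds {b y : ℝ} (hb : 1 < b) (hy : 0 < y) :
    b ^ ⌊Real.log y / Real.log b⌋ ≤ y ∧ y < b ^ (⌊Real.log y / Real.log b⌋ + 1) := by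
  have hb₀ : 0 < b := by linarith
  have hlog : 0 < Real.log b := Real.log_pos hb
  constructor
  · rw [← Real.log_le_log_iff (by positivity) hy, Real.log_zpow, ← le_div_iff₀ hlog]
    exact Int.floor_le _
  · rw [← Real.log_lt_log_iff hy (by positivity), Real.log_zpow, ← div_lt_iff₀ hlog]
    push_cast
    exact Int.lt_floor_add_one _

theorem stmt_9 (g : ℕ) (hg : 2 ≤ g) (α : ℝ) (hα : ∀ n : ℤ, α ≠ n) :
    dnear ((g : ℝ) ^
        (⌊Real.log ((g : ℝ) / (((g : ℝ) + 1) * dnear α)) / Real.log g⌋ : ℤ) * α) ≥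
      1 / ((g : ℝ) + 1) := by
  have hg₂ : (2 : ℝ) ≤ g := by exact_mod_cast hg
  have hd : 0 < dnear α := dnear_pos hα
  have hd₂ : dnear α ≤ 1 / 2 := abs_sub_round α
  have hy : 1 ≤ (g : ℝ) / (((g : ℝ) + 1) * dnear α) := by
    rw [le_div_iff₀ (by positivity)]
    nlinarith
  obtain ⟨h₁, h₂⟩ := zpow_floor_log_div_log_bounds (b := g) (by linarith) (by linarith)
  have hi : 0 ≤ ⌊Real.log ((g : ℝ) / (((g : ℝ) + 1) * dnear α)) / Real.log g⌋ :=
    Int.floor_nonneg.mpr (div_nonneg (Real.log_nonneg hy) (Real.log_nonneg (by linarith)))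
  obtain ⟨n, hn⟩ := Int.eq_ofNat_of_zero_le hi
  rw [hn] at h₁ h₂ ⊢
  rw [le_div_iff₀ (by positivity), zpow_natCast] at h₁
  rw [div_lt_iff₀ (by positivity), zpow_add_one₀ (by positivity), zpow_natCast] at h₂
  have h := le_dnear_intCast_mul (x := α) (c := 1 / ((g : ℝ) + 1)) ((g : ℤ) ^ n)
  push_cast at h
  rw [abs_of_nonneg (by positivity)] at h
  rw [zpow_natCast]
  apply h
  · rw [div_le_iff₀ (by positivity)]
    nlinarith
  · rw [one_sub_div (by positivity), le_div_iff₀ (by positivity)]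
    linarith
end
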